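/- arXiv:1508.05547 — 2 statements merged into one kernel-verified Lean document; each statement's English description precedes it below -/
import Mathlib

section
/- For every integer k ≥ 3, there exist infinitely many squarefree natural numbers n with exactly k − 1 distinct prime factors such that φ(n) divides (n − 1)^k but φ(n) does not divide (n − 1)^{k−1}; that is, the set L_k \ L_{k−1} contains infinitely many integers with exactly k − 1 prime factors. -/
section

open Complex DirichletCharacter

lemma norm_cpow_add_sub_cpow_le {x y : ℝ} (hx : 0 < x) (hy : 0 ≤ y) {z : ℂ} (hz : 0 < z.re) :
    ‖((x + y : ℝ) : ℂ) ^ (-z) - (x : ℂ) ^ (-z)‖ ≤ ‖z‖ * x ^ (-z.re - 1) * y := by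
  have hderiv : ∀ t ∈ Set.Icc x (x + y), HasDerivWithinAt (fun t : ℝ ↦ (t : ℂ) ^ (-z))
      ((-z) * (t : ℂ) ^ (-z - 1)) (Set.Icc x (x + y)) t := by
    intro t ht
    have ht0 : t ≠ 0 := (hx.trans_le ht.1).ne'
    have hz0 : -z ≠ 0 := by
      intro h
      have : z = 0 := by simpa using h
      simp [this] at hz
    exact (hasDerivAt_ofReal_cpow_const ht0 hz0).hasDerivWithinAt
  have hbound : ∀ t ∈ Set.Icc x (x + y), ‖(-z) * (t : ℂ) ^ (-z - 1)‖ ≤ ‖z‖ * x ^ (-z.re - 1) := by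
    intro t ht
    have ht0 : 0 < t := hx.trans_le ht.1
    rw [norm_mul, norm_neg, norm_cpow_eq_rpow_re_of_pos ht0]
    simp only [sub_re, neg_re, one_re]
    gcongr ?_ * ?_
    exact Real.rpow_le_rpow_of_nonpos hx ht.1 (by linarith)
  have := (convex_Icc x (x + y)).norm_image_sub_le_of_norm_hasDerivWithin_le hderiv hbound
    (Set.left_mem_Icc.2 (by linarith)) (Set.right_mem_Icc.2 (by linarith))
  simpa [abs_of_nonneg hy] using this

namespace DirichletCharacter

/-- The part of the Dirichlet series of `χ` coming from the integers in `[N m, N (m + 1))`. -/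
noncomputable def seriesBlock {N : ℕ} [NeZero N] (χ : DirichletCharacter ℂ N) (m : ℕ) (z : ℂ) :
    ℂ :=
  ∑ j : ZMod N, χ j * ((j.val + N * m : ℕ) : ℂ) ^ (-z)

variable {N : ℕ} [NeZero N] {χ : DirichletCharacter ℂ N}

lemma one_lt_level (hχ : χ ≠ 1) : 1 < N := by
  have := NeZero.pos N
  by_contra! h
  obtain rfl : N = 1 := by omega
  exact hχ (level_one χ)

lemma LFunction_eq_tsum_seriesBlock (hχ : χ ≠ 1) {z : ℂ} (hz : 1 < z.re) :
    LFunction χ z = ∑' m, seriesBlock χ m z := by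
  have hN := one_lt_level hχ
  have hz0 : z ≠ 0 := by rintro rfl; simp at hz; linarith
  have hs := LSeriesSummable_of_one_lt_re χ hz
  have hterm : LSeries.term (χ ·) z = fun n : ℕ ↦ χ n * (n : ℂ) ^ (-z) := by
    ext n
    rcases eq_or_ne n 0 with rfl | hn
    · have : z ≠ 0 := hz0
      simp [this]
    · rw [LSeries.term_of_ne_zero hn, cpow_neg, div_eq_mul_inv]
  rw [LFunction_eq_LSeries χ hz, LSeries]
  unfold LSeriesSummable at hs
  rw [hterm] at hs ⊢
  rw [Nat.sumByResidueClasses hs N, ← Summable.tsum_finsetSum]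
  · simp [seriesBlock]
  · intro j _
    refine hs.comp_injective (i := fun m ↦ j.val + N * m) ?_
    intro a b hab
    have : N * a = N * b := by simpa using hab
    exact Nat.eq_of_mul_eq_mul_left (NeZero.pos N) this

lemma norm_seriesBlock_succ_le (hχ : χ ≠ 1) {z : ℂ} (hz : 0 < z.re) (m : ℕ) :
    ‖seriesBlock χ (m + 1) z‖ ≤ ‖z‖ * (N : ℝ) ^ (1 - z.re) * ((m : ℝ) + 1) ^ (-z.re - 1) := by
  have hN0 : (0 : ℝ) < N := by exact_mod_cast NeZero.pos N
  have hsum : ∑ j : ZMod N, χ j = 0 := χ.sum_eq_zero_of_ne_one hχ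
  set x : ℝ := N * (m + 1) with hx
  have hx0 : 0 < x := by positivity
  have h1 : seriesBlock χ (m + 1) z =
      ∑ j : ZMod N, χ j * (((x + j.val : ℝ) : ℂ) ^ (-z) - (x : ℂ) ^ (-z)) := by
    simp_rw [mul_sub, Finset.sum_sub_distrib, ← Finset.sum_mul, hsum, zero_mul, sub_zero]
    refine Finset.sum_congr rfl fun j _ ↦ ?_
    congr 2
    push_cast [hx]
    ring
  rw [h1]
  calc _ ≤ ∑ j : ZMod N, ‖z‖ * x ^ (-z.re - 1) * N := by
        refine norm_sum_le_of_le _ fun j _ ↦ ?_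
        rw [norm_mul]
        refine (mul_le_of_le_one_left (norm_nonneg _) (χ.norm_le_one j)).trans ?_
        refine (norm_cpow_add_sub_cpow_le hx0 (Nat.cast_nonneg _) hz).trans ?_
        gcongr
        exact (ZMod.val_lt j).le
    _ = ‖z‖ * (N : ℝ) ^ (1 - z.re) * ((m : ℝ) + 1) ^ (-z.re - 1) := by
        rw [Finset.sum_const, Finset.card_univ, ZMod.card, nsmul_eq_mul, hx,
          Real.mul_rpow hN0.le (by positivity),
          show (1 - z.re) = (-z.re - 1) + 1 + 1 by ring, Real.rpow_add hN0, Real.rpow_add hN0,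
          Real.rpow_one]
        ring

lemma differentiable_seriesBlock (hχ : χ ≠ 1) (m : ℕ) : Differentiable ℂ (seriesBlock χ m) := by
  have hN := one_lt_level hχ
  unfold seriesBlock
  refine Differentiable.fun_sum fun j _ ↦ ?_
  rcases eq_or_ne (j.val + N * m) 0 with h | h
  · have hj : j = 0 := by
      rw [← ZMod.val_eq_zero]; omega
    have : Nontrivial (ZMod N) := by
      have : Fact (1 < N) := ⟨hN⟩
      infer_instance
    have : χ j = 0 := by rw [hj]; exact χ.map_nonunit not_isUnit_zero
    simp [this]
  · have h' : ((j.val + N * m : ℕ) : ℂ) ≠ 0 := by exact_mod_cast h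
    exact (Differentiable.const_cpow (by fun_prop) (Or.inl h')).const_mul _

lemma LFunction_eq_seriesBlock_zero_add_tsum (hχ : χ ≠ 1) {z : ℂ} (hz : 1 / 3 < z.re)
    (hz1 : ‖z - 1‖ < 2) :
    Summable (fun m ↦ ‖seriesBlock χ (m + 1) z‖) ∧
      LFunction χ z = seriesBlock χ 0 z + ∑' m, seriesBlock χ (m + 1) z := by
  set U : Set ℂ := {z | 1 / 3 < z.re} ∩ Metric.ball 1 2 with hU
  have hUo : IsOpen U := (isOpen_lt continuous_const continuous_re).inter Metric.isOpen_ball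
  have hUc : Convex ℝ U := (convex_halfSpace_re_gt _).inter (convex_ball _ _)
  have hN1 : (1 : ℝ) ≤ N := by exact_mod_cast NeZero.one_le
  let u : ℕ → ℝ := fun m ↦ 3 * N * ((m : ℝ) + 1) ^ (-(4 / 3) : ℝ)
  have hu : Summable u := by
    refine Summable.mul_left _ ?_
    have := (summable_nat_add_iff 1).2 (Real.summable_nat_rpow (p := -(4 / 3)).2 (by norm_num))
    simpa using this
  have hbd : ∀ m, ∀ w ∈ U, ‖seriesBlock χ (m + 1) w‖ ≤ u m := by
    rintro m w ⟨hw, hw1⟩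
    have hw : 1 / 3 < w.re := hw
    have hw1 : ‖w - 1‖ < 2 := by simpa [dist_eq_norm] using hw1
    have hw3 : ‖w‖ ≤ 3 := by
      have := norm_add_le (w - 1) 1
      simp at this
      linarith
    refine (norm_seriesBlock_succ_le hχ (by linarith) m).trans ?_
    have h1 : (N : ℝ) ^ (1 - w.re) ≤ N := by
      conv_rhs => rw [← Real.rpow_one (N : ℝ)]
      exact Real.rpow_le_rpow_of_exponent_le hN1 (by linarith)
    have h2 : ((m : ℝ) + 1) ^ (-w.re - 1) ≤ ((m : ℝ) + 1) ^ (-(4 / 3) : ℝ) :=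
      Real.rpow_le_rpow_of_exponent_le (by linarith [(Nat.cast_nonneg m : (0 : ℝ) ≤ m)])
        (by linarith)
    simp only [u]
    gcongr
  have hdiff : DifferentiableOn ℂ (fun w ↦ seriesBlock χ 0 w + ∑' m, seriesBlock χ (m + 1) w) U :=
    (differentiable_seriesBlock hχ 0).differentiableOn.add
      (differentiableOn_tsum_of_summable_norm hu
        (fun m ↦ (differentiable_seriesBlock hχ (m + 1)).differentiableOn) hUo hbd)
  have hsm : ∀ w ∈ U, Summable (fun m ↦ ‖seriesBlock χ (m + 1) w‖) := fun w hw ↦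
    hu.of_nonneg_of_le (fun _ ↦ norm_nonneg _) (fun m ↦ hbd m w hw)
  have hzU : z ∈ U := ⟨hz, by simpa [dist_eq_norm] using hz1⟩
  refine ⟨hsm z hzU, ?_⟩
  have h2U : (2 : ℂ) ∈ U := by
    refine ⟨by norm_num [Set.mem_ofPred_eq], ?_⟩
    rw [Metric.mem_ball, dist_eq_norm]; norm_num
  have key := AnalyticOnNhd.eqOn_of_preconnected_of_eventuallyEq (𝕜 := ℂ)
    ((differentiable_LFunction hχ).differentiableOn.analyticOnNhd hUo)
    (hdiff.analyticOnNhd hUo) hUc.isPreconnected h2U ?_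
  · exact key hzU
  · have : U ∩ {w : ℂ | 1 < w.re} ∈ nhds (2 : ℂ) :=
      (hUo.inter (isOpen_lt continuous_const continuous_re)).mem_nhds ⟨h2U, by norm_num⟩
    filter_upwards [this] with w hw
    rw [LFunction_eq_tsum_seriesBlock hχ hw.2]
    have hs : Summable (fun m ↦ seriesBlock χ m w) :=
      (summable_nat_add_iff 1).1 (hsm w hw.1).of_norm
    exact hs.tsum_eq_zero_add

lemma norm_seriesBlock_zero_le (hχ : χ ≠ 1) {z : ℂ} (hz : 1 - z.re ≤ 1 / (2 + Real.log N)) :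
    ‖seriesBlock χ 0 z‖ ≤ Real.exp 1 * (1 + Real.log N) := by
  have hN := one_lt_level hχ
  have hN1 : (1 : ℝ) < N := by exact_mod_cast hN
  have hL : 0 ≤ Real.log N := Real.log_nonneg hN1.le
  have hNt : Nontrivial (ZMod N) := by
    have : Fact (1 < N) := ⟨hN⟩
    infer_instance
  have hterm (j : ZMod N) : ‖χ j * ((j.val + N * 0 : ℕ) : ℂ) ^ (-z)‖ ≤
      Real.exp 1 * ((j.val : ℝ))⁻¹ := by
    rcases eq_or_ne j 0 with rfl | hj
    · rw [χ.map_nonunit not_isUnit_zero]; simp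
    · have hj0 : (0 : ℝ) < j.val := by
        exact_mod_cast Nat.pos_of_ne_zero (by simpa [ZMod.val_eq_zero] using hj)
      have hj1 : (1 : ℝ) ≤ j.val := by exact_mod_cast hj0
      have hjN : (j.val : ℝ) ≤ N := by exact_mod_cast (ZMod.val_lt j).le
      rw [norm_mul]
      refine (mul_le_of_le_one_left (norm_nonneg _) (χ.norm_le_one j)).trans ?_
      have : (((j.val + N * 0 : ℕ) : ℂ)) = ((j.val : ℝ) : ℂ) := by
        rw [mul_zero, add_zero, ofReal_natCast]
      rw [this, norm_cpow_eq_rpow_re_of_pos hj0, neg_re,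
        show -z.re = (1 - z.re) + (-1) by ring, Real.rpow_add hj0, Real.rpow_neg_one]
      gcongr
      calc (j.val : ℝ) ^ (1 - z.re) ≤ (j.val : ℝ) ^ (1 / (2 + Real.log N)) :=
            Real.rpow_le_rpow_of_exponent_le hj1 hz
        _ ≤ (N : ℝ) ^ (1 / (2 + Real.log N)) := by gcongr
        _ ≤ Real.exp 1 := by
            rw [Real.rpow_def_of_pos (by linarith)]
            apply Real.exp_le_exp.2
            rw [mul_one_div, div_le_one (by linarith)]
            linarith
  have hsum : ∑ j : ZMod N, ((j.val : ℝ))⁻¹ = ∑ i ∈ Finset.range N, ((i : ℝ))⁻¹ := by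
    refine Finset.sum_nbij (fun j : ZMod N ↦ j.val) (fun j _ ↦ Finset.mem_range.2 (ZMod.val_lt j))
      (fun a _ b _ h ↦ ZMod.val_injective N h) (fun i hi ↦ ?_) (fun _ _ ↦ rfl)
    exact ⟨(i : ZMod N), by simp, ZMod.val_cast_of_lt (Finset.mem_range.1 hi)⟩
  refine (norm_sum_le_of_le _ fun j _ ↦ hterm j).trans ?_
  rw [← Finset.mul_sum, hsum]
  gcongr
  obtain ⟨M, rfl⟩ : ∃ M, N = M + 1 := ⟨N - 1, by omega⟩
  rw [Finset.sum_range_succ']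
  have h1 := harmonic_le_one_add_log M
  have h2 : Real.log M ≤ Real.log (M + 1 : ℕ) := by
    have : 0 < M := by omega
    apply Real.log_le_log <;> norm_cast
    omega
  simp only [harmonic] at h1
  push_cast at h1 h2 ⊢
  simp only [inv_zero, add_zero]
  linarith

lemma exists_norm_LFunction_le : ∃ C : ℝ, 1 ≤ C ∧ ∀ (N : ℕ) [NeZero N]
    (χ : DirichletCharacter ℂ N), χ ≠ 1 → ∀ z : ℂ, ‖z - 1‖ ≤ 1 / (2 + Real.log N) →
      ‖LFunction χ z‖ ≤ C * (2 + Real.log N) := by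
  set S : ℝ := ∑' m : ℕ, ((m : ℝ) + 1) ^ (-(3 / 2) : ℝ) with hS
  have hsum : Summable fun m : ℕ ↦ ((m : ℝ) + 1) ^ (-(3 / 2) : ℝ) := by
    have := (summable_nat_add_iff 1).2 (Real.summable_nat_rpow (p := -(3 / 2)).2 (by norm_num))
    simpa using this
  have hS0 : 0 ≤ S := tsum_nonneg fun m ↦ by positivity
  have he : 1 ≤ Real.exp 1 := Real.one_le_exp zero_le_one
  refine ⟨Real.exp 1 * (1 + 2 * S), by nlinarith, fun N _ χ hχ z hz ↦ ?_⟩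
  have hN1 : (1 : ℝ) < N := by exact_mod_cast one_lt_level hχ
  have hL : 0 ≤ Real.log N := Real.log_nonneg hN1.le
  have h2 : 1 / (2 + Real.log N) ≤ 1 / 2 := by gcongr; linarith
  have hre : |1 - z.re| ≤ ‖z - 1‖ := by
    rw [abs_sub_comm]; simpa using abs_re_le_norm (z - 1)
  have hre' := (abs_le.1 hre).2
  have hz2 : ‖z‖ ≤ 2 := by
    have := norm_add_le (z - 1) 1
    simp at this
    linarith
  obtain ⟨hs, heq⟩ := LFunction_eq_seriesBlock_zero_add_tsum hχ (z := z) (by linarith) (by linarith)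
  have hNp : (N : ℝ) ^ (1 - z.re) ≤ Real.exp 1 := by
    refine (Real.rpow_le_rpow_of_exponent_le hN1.le (hre'.trans hz)).trans ?_
    rw [Real.rpow_def_of_pos (by linarith)]
    apply Real.exp_le_exp.2
    rw [mul_one_div, div_le_one (by linarith)]
    linarith
  have htail : ∑' m, ‖seriesBlock χ (m + 1) z‖ ≤ 2 * Real.exp 1 * S := by
    rw [hS, ← tsum_mul_left]
    refine hs.tsum_le_tsum (fun m ↦ ?_) (hsum.mul_left _)
    refine (norm_seriesBlock_succ_le hχ (by linarith) m).trans ?_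
    have : ((m : ℝ) + 1) ^ (-z.re - 1) ≤ ((m : ℝ) + 1) ^ (-(3 / 2) : ℝ) :=
      Real.rpow_le_rpow_of_exponent_le (by linarith [(Nat.cast_nonneg m : (0 : ℝ) ≤ m)])
        (by linarith)
    gcongr
  rw [heq]
  refine (norm_add_le _ _).trans ?_
  have h0 := norm_seriesBlock_zero_le hχ (z := z) (hre'.trans hz)
  have h1 := (norm_tsum_le_tsum_norm hs).trans htail
  nlinarith [mul_nonneg (mul_nonneg (zero_le_one.trans he) hS0) hL]

end DirichletCharacter

lemma tsum_nat_add_one_rpow_le {x : ℝ} (hx : 0 < x) :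
    ∑' m : ℕ, ((m : ℝ) + 1) ^ (-(1 + x)) ≤ 1 + 1 / x := by
  have h := ZetaAsymptotics.zeta_limit_aux1 (s := 1 + x) (by linarith)
  have h0 : 0 ≤ ZetaAsymptotics.termTSum (1 + x) :=
    tsum_nonneg fun n ↦ ZetaAsymptotics.term_nonneg _ _
  have h1 : ∑' m : ℕ, ((m : ℝ) + 1) ^ (-(1 + x)) = ∑' n : ℕ, 1 / ((n : ℝ) + 1) ^ (1 + x) := by
    refine tsum_congr fun m ↦ ?_
    rw [Real.rpow_neg (by positivity), one_div]
  rw [h1]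
  have h2 : 1 / (1 + x - 1) = 1 / x := by congr 1; ring
  have h3 : 0 ≤ (1 + x) * ZetaAsymptotics.termTSum (1 + x) := by positivity
  linarith

lemma summable_nat_add_one_rpow {x : ℝ} (hx : 0 < x) :
    Summable fun m : ℕ ↦ ((m : ℝ) + 1) ^ (-(1 + x)) := by
  have := (summable_nat_add_iff 1).2 (Real.summable_nat_rpow (p := -(1 + x)).2 (by linarith))
  simpa using this

namespace DirichletCharacter

variable {N : ℕ} [NeZero N] {χ : DirichletCharacter ℂ N}

lemma norm_LFunctionTrivChar_one_add_le {x : ℝ} (hx : 0 < x) :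
    ‖LFunctionTrivChar N (1 + x)‖ ≤ 1 + 1 / x := by
  have hre : 1 < ((1 : ℂ) + x).re := by simpa using hx
  rw [LFunctionTrivChar, LFunction_eq_LSeries _ hre, LSeries]
  have hs : Summable (LSeries.term ((1 : DirichletCharacter ℂ N) ·) (1 + x)) :=
    LSeriesSummable_of_one_lt_re _ hre
  have hle (m : ℕ) : ‖LSeries.term ((1 : DirichletCharacter ℂ N) ·) (1 + x) (m + 1)‖ ≤
      ((m : ℝ) + 1) ^ (-(1 + x)) := by
    rw [LSeries.norm_term_eq, if_neg (Nat.succ_ne_zero m), Real.rpow_neg (by positivity),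
      div_eq_mul_inv]
    refine (mul_le_of_le_one_left (by positivity) (norm_le_one _ _)).trans (le_of_eq ?_)
    simp
  have h0 : LSeries.term ((1 : DirichletCharacter ℂ N) ·) (1 + x) 0 = 0 := LSeries.term_zero _ _
  generalize LSeries.term ((1 : DirichletCharacter ℂ N) ·) (1 + x) = f at hs hle h0
  rw [hs.tsum_eq_zero_add, h0, zero_add]
  exact (tsum_of_norm_bounded (summable_nat_add_one_rpow hx).hasSum hle).trans
    (tsum_nat_add_one_rpow_le hx)

lemma exists_norm_deriv_LFunction_div_le_of_sq_ne_one : ∃ c : ℝ, 0 < c ∧ ∀ (N : ℕ) [NeZero N]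
    (χ : DirichletCharacter ℂ N), χ ^ 2 ≠ 1 → ∀ z : ℂ, ‖z - 1‖ ≤ c / (2 + Real.log N) ^ 9 →
      LFunction χ z ≠ 0 ∧
        ‖deriv (LFunction χ) z / LFunction χ z‖ ≤ (2 + Real.log N) ^ 9 / (2 * c) := by
  obtain ⟨C, hC1, hC⟩ := exists_norm_LFunction_le
  set c : ℝ := 1 / (8 * C) ^ 5 with hc
  have hc0 : 0 < c := by positivity
  have hcC : (8 * C) ^ 5 * c = 1 := by rw [hc]; field_simp
  have hc2 : c ≤ 1 / 2 := by
    rw [hc]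
    have : (8 : ℝ) ≤ (8 * C) ^ 5 := (by linarith : (8 : ℝ) ≤ 8 * C).trans
      (le_self_pow₀ (by linarith) (by norm_num))
    gcongr; linarith
  refine ⟨c, hc0, fun N _ χ hχ2 z hz ↦ ?_⟩
  have hχ : χ ≠ 1 := fun h ↦ hχ2 (by rw [h, one_pow])
  have hN1 : (1 : ℝ) < N := by exact_mod_cast one_lt_level hχ
  have hlog : 0 ≤ Real.log N := Real.log_nonneg hN1.le
  have hCN := hC N
  set ℓ : ℝ := 2 + Real.log N with hℓ
  have hℓ2 : 2 ≤ ℓ := by linarith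
  have hℓ0 : 0 < ℓ := by linarith
  set δ : ℝ := c / ℓ ^ 9 with hδ
  have hδ0 : 0 < δ := by positivity
  have hδ1 : δ ≤ 1 / (2 * ℓ) := by
    rw [hδ, div_le_div_iff₀ (by positivity) (by positivity)]
    have : ℓ ≤ ℓ ^ 9 := le_self_pow₀ (by linarith) (by norm_num)
    nlinarith
  have hδ2 : δ ≤ 1 := hδ1.trans (by rw [div_le_one (by positivity)]; linarith)
  have hhalf : 1 / (2 * ℓ) + 1 / (2 * ℓ) = 1 / ℓ := by field_simp; norm_num
  have hderiv : ∀ w : ℂ, ‖w - 1‖ ≤ 1 / (2 * ℓ) → ‖deriv (LFunction χ) w‖ ≤ 2 * C * ℓ ^ 2 := by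
    intro w hw
    have := norm_deriv_le_of_forall_mem_sphere_norm_le (f := LFunction χ) (c := w)
      (R := 1 / (2 * ℓ)) (C := C * ℓ) (by positivity) (differentiable_LFunction hχ).diffContOnCl
      (fun y hy ↦ hCN χ hχ y ?_)
    · refine this.trans (le_of_eq ?_)
      field_simp
    · have hy' : ‖y - w‖ = 1 / (2 * ℓ) := by simpa [dist_eq_norm] using hy
      calc ‖y - 1‖ ≤ ‖y - w‖ + ‖w - 1‖ := by
            simpa using norm_add_le (y - w) (w - 1)
        _ ≤ 1 / ℓ := by rw [← hhalf]; linarith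
  set w : ℂ := 1 + δ with hw
  have hwn : ‖w - 1‖ = δ := by simp [hw, abs_of_pos hδ0]
  have hlip : ‖LFunction χ z - LFunction χ w‖ ≤ 2 * C * ℓ ^ 2 * ‖z - w‖ := by
    refine (convex_closedBall (1 : ℂ) (1 / (2 * ℓ))).norm_image_sub_le_of_norm_deriv_le
      (fun x _ ↦ (differentiable_LFunction hχ) x) (fun x hx ↦ hderiv x ?_) ?_ ?_
    · simpa [dist_eq_norm] using hx
    · rw [Metric.mem_closedBall, dist_eq_norm, hwn]; exact hδ1
    · rw [Metric.mem_closedBall, dist_eq_norm]; exact hz.trans hδ1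
  have hzw : ‖z - w‖ ≤ 2 * δ := by
    calc ‖z - w‖ = ‖(z - 1) - (w - 1)‖ := by congr 1; ring
      _ ≤ ‖z - 1‖ + ‖w - 1‖ := norm_sub_le _ _
      _ ≤ 2 * δ := by rw [hwn]; linarith
  have hlow : 8 * C * c / ℓ ^ 7 ≤ ‖LFunction χ w‖ := by
    by_contra! hlt
    have h341 := norm_LFunction_product_ge_one (N := N) χ hδ0 0
    simp only [ofReal_zero, mul_zero, add_zero, norm_mul, norm_pow] at h341
    have h1 : ‖LFunctionTrivChar N (1 + δ)‖ ≤ 2 / δ := by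
      refine (norm_LFunctionTrivChar_one_add_le hδ0).trans ?_
      rw [show (2 : ℝ) / δ = 1 / δ + 1 / δ by ring]
      gcongr
      rwa [one_le_div hδ0]
    have h2 : ‖LFunction (χ ^ 2) (1 + δ)‖ ≤ C * ℓ :=
      hCN _ hχ2 _ (by rw [← hw, hwn]; exact hδ1.trans (by gcongr; linarith))
    have h3 : ‖LFunction χ w‖ ^ 4 < (8 * C * c / ℓ ^ 7) ^ 4 :=
      pow_lt_pow_left₀ hlt (norm_nonneg _) (by norm_num)
    have : (2 / δ) ^ 3 * (8 * C * c / ℓ ^ 7) ^ 4 * (C * ℓ) = 1 := by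
      rw [hδ]
      field_simp
      linear_combination hcC
    have h4 : ‖LFunctionTrivChar N (1 + δ)‖ ^ 3 * ‖LFunction χ w‖ ^ 4 *
        ‖LFunction (χ ^ 2) (1 + δ)‖ < 1 := by
      calc _ ≤ (2 / δ) ^ 3 * ‖LFunction χ w‖ ^ 4 * (C * ℓ) := by gcongr
        _ < (2 / δ) ^ 3 * (8 * C * c / ℓ ^ 7) ^ 4 * (C * ℓ) := by gcongr
        _ = 1 := this
    linarith
  have hLz : 4 * C * c / ℓ ^ 7 ≤ ‖LFunction χ z‖ := by
    have h1 : 2 * C * ℓ ^ 2 * ‖z - w‖ ≤ 4 * C * c / ℓ ^ 7 := by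
      calc _ ≤ 2 * C * ℓ ^ 2 * (2 * δ) := by gcongr
        _ = _ := by rw [hδ]; field_simp; norm_num
    have h2 := norm_sub_norm_le (LFunction χ w) (LFunction χ z)
    rw [norm_sub_rev] at h2
    have h3 : 8 * C * c / ℓ ^ 7 = 2 * (4 * C * c / ℓ ^ 7) := by ring
    linarith
  have hpos : 0 < 4 * C * c / ℓ ^ 7 := by positivity
  refine ⟨norm_pos_iff.1 (hpos.trans_le hLz), ?_⟩
  rw [norm_div]
  calc _ ≤ 2 * C * ℓ ^ 2 / (4 * C * c / ℓ ^ 7) := by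
        gcongr
        exact hderiv z (hz.trans hδ1)
    _ = _ := by field_simp; norm_num

end DirichletCharacter

namespace DirichletCharacter

lemma changeLevel_factor_of_sq_eq_one {Q N J : ℕ} [NeZero N] (hQ : _root_.Odd Q) (hQN : Q ∣ N)
    (hNQ : N ∣ Q ^ J) {χ : DirichletCharacter ℂ N} (hχ : χ ^ 2 = 1) :
    ∃ χ₀ : DirichletCharacter ℂ Q, χ = changeLevel hQN χ₀ := by
  suffices h : χ.FactorsThrough Q from ⟨h.χ₀, h.eq_changeLevel⟩
  rw [factorsThrough_iff_ker_unitsMap hQN]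
  intro u hu
  rw [MonoidHom.mem_ker] at hu ⊢
  have hcast : (((u : ZMod N).val : ℤ) : ZMod Q) = ((1 : ℤ) : ZMod Q) := by
    have := congrArg (fun v : (ZMod Q)ˣ ↦ (v : ZMod Q)) hu
    simpa [ZMod.unitsMap_def] using this
  have hdvd : (Q : ℤ) ∣ ((u : ZMod N).val : ℤ) - 1 := by
    have := (ZMod.intCast_eq_intCast_iff_dvd_sub _ _ _).1 hcast
    rw [← dvd_neg]; simpa using this
  have hpow := dvd_sub_pow_of_dvd_sub hdvd J
  have hN : (N : ℤ) ∣ ((u : ZMod N).val : ℤ) ^ Q ^ J - 1 ^ Q ^ J :=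
    ((Int.natCast_dvd_natCast.2 hNQ).trans (by
      push_cast; exact pow_dvd_pow _ (Nat.le_succ J))).trans hpow
  have hu1 : u ^ Q ^ J = 1 := by
    ext
    have := (ZMod.intCast_zmod_eq_zero_iff_dvd _ _).2 hN
    push_cast at this
    simpa [sub_eq_zero] using this
  have h1 : χ.toUnitHom u ^ Q ^ J = 1 := by rw [← map_pow, hu1, map_one]
  have h2 : χ.toUnitHom u ^ 2 = 1 := by
    ext
    rw [Units.val_pow_eq_pow_val, MulChar.coe_toUnitHom, ← MulChar.pow_apply_coe, hχ,
      MulChar.one_apply_coe, Units.val_one]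
  obtain ⟨t, ht⟩ : _root_.Odd (Q ^ J) := Odd.pow hQ
  rwa [ht, pow_add, pow_mul, h2, one_pow, one_mul, pow_one] at h1

variable {Q N J : ℕ} [NeZero Q] [NeZero N]

lemma primeFactors_eq_of_dvd_pow (hQN : Q ∣ N) (hNQ : N ∣ Q ^ J) :
    N.primeFactors = Q.primeFactors := by
  refine Finset.Subset.antisymm ?_ (Nat.primeFactors_mono hQN (NeZero.ne N))
  intro p hp
  exact Nat.mem_primeFactors.2 ⟨Nat.prime_of_mem_primeFactors hp,
    (Nat.prime_of_mem_primeFactors hp).dvd_of_dvd_pow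
      ((Nat.dvd_of_mem_primeFactors hp).trans hNQ), NeZero.ne Q⟩

lemma LFunction_changeLevel_of_dvd_pow (hQN : Q ∣ N) (hNQ : N ∣ Q ^ J)
    (χ : DirichletCharacter ℂ Q) {s : ℂ} (h : χ ≠ 1 ∨ s ≠ 1) :
    LFunction (changeLevel hQN χ) s = LFunction χ s := by
  rw [LFunction_changeLevel hQN χ h, Finset.prod_eq_one, mul_one]
  intro p hp
  rw [primeFactors_eq_of_dvd_pow hQN hNQ] at hp
  have : ¬ IsUnit ((p : ℕ) : ZMod Q) := by
    rw [ZMod.isUnit_iff_coprime]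
    intro hc
    exact (Nat.prime_of_mem_primeFactors hp).one_lt.ne'
      (Nat.Coprime.eq_one_of_dvd hc (Nat.dvd_of_mem_primeFactors hp))
  rw [χ.map_nonunit this, zero_mul, sub_zero]

lemma LFunctionTrivChar₁_eq_of_dvd_pow (hQN : Q ∣ N) (hNQ : N ∣ Q ^ J) :
    LFunctionTrivChar₁ N = LFunctionTrivChar₁ Q := by
  unfold LFunctionTrivChar₁
  rw [primeFactors_eq_of_dvd_pow hQN hNQ]
  ext s
  rcases eq_or_ne s 1 with rfl | hs
  · simp
  · rw [Function.update_of_ne hs, Function.update_of_ne hs, LFunctionTrivChar, LFunctionTrivChar,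
      ← changeLevel_one hQN, LFunction_changeLevel_of_dvd_pow hQN hNQ _ (.inr hs)]

lemma eventually_norm_deriv_div_le {f : ℂ → ℂ} (hf : Differentiable ℂ f) {z : ℂ} (hz : f z ≠ 0) :
    ∃ B : ℝ, ∀ᶠ w in nhds z, f w ≠ 0 ∧ ‖deriv f w / f w‖ ≤ B := by
  have hc : ContinuousAt (fun w ↦ ‖deriv f w / f w‖) z :=
    (((hf.contDiff (n := 1)).continuous_deriv le_rfl).continuousAt.div
      hf.continuous.continuousAt hz).norm
  refine ⟨‖deriv f z / f z‖ + 1, (hf.continuous.continuousAt.eventually_ne hz).and ?_⟩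
  filter_upwards [hc.eventually_lt_const (lt_add_one _)] with w hw using hw.le

variable (Q) in
lemma exists_norm_deriv_div_le_level : ∃ r : ℝ, 0 < r ∧ ∀ z : ℂ, ‖z - 1‖ ≤ r →
    (LFunctionTrivChar₁ Q z ≠ 0 ∧
      ‖deriv (LFunctionTrivChar₁ Q) z / LFunctionTrivChar₁ Q z‖ ≤ 1 / r) ∧
    ∀ χ : DirichletCharacter ℂ Q, χ ≠ 1 →
      LFunction χ z ≠ 0 ∧ ‖deriv (LFunction χ) z / LFunction χ z‖ ≤ 1 / r := by
  obtain ⟨B₀, h₀⟩ := eventually_norm_deriv_div_le (differentiable_LFunctionTrivChar₁ Q)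
    (LFunctionTrivChar₁_apply_one_ne_zero Q)
  have hχ (χ : DirichletCharacter ℂ Q) : ∃ B : ℝ, χ ≠ 1 → ∀ᶠ z in nhds (1 : ℂ),
      LFunction χ z ≠ 0 ∧ ‖deriv (LFunction χ) z / LFunction χ z‖ ≤ B := by
    by_cases h : χ = 1
    · exact ⟨0, fun h' ↦ absurd h h'⟩
    · obtain ⟨B, hB⟩ := eventually_norm_deriv_div_le (differentiable_LFunction h)
        (LFunction_apply_one_ne_zero h)
      exact ⟨B, fun _ ↦ hB⟩
  choose B hB using hχ
  have hall : ∀ᶠ z in nhds (1 : ℂ), ∀ χ : DirichletCharacter ℂ Q, χ ≠ 1 →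
      LFunction χ z ≠ 0 ∧ ‖deriv (LFunction χ) z / LFunction χ z‖ ≤ B χ := by
    refine Filter.eventually_all.2 fun χ ↦ ?_
    by_cases h : χ = 1
    · simp [h]
    · filter_upwards [hB χ h] with z hz _ using hz
  obtain ⟨ε, hε, hball⟩ := Metric.eventually_nhds_iff.1 (h₀.and hall)
  set M : ℝ := 1 + |B₀| + ∑ χ : DirichletCharacter ℂ Q, |B χ| with hM
  have hsum : 0 ≤ ∑ χ : DirichletCharacter ℂ Q, |B χ| := Finset.sum_nonneg fun _ _ ↦ abs_nonneg _
  have hM0 : 0 < M := by positivity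
  have hr : 0 < min (ε / 2) (1 / M) := by positivity
  have hMr : M ≤ 1 / min (ε / 2) (1 / M) := by
    rw [le_one_div hM0 hr]
    exact min_le_right _ _
  refine ⟨min (ε / 2) (1 / M), hr, fun z hz ↦ ?_⟩
  obtain ⟨⟨h1, h2⟩, h3⟩ := hball (y := z) (by
    rw [dist_eq_norm]; linarith [min_le_left (ε / 2) (1 / M)])
  refine ⟨⟨h1, h2.trans (le_trans ?_ hMr)⟩, fun χ hχ ↦ ⟨(h3 χ hχ).1,
    (h3 χ hχ).2.trans (le_trans ?_ hMr)⟩⟩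
  · linarith [le_abs_self B₀]
  · have := Finset.single_le_sum (f := fun χ : DirichletCharacter ℂ Q ↦ |B χ|)
      (fun _ _ ↦ abs_nonneg _) (Finset.mem_univ χ)
    linarith [le_abs_self (B χ), abs_nonneg B₀]

variable (Q) in
lemma exists_norm_deriv_div_le_of_dvd_pow (hQ : _root_.Odd Q) : ∃ c : ℝ, 0 < c ∧
    ∀ (N : ℕ) [NeZero N] (J : ℕ), Q ∣ N → N ∣ Q ^ J → ∀ δ : ℝ, 0 < δ →
      δ ≤ c / (2 + Real.log N) ^ 9 → ∀ z : ℂ, ‖z - 1‖ ≤ δ →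
    (LFunctionTrivChar₁ N z ≠ 0 ∧
      ‖deriv (LFunctionTrivChar₁ N) z / LFunctionTrivChar₁ N z‖ ≤ 1 / δ) ∧
    ∀ χ : DirichletCharacter ℂ N, χ ≠ 1 →
      LFunction χ z ≠ 0 ∧ ‖deriv (LFunction χ) z / LFunction χ z‖ ≤ 1 / δ := by
  obtain ⟨r, hr, H⟩ := exists_norm_deriv_div_le_level Q
  obtain ⟨c, hc, Hc⟩ := exists_norm_deriv_LFunction_div_le_of_sq_ne_one
  refine ⟨min r c, lt_min hr hc, fun N _ J hQN hNQ δ hδ0 hδ z hz ↦ ?_⟩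
  have hlog : 0 ≤ Real.log N := Real.log_natCast_nonneg N
  have hℓ : 1 ≤ (2 + Real.log N) ^ 9 := one_le_pow₀ (by linarith)
  have hδr : δ ≤ r := hδ.trans ((div_le_self (by positivity) hℓ).trans (min_le_left _ _))
  have hδc : δ ≤ c / (2 + Real.log N) ^ 9 := hδ.trans (by gcongr; exact min_le_right _ _)
  have hr1 : 1 / r ≤ 1 / δ := one_div_le_one_div_of_le hδ0 hδr
  have hc1 : (2 + Real.log N) ^ 9 / (2 * c) ≤ 1 / δ := by
    rw [le_one_div (by positivity) hδ0, one_div_div]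
    refine hδc.trans ?_
    gcongr
    linarith
  obtain ⟨⟨h1, h2⟩, h3⟩ := H z (hz.trans hδr)
  refine ⟨?_, fun χ hχ ↦ ?_⟩
  · rw [LFunctionTrivChar₁_eq_of_dvd_pow hQN hNQ]
    exact ⟨h1, h2.trans hr1⟩
  · by_cases hχ2 : χ ^ 2 = 1
    · obtain ⟨χ₀, rfl⟩ := changeLevel_factor_of_sq_eq_one hQ hQN hNQ hχ2
      have hχ₀ : χ₀ ≠ 1 := by
        rintro rfl
        exact hχ (changeLevel_one hQN)
      have : LFunction (changeLevel hQN χ₀) = LFunction χ₀ :=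
        funext fun s ↦ LFunction_changeLevel_of_dvd_pow hQN hNQ χ₀ (.inl hχ₀)
      rw [this]
      exact ⟨(h3 χ₀ hχ₀).1, (h3 χ₀ hχ₀).2.trans hr1⟩
    · obtain ⟨h4, h5⟩ := Hc N χ hχ2 z (hz.trans hδc)
      exact ⟨h4, h5.trans hc1⟩

end DirichletCharacter

lemma LSeries.logMul_iterate_apply (f : ℕ → ℂ) (k n : ℕ) :
    LSeries.logMul^[k] f n = Complex.log n ^ k * f n := by
  induction k with
  | zero => simp
  | succ k ih => rw [Function.iterate_succ_apply', LSeries.logMul, ih]; ring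

lemma iteratedDeriv_const_mul_inv_sub (k : ℕ) (a b s : ℂ) :
    iteratedDeriv k (fun z ↦ a * (z - b)⁻¹) s =
      a * ((-1) ^ k * k.factorial / (s - b) ^ (k + 1)) := by
  rw [iteratedDeriv_const_mul_field a (fun z : ℂ ↦ (z - b)⁻¹),
    iteratedDeriv_comp_sub_const k (Inv.inv : ℂ → ℂ), iteratedDeriv_eq_iterate]
  beta_reduce
  rw [iter_deriv_inv,
    show (-1 - k : ℤ) = -((k + 1 : ℕ) : ℤ) by push_cast; ring, zpow_neg, zpow_natCast,
    div_eq_mul_inv]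

namespace ArithmeticFunction.vonMangoldt

lemma norm_LFunctionResidueClassAux_one_le {N : ℕ} [NeZero N] {B : ℝ} {z : ℂ}
    (h₁ : ‖deriv (LFunctionTrivChar₁ N) z / LFunctionTrivChar₁ N z‖ ≤ B)
    (h : ∀ χ : DirichletCharacter ℂ N, χ ≠ 1 → ‖deriv (LFunction χ) z / LFunction χ z‖ ≤ B) :
    ‖LFunctionResidueClassAux (1 : ZMod N) z‖ ≤ B := by
  classical
  have hφ : 0 < (N.totient : ℝ) := mod_cast Nat.totient_pos.2 (NeZero.pos N)
  have hcard : (Fintype.card (DirichletCharacter ℂ N) : ℝ) = N.totient := by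
    rw [← Nat.card_eq_fintype_card, card_eq_totient_of_hasEnoughRootsOfUnity]
  rw [LFunctionResidueClassAux, norm_mul, norm_inv, norm_natCast, inv_mul_le_iff₀ hφ, ← hcard,
    ← nsmul_eq_mul, ← Finset.card_univ, ← Finset.sum_const,
    ← Finset.sum_add_sum_compl {(1 : DirichletCharacter ℂ N)}, Finset.sum_singleton]
  refine (norm_sub_le _ _).trans (add_le_add (by rwa [neg_div, norm_neg]) ?_)
  refine (norm_sum_le _ _).trans
    ((Finset.sum_le_sum (g := fun _ ↦ B) fun χ hχ ↦ ?_).trans_eq (by congr!))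
  simpa [ZMod.inv_one] using h χ (by simpa using hχ)

lemma differentiableAt_LFunctionResidueClassAux {N : ℕ} [NeZero N] (a : ZMod N) {z : ℂ}
    (h₁ : LFunctionTrivChar₁ N z ≠ 0)
    (h : ∀ χ : DirichletCharacter ℂ N, χ ≠ 1 → LFunction χ z ≠ 0) :
    DifferentiableAt ℂ (LFunctionResidueClassAux a) z := by
  have hd {f : ℂ → ℂ} (hf : Differentiable ℂ f) : Differentiable ℂ (deriv f) :=
    (hf.contDiff (n := 2)).differentiable_deriv_two
  unfold LFunctionResidueClassAux
  refine (((hd (differentiable_LFunctionTrivChar₁ N) z).fun_neg.fun_div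
    (differentiable_LFunctionTrivChar₁ N z) h₁).fun_sub
      (DifferentiableAt.fun_sum fun χ hχ ↦ ?_)).const_mul _
  have hχ1 : χ ≠ 1 := by simpa using hχ
  exact ((hd (differentiable_LFunction hχ1) z).const_mul _).fun_div
    (differentiable_LFunction hχ1 z) (h χ hχ1)

lemma LSeries_logMul_iterate_residueClass {N : ℕ} (a : ZMod N) (k : ℕ) {x : ℝ} (hx : 0 < x) :
    Summable (fun n : ℕ ↦ Real.log n ^ k * residueClass a n / (n : ℝ) ^ (1 + x)) ∧
    LSeries (LSeries.logMul^[k] fun n ↦ (residueClass a n : ℂ)) ((1 + x : ℝ) : ℂ) =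
      ((∑' n : ℕ, Real.log n ^ k * residueClass a n / (n : ℝ) ^ (1 + x) : ℝ) : ℂ) := by
  have hterm : LSeries.term (LSeries.logMul^[k] fun n ↦ (residueClass a n : ℂ))
      ((1 + x : ℝ) : ℂ) =
      fun n : ℕ ↦ ((Real.log n ^ k * residueClass a n / (n : ℝ) ^ (1 + x) : ℝ) : ℂ) := by
    funext n
    rcases eq_or_ne n 0 with rfl | hn
    · simp
    · rw [LSeries.term_of_ne_zero hn, LSeries.logMul_iterate_apply, ← natCast_log]
      push_cast [ofReal_cpow (Nat.cast_nonneg n)]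
      rfl
  have hs : LSeriesSummable (LSeries.logMul^[k] fun n ↦ (residueClass a n : ℂ))
      ((1 + x : ℝ) : ℂ) := by
    refine LSeriesSummable_of_abscissaOfAbsConv_lt_re ?_
    rw [LSeries.absicssaOfAbsConv_logPowMul]
    refine (abscissaOfAbsConv_residueClass_le_one a).trans_lt ?_
    rw [ofReal_re]
    exact_mod_cast lt_add_of_pos_right 1 hx
  rw [LSeriesSummable, hterm] at hs
  refine ⟨Complex.summable_ofReal.1 hs, ?_⟩
  rw [LSeries, hterm, ofReal_tsum]

theorem exists_le_tsum_log_pow_mul_residueClass_one {Q : ℕ} [NeZero Q] (hQ : _root_.Odd Q) :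
    ∃ c : ℝ, 0 < c ∧ ∀ (N : ℕ) [NeZero N] (J : ℕ), Q ∣ N → N ∣ Q ^ J → ∀ ε : ℝ, 0 < ε →
      ε ≤ c / (2 + Real.log N) ^ 9 → ∀ k : ℕ, N ≤ 3 ^ k →
      3 / 4 * (k.factorial / (N.totient * ε ^ (k + 1))) ≤
        ∑' n : ℕ, Real.log n ^ k * residueClass (1 : ZMod N) n / (n : ℝ) ^ (1 + ε) := by
  obtain ⟨c, hc, H⟩ := exists_norm_deriv_div_le_of_dvd_pow Q hQ
  refine ⟨c / 4, by positivity, fun N _ J hQN hNQ ε hε hεc k hNk ↦ ?_⟩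
  have hφ : 0 < (N.totient : ℝ) := mod_cast Nat.totient_pos.2 (NeZero.pos N)
  replace H := H N J hQN hNQ (4 * ε) (by positivity) (by
    calc 4 * ε ≤ 4 * (c / 4 / (2 + Real.log N) ^ 9) := by gcongr
      _ = _ := by ring)
  set s₀ : ℂ := ((1 + ε : ℝ) : ℂ) with hs₀
  have hnear (z : ℂ) (hz : z ∈ Metric.closedBall s₀ (3 * ε)) : ‖z - 1‖ ≤ 4 * ε := by
    have h1 : ‖z - s₀‖ ≤ 3 * ε := by simpa [dist_eq_norm] using hz
    have h2 : z - 1 = (z - s₀) + (ε : ℂ) := by rw [hs₀]; push_cast; ring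
    rw [h2]
    refine (norm_add_le _ _).trans ?_
    rw [norm_real, Real.norm_of_nonneg hε.le]
    linarith
  have hcauchy := Complex.norm_iteratedDeriv_le_of_forall_mem_sphere_norm_le (c := s₀)
    (R := 3 * ε) (C := 1 / (4 * ε)) (f := LFunctionResidueClassAux (1 : ZMod N)) k (by positivity)
    (by
      refine DifferentiableOn.diffContOnCl fun z hz ↦ ?_
      rw [closure_ball _ (by positivity)] at hz
      have := H z (hnear z hz)
      exact (differentiableAt_LFunctionResidueClassAux _ this.1.1
        fun χ hχ ↦ (this.2 χ hχ).1).differentiableWithinAt)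
    (fun z hz ↦ by
      have := H z (hnear z (Metric.sphere_subset_closedBall hz))
      exact norm_LFunctionResidueClassAux_one_le this.1.2 fun χ hχ ↦ (this.2 χ hχ).2)
  have hre : 1 < s₀.re := by rw [hs₀, ofReal_re]; linarith
  have habs : LSeries.abscissaOfAbsConv (fun n ↦ (residueClass (1 : ZMod N) n : ℂ)) < s₀.re :=
    (abscissaOfAbsConv_residueClass_le_one _).trans_lt (mod_cast hre)
  have hev : LFunctionResidueClassAux (1 : ZMod N) =ᶠ[nhds s₀]
      fun s ↦ LSeries (fun n ↦ (residueClass (1 : ZMod N) n : ℂ)) s -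
        (N.totient : ℂ)⁻¹ * (s - 1)⁻¹ := by
    filter_upwards [(isOpen_lt continuous_const continuous_re).mem_nhds hre] with s hs
    exact eqOn_LFunctionResidueClassAux isUnit_one hs
  have hL : ContDiffAt ℂ k (LSeries fun n ↦ (residueClass (1 : ZMod N) n : ℂ)) s₀ :=
    (LSeries_analyticOnNhd _ s₀ habs).contDiffAt
  have hsub : s₀ - 1 = (ε : ℂ) := by rw [hs₀]; push_cast; ring
  have hinv : ContDiffAt ℂ k (fun s : ℂ ↦ (N.totient : ℂ)⁻¹ * (s - 1)⁻¹) s₀ := by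
    refine contDiffAt_const.mul ((contDiffAt_id.sub contDiffAt_const).inv ?_)
    rw [id, hsub]
    exact_mod_cast hε.ne'
  rw [hev.iteratedDeriv_eq, iteratedDeriv_fun_sub hL hinv, LSeries_iteratedDeriv k habs,
    iteratedDeriv_const_mul_inv_sub, (LSeries_logMul_iterate_residueClass _ k hε).2, hsub] at hcauchy
  set S : ℝ := ∑' n : ℕ, Real.log n ^ k * residueClass (1 : ZMod N) n / (n : ℝ) ^ (1 + ε)
  have hrw : (-1) ^ k * (S : ℂ) - (N.totient : ℂ)⁻¹ * ((-1) ^ k * k.factorial / (ε : ℂ) ^ (k + 1)) =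
      (-1) ^ k * ((S - k.factorial / (N.totient * ε ^ (k + 1)) : ℝ) : ℂ) := by
    push_cast
    field_simp
  rw [hrw, norm_mul, norm_pow, norm_neg, norm_one, one_pow, one_mul, norm_real,
    Real.norm_eq_abs] at hcauchy
  have hbound : k.factorial * (1 / (4 * ε)) / (3 * ε) ^ k ≤
      1 / 4 * (k.factorial / (N.totient * ε ^ (k + 1))) := by
    have h3 : (N.totient : ℝ) ≤ 3 ^ k := by exact_mod_cast (Nat.totient_le N).trans hNk
    calc k.factorial * (1 / (4 * ε)) / (3 * ε) ^ k
        = 1 / 4 * (k.factorial / (3 ^ k * ε ^ (k + 1))) := by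
          field_simp
          ring
      _ ≤ _ := by gcongr
  linarith [(abs_le.1 (hcauchy.trans hbound)).1]

end ArithmeticFunction.vonMangoldt

lemma Real.log_pow_le_factorial_mul_rpow {x θ : ℝ} (hx : 1 ≤ x) (hθ : 0 < θ) (K : ℕ) :
    Real.log x ^ K ≤ K.factorial / θ ^ K * x ^ θ := by
  have h := Real.pow_div_factorial_le_exp (Real.log x * θ)
    (mul_nonneg (Real.log_nonneg hx) hθ.le) K
  rw [← Real.rpow_def_of_pos (by linarith), div_le_iff₀ (by positivity), mul_pow] at h
  rw [div_mul_eq_mul_div, le_div_iff₀ (by positivity)]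
  linarith

lemma exists_eq_sq_mul_cube_of_isPrimePow {n : ℕ} (hn : IsPrimePow n) (hn' : ¬ n.Prime) :
    ∃ p : ℕ × ℕ, 1 ≤ p.1 ∧ 1 ≤ p.2 ∧ n = p.1 ^ 2 * p.2 ^ 3 := by
  obtain ⟨p, j, hp, hj, rfl⟩ := (isPrimePow_nat_iff n).1 hn
  have hj1 : j ≠ 1 := by
    rintro rfl
    exact hn' (by simpa using hp)
  obtain ⟨i, rfl | rfl⟩ := j.even_or_odd'
  · exact ⟨(p ^ i, 1), Nat.one_le_pow _ _ hp.pos, le_rfl, by ring⟩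
  · obtain ⟨i, rfl⟩ : ∃ l, i = l + 1 := ⟨i - 1, by omega⟩
    exact ⟨(p ^ i, p), Nat.one_le_pow _ _ hp.pos, hp.one_le, by ring⟩

open scoped Classical in
lemma summable_isPrimePow_not_prime_rpow :
    Summable fun n : ℕ ↦ if IsPrimePow n ∧ ¬ n.Prime then (n : ℝ) ^ (-(3 / 4) : ℝ) else 0 := by
  have hsum : Summable fun p : ℕ × ℕ ↦ (p.1 : ℝ) ^ (-(3 / 2) : ℝ) * (p.2 : ℝ) ^ (-(9 / 4) : ℝ) :=
    (Real.summable_nat_rpow.2 (by norm_num)).mul_of_nonneg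
      (Real.summable_nat_rpow.2 (by norm_num)) (fun _ ↦ by positivity) (fun _ ↦ by positivity)
  have hchoose (n : {n : ℕ | IsPrimePow n ∧ ¬ n.Prime}) :
      ∃ p : ℕ × ℕ, 1 ≤ p.1 ∧ 1 ≤ p.2 ∧ (n : ℕ) = p.1 ^ 2 * p.2 ^ 3 :=
    exists_eq_sq_mul_cube_of_isPrimePow n.2.1 n.2.2
  choose e he₁ he₂ he using hchoose
  have hinj : Function.Injective e := fun m n hmn ↦ Subtype.ext (by rw [he, he, hmn])
  refine ((summable_subtype_iff_indicator
    (f := fun n : ℕ ↦ (n : ℝ) ^ (-(3 / 4) : ℝ)) (s := {n | IsPrimePow n ∧ ¬ n.Prime})).1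
      ?_).congr fun n ↦ ?_
  · refine (hsum.comp_injective hinj).congr fun n ↦ ?_
    simp only [Function.comp_apply]
    rw [he n]
    push_cast
    rw [Real.mul_rpow (by positivity) (by positivity), ← Real.rpow_natCast, ← Real.rpow_natCast,
      ← Real.rpow_mul (by positivity), ← Real.rpow_mul (by positivity)]
    norm_num
  · rw [Set.indicator_apply]
    rfl

namespace ArithmeticFunction.vonMangoldt

variable {N : ℕ} {k : ℕ} {ε : ℝ}

lemma log_pow_mul_residueClass_div_le (a : ZMod N) {θ : ℝ} (hθ : 0 < θ) {n : ℕ} (hn : 1 ≤ n) :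
    Real.log n ^ k * residueClass a n / (n : ℝ) ^ (1 + ε) ≤
      (k + 1).factorial / θ ^ (k + 1) * (n : ℝ) ^ (-(1 + ε - θ)) := by
  have hn' : (1 : ℝ) ≤ n := mod_cast hn
  have hΛ : residueClass a n ≤ Real.log n := (residueClass_le a n).trans vonMangoldt_le_log
  calc Real.log n ^ k * residueClass a n / (n : ℝ) ^ (1 + ε)
      ≤ Real.log n ^ k * Real.log n / (n : ℝ) ^ (1 + ε) := by
        have := Real.log_nonneg hn'
        gcongr
    _ ≤ ((k + 1).factorial / θ ^ (k + 1) * (n : ℝ) ^ θ) / (n : ℝ) ^ (1 + ε) := by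
        rw [← pow_succ]
        gcongr
        exact Real.log_pow_le_factorial_mul_rpow hn' hθ _
    _ = _ := by
        rw [mul_div_assoc, ← Real.rpow_sub (by linarith)]
        congr 2
        ring

open scoped Classical in
lemma tsum_not_prime_log_pow_mul_residueClass_le (a : ZMod N) (k : ℕ) (hε : 0 < ε) :
    ∑' n : ℕ, (if n.Prime then 0 else Real.log n ^ k * residueClass a n / (n : ℝ) ^ (1 + ε)) ≤
      (k + 1).factorial * 4 ^ (k + 1) *
        ∑' n : ℕ, if IsPrimePow n ∧ ¬ n.Prime then (n : ℝ) ^ (-(3 / 4) : ℝ) else 0 := by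
  have hnonneg (n : ℕ) : 0 ≤ Real.log n ^ k * residueClass a n / (n : ℝ) ^ (1 + ε) := by
    have := residueClass_nonneg a n
    have := Real.log_natCast_nonneg n
    positivity
  have hle (n : ℕ) : (if n.Prime then 0 else
      Real.log n ^ k * residueClass a n / (n : ℝ) ^ (1 + ε)) ≤
      (k + 1).factorial * 4 ^ (k + 1) *
        if IsPrimePow n ∧ ¬ n.Prime then (n : ℝ) ^ (-(3 / 4) : ℝ) else 0 := by
    by_cases hn : n.Prime
    · simp [hn]
    by_cases hpp : IsPrimePow n
    · have h1 : 1 ≤ n := hpp.pos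
      simp only [hn, hpp, if_false, not_false_eq_true, and_self, if_true]
      refine (log_pow_mul_residueClass_div_le a (θ := 1 / 4) (by norm_num) h1).trans ?_
      rw [one_div, inv_pow, div_inv_eq_mul]
      gcongr
      · exact_mod_cast h1
      · linarith
    · have : residueClass a n = 0 := le_antisymm ((residueClass_le a n).trans_eq
        (vonMangoldt_eq_zero_iff.2 hpp)) (residueClass_nonneg a n)
      simp [hpp, this]
  have hs := summable_isPrimePow_not_prime_rpow.mul_left (((k + 1).factorial : ℝ) * 4 ^ (k + 1))
  rw [← tsum_mul_left]
  refine Summable.tsum_le_tsum hle (hs.of_nonneg_of_le (fun n ↦ ?_) hle) hs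
  split_ifs
  · exact le_rfl
  · exact hnonneg n

lemma tsum_prime_log_pow_mul_residueClass_one_le [NeZero N] (k : ℕ) (hε : 0 < ε) :
    ∑' n : ℕ, (if n.Prime then
      Real.log n ^ k * residueClass (1 : ZMod N) n / (n : ℝ) ^ (1 + ε) else 0) ≤
      2 * (k + 1).factorial / (N * ε ^ (k + 1)) *
        ∑' m : ℕ, if (1 + N * (m + 1)).Prime then
          ((m : ℝ) + 1) ^ (-(1 + ε / (2 * (k + 1)))) else 0 := by
  set x : ℝ := ε / (2 * (k + 1)) with hx
  have hx0 : 0 < x := by positivity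
  have hN : 1 ≤ N := NeZero.one_le
  have hN' : (1 : ℝ) ≤ N := mod_cast hN
  set F : ℕ → ℝ := fun n ↦ if n.Prime then
      Real.log n ^ k * residueClass (1 : ZMod N) n / (n : ℝ) ^ (1 + ε) else 0 with hF
  have hi : Function.Injective fun m : ℕ ↦ 1 + N * (m + 1) := fun a b hab ↦ by
    simpa [NeZero.ne N] using hab
  have hsupp : Function.support F ⊆ Set.range fun m : ℕ ↦ 1 + N * (m + 1) := by
    intro n hn
    have hp : n.Prime := by
      by_contra h
      simp [hF, h] at hn
    have hmod : (n : ZMod N) = 1 := by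
      by_contra h
      simp [hF, residueClass, h] at hn
    have hdvd : N ∣ n - 1 := (Nat.modEq_iff_dvd' hp.one_le).1
      ((ZMod.natCast_eq_natCast_iff _ _ _).1 (by simpa using hmod.symm))
    obtain ⟨q, hq⟩ := hdvd
    have hp2 := hp.two_le
    have hq0 : q ≠ 0 := by
      rintro rfl
      omega
    refine ⟨q - 1, ?_⟩
    beta_reduce
    rw [Nat.sub_add_cancel (by omega)]
    omega
  have hFs : Summable F := by
    refine (LSeries_logMul_iterate_residueClass (1 : ZMod N) k hε).1.of_nonneg_of_le
      (fun n ↦ ?_) (fun n ↦ ?_) <;>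
    · have := residueClass_nonneg (1 : ZMod N) n
      have := Real.log_natCast_nonneg n
      simp only [hF]
      split_ifs <;> first | exact le_rfl | positivity
  have hk0 : (0 : ℝ) < k + 1 := by positivity
  set θ : ℝ := ε - x with hθ
  have hθε : θ = ε * (1 - 1 / (2 * (k + 1))) := by rw [hθ, hx]; ring
  have hfrac : 1 / (2 * ((k : ℝ) + 1)) ≤ 1 / 2 := by
    gcongr
    linarith
  have hθ0 : 0 < θ := by
    rw [hθε]
    exact mul_pos hε (by linarith)
  have hθpow : ε ^ (k + 1) ≤ 2 * θ ^ (k + 1) := by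
    have hb := one_add_mul_le_pow (a := -(1 / (2 * ((k : ℝ) + 1)))) (by linarith) (k + 1)
    have : 1 + ((k + 1 : ℕ) : ℝ) * -(1 / (2 * ((k : ℝ) + 1))) = 1 / 2 := by
      push_cast
      field_simp
      ring
    rw [this, ← sub_eq_add_neg] at hb
    rw [hθε, mul_pow]
    nlinarith [pow_pos hε (k + 1)]
  have hle (m : ℕ) : F (1 + N * (m + 1)) ≤ 2 * (k + 1).factorial / (N * ε ^ (k + 1)) *
      if (1 + N * (m + 1)).Prime then ((m : ℝ) + 1) ^ (-(1 + x)) else 0 := by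
    simp only [hF]
    split_ifs with hp
    · refine (log_pow_mul_residueClass_div_le 1 hθ0 hp.one_le).trans ?_
      have h1 : ((1 + N * (m + 1) : ℕ) : ℝ) ^ (-(1 + ε - θ)) ≤
          (N : ℝ)⁻¹ * ((m : ℝ) + 1) ^ (-(1 + x)) := by
        rw [show 1 + ε - θ = 1 + x by rw [hθ]; ring]
        calc ((1 + N * (m + 1) : ℕ) : ℝ) ^ (-(1 + x))
            ≤ ((N : ℝ) * (m + 1)) ^ (-(1 + x)) := by
              refine Real.rpow_le_rpow_of_nonpos (by positivity) ?_ (by linarith)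
              push_cast
              linarith
          _ = (N : ℝ) ^ (-(1 + x)) * ((m : ℝ) + 1) ^ (-(1 + x)) :=
              Real.mul_rpow (by positivity) (by positivity)
          _ ≤ _ := by
              gcongr
              rw [← Real.rpow_neg_one]
              exact Real.rpow_le_rpow_of_exponent_le hN' (by linarith)
      have h2 : ((k + 1).factorial : ℝ) / θ ^ (k + 1) ≤
          2 * (k + 1).factorial / ε ^ (k + 1) := by
        rw [div_le_div_iff₀ (by positivity) (by positivity)]
        have : (0 : ℝ) < (k + 1).factorial := by positivity
        nlinarith
      calc _ ≤ 2 * (k + 1).factorial / ε ^ (k + 1) *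
            ((N : ℝ)⁻¹ * ((m : ℝ) + 1) ^ (-(1 + x))) := by gcongr
        _ = _ := by field_simp
    · simp
  have hsum : Summable fun m : ℕ ↦ if (1 + N * (m + 1)).Prime then
      ((m : ℝ) + 1) ^ (-(1 + x)) else 0 := by
    refine (summable_nat_add_one_rpow hx0).of_nonneg_of_le (fun m ↦ ?_) (fun m ↦ ?_) <;>
    · split_ifs <;> first | exact le_rfl | positivity
  rw [← hi.tsum_eq hsupp, ← tsum_mul_left]
  exact Summable.tsum_le_tsum hle (hFs.comp_injective hi) (hsum.mul_left _)

theorem exists_one_le_tsum_prime_one_add_mul {Q : ℕ} [NeZero Q] (hQ : _root_.Odd Q) :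
    ∃ c : ℝ, 0 < c ∧ ∀ (N J : ℕ), Q ∣ N → N ∣ Q ^ J → ∀ ε : ℝ, 0 < ε →
      ε ≤ c / (2 + Real.log N) ^ 9 → ∀ k : ℕ, N ≤ 3 ^ k →
      1 ≤ 8 * ((k : ℝ) + 1) * ∑' m : ℕ, if (1 + N * (m + 1)).Prime then
          ((m : ℝ) + 1) ^ (-(1 + ε / (2 * (k + 1)))) else 0 := by
  classical
  obtain ⟨c, hc, H⟩ := exists_le_tsum_log_pow_mul_residueClass_one hQ
  set C : ℝ := ∑' n : ℕ, if IsPrimePow n ∧ ¬ n.Prime then (n : ℝ) ^ (-(3 / 4) : ℝ) else 0 with hC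
  have hC0 : 0 ≤ C := tsum_nonneg fun n ↦ by split_ifs <;> positivity
  refine ⟨min c (1 / (24 * (2 * C + 1))), by positivity, fun N J hQN hNQ ε hε hεc k hNk ↦ ?_⟩
  have : NeZero N := ⟨fun h ↦ pow_ne_zero J (NeZero.ne Q) (zero_dvd_iff.1 (h ▸ hNQ))⟩
  have hlog : 0 ≤ Real.log N := Real.log_natCast_nonneg N
  have hℓ : 1 ≤ (2 + Real.log N) ^ 9 := one_le_pow₀ (by linarith)
  have hε1 : ε ≤ c / (2 + Real.log N) ^ 9 := hεc.trans (by gcongr; exact min_le_left _ _)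
  have hε2 : ε ≤ 1 / (24 * (2 * C + 1)) :=
    hεc.trans ((div_le_self (by positivity) hℓ).trans (min_le_right _ _))
  have hmain := H N J hQN hNQ ε hε hε1 k hNk
  have hφ : 0 < (N.totient : ℝ) := mod_cast Nat.totient_pos.2 (NeZero.pos N)
  have hφN : (N.totient : ℝ) ≤ N := mod_cast Nat.totient_le N
  have hN0 : (0 : ℝ) < N := hφ.trans_le hφN
  have hs := (LSeries_logMul_iterate_residueClass (1 : ZMod N) k hε).1
  have hsplit : ∑' n : ℕ, Real.log n ^ k * residueClass (1 : ZMod N) n / (n : ℝ) ^ (1 + ε) =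
      ∑' n : ℕ, (if n.Prime then
        Real.log n ^ k * residueClass (1 : ZMod N) n / (n : ℝ) ^ (1 + ε) else 0) +
      ∑' n : ℕ, (if n.Prime then 0 else
        Real.log n ^ k * residueClass (1 : ZMod N) n / (n : ℝ) ^ (1 + ε)) := by
    rw [← Summable.tsum_add]
    · refine tsum_congr fun n ↦ ?_
      split_ifs <;> simp
    · refine (hs.indicator {n | n.Prime}).congr fun n ↦ ?_
      rw [Set.indicator_apply]
      rfl
    · refine (hs.indicator {n | ¬ n.Prime}).congr fun n ↦ ?_
      rw [Set.indicator_apply]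
      simp only [Set.mem_ofPred_eq, ite_not]
  rw [hsplit] at hmain
  have hnp := tsum_not_prime_log_pow_mul_residueClass_le (1 : ZMod N) k hε
  have hp := tsum_prime_log_pow_mul_residueClass_one_le (N := N) k hε
  rw [← hC] at hnp
  set P : ℝ := ∑' m : ℕ, if (1 + N * (m + 1)).Prime then
          ((m : ℝ) + 1) ^ (-(1 + ε / (2 * (k + 1)))) else 0
  have hk2 : ((k : ℝ) + 1) ≤ 2 ^ (k + 1) := by exact_mod_cast (Nat.lt_two_pow_self (n := k + 1)).le
  have hNk' : (N.totient : ℝ) ≤ 3 ^ (k + 1) := by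
    refine hφN.trans ?_
    exact_mod_cast hNk.trans (Nat.pow_le_pow_right (by norm_num) (Nat.le_succ k))
  have h24 : (24 * ε) ^ (k + 1) ≤ 1 / (2 * C + 1) := by
    have h1 : 24 * ε ≤ 1 / (2 * C + 1) := by
      calc 24 * ε ≤ 24 * (1 / (24 * (2 * C + 1))) := by gcongr
        _ = _ := by field_simp
    have h2 : 1 / (2 * C + 1) ≤ 1 := by
      rw [div_le_one (by positivity)]
      linarith
    exact (pow_le_of_le_one (by positivity) (h1.trans h2) (Nat.succ_ne_zero k)).trans h1
  have hsmall : (k + 1).factorial * 4 ^ (k + 1) * C ≤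
      1 / 2 * (k.factorial / (N.totient * ε ^ (k + 1))) := by
    have h3 : 2 * C * ((k + 1) * N.totient * 4 ^ (k + 1) * ε ^ (k + 1)) ≤ 1 := by
      calc 2 * C * ((k + 1) * N.totient * 4 ^ (k + 1) * ε ^ (k + 1))
          ≤ 2 * C * (2 ^ (k + 1) * 3 ^ (k + 1) * 4 ^ (k + 1) * ε ^ (k + 1)) := by gcongr
        _ = 2 * C * (24 * ε) ^ (k + 1) := by
            rw [← mul_pow, ← mul_pow, ← mul_pow]
            norm_num
        _ ≤ 2 * C * (1 / (2 * C + 1)) := by gcongr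
        _ ≤ 1 := by
            rw [mul_one_div, div_le_one (by positivity)]
            linarith
    rw [Nat.factorial_succ, ← mul_div_assoc, le_div_iff₀ (by positivity)]
    push_cast
    have : (0 : ℝ) < k.factorial := by positivity
    nlinarith
  have hA : 1 / 4 * (k.factorial / (N.totient * ε ^ (k + 1))) ≤
      2 * (k + 1).factorial / (N * ε ^ (k + 1)) * P := by linarith
  rw [Nat.factorial_succ] at hA
  push_cast at hA
  have hA' : (N : ℝ) / N.totient ≤ 8 * (k + 1) * P := by
    have hm := mul_le_mul_of_nonneg_left hA
      (show 0 ≤ 4 * N * ε ^ (k + 1) / k.factorial by positivity)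
    have hkf : (k.factorial : ℝ) ≠ 0 := by positivity
    calc (N : ℝ) / N.totient = 4 * N * ε ^ (k + 1) / k.factorial *
          (1 / 4 * (k.factorial / (N.totient * ε ^ (k + 1)))) := by field_simp
      _ ≤ _ := hm
      _ = _ := by
        field_simp
        ring
  exact ((one_le_div hφ).2 hφN).trans hA'

end ArithmeticFunction.vonMangoldt

end

theorem exists_lt_card_filter_prime_one_add_mul {Q : ℕ} (hQ : Odd Q) :
    ∃ C : ℝ, ∀ J : ℕ, 1 ≤ J → ∀ {ι : Type} (D : Finset ι) (N : ι → ℕ),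
      (∀ i ∈ D, Q ∣ N i ∧ N i ∣ Q ^ J) → ∀ s : ℕ, C * s * (J : ℝ) ^ 11 < D.card →
      ∃ m : ℕ, 1 ≤ m ∧ s < (D.filter fun i ↦ (1 + N i * m).Prime).card := by
  have : NeZero Q := ⟨hQ.pos.ne'⟩
  obtain ⟨c, hc, H⟩ := ArithmeticFunction.vonMangoldt.exists_one_le_tsum_prime_one_add_mul hQ
  refine ⟨8 * (Q + 1) * (1 + 2 * (Q + 1) * ((Q + 2) ^ 9 / c)), fun J hJ ι D N hN s hs ↦ ?_⟩
  by_contra! hcon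
  have hJ' : (1 : ℝ) ≤ J := mod_cast hJ
  set k : ℕ := Q * J with hk
  set ε : ℝ := c / ((J : ℝ) ^ 9 * (Q + 2) ^ 9) with hε
  have hε0 : 0 < ε := by positivity
  set x : ℝ := ε / (2 * (k + 1)) with hx
  have hx0 : 0 < x := by positivity
  have hNk {i : ι} (hi : i ∈ D) : N i ≤ 3 ^ k :=
    calc N i ≤ Q ^ J := Nat.le_of_dvd (by positivity [hQ.pos]) (hN i hi).2
      _ ≤ (3 ^ Q) ^ J := Nat.pow_le_pow_left (Nat.lt_pow_self (by norm_num)).le J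
      _ = 3 ^ k := by rw [hk, pow_mul]
  have hlog {i : ι} (hi : i ∈ D) : ε ≤ c / (2 + Real.log (N i)) ^ 9 := by
    have h0 : 0 ≤ Real.log (N i) := Real.log_natCast_nonneg _
    have hpos : 0 < N i := Nat.pos_of_dvd_of_pos (hN i hi).2 (pow_pos hQ.pos J)
    have h1 : Real.log (N i) ≤ J * Q := by
      calc Real.log (N i) ≤ Real.log ((Q : ℝ) ^ J) := by
            refine Real.log_le_log (mod_cast hpos) ?_
            exact_mod_cast Nat.le_of_dvd (pow_pos hQ.pos J) (hN i hi).2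
        _ = J * Real.log Q := Real.log_pow _ _
        _ ≤ J * Q := by
            gcongr
            exact Real.log_le_self (Nat.cast_nonneg Q)
    rw [hε, ← mul_pow]
    gcongr
    nlinarith
  have hone (i : ι) (hi : i ∈ D) := H (N i) J (hN i hi).1 (hN i hi).2 ε hε0 (hlog hi) k (hNk hi)
  have hsummable (i : ι) : Summable fun m : ℕ ↦ if (1 + N i * (m + 1)).Prime then
      ((m : ℝ) + 1) ^ (-(1 + x)) else 0 := by
    refine (summable_nat_add_one_rpow hx0).of_nonneg_of_le (fun m ↦ ?_) (fun m ↦ ?_) <;>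
    · split_ifs <;> first | exact le_rfl | positivity
  have hupper : ∑ i ∈ D, ∑' m : ℕ, (if (1 + N i * (m + 1)).Prime then
      ((m : ℝ) + 1) ^ (-(1 + x)) else 0) ≤ s * (1 + 1 / x) := by
    rw [← Summable.tsum_finsetSum fun i _ ↦ hsummable i]
    refine (Summable.tsum_le_tsum (fun m ↦ ?_) (summable_sum fun i _ ↦ hsummable i)
      ((summable_nat_add_one_rpow hx0).mul_left (s : ℝ))).trans ?_
    · rw [← Finset.sum_filter, Finset.sum_const, nsmul_eq_mul]
      gcongr
      exact_mod_cast hcon (m + 1) (Nat.le_add_left 1 m)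
    · rw [tsum_mul_left]
      gcongr
      exact tsum_nat_add_one_rpow_le hx0
  have hcard : (D.card : ℝ) ≤ 8 * (k + 1) * (s * (1 + 1 / x)) := by
    calc (D.card : ℝ) = ∑ i ∈ D, (1 : ℝ) := by simp
      _ ≤ ∑ i ∈ D, 8 * ((k : ℝ) + 1) * ∑' m : ℕ, (if (1 + N i * (m + 1)).Prime then
          ((m : ℝ) + 1) ^ (-(1 + x)) else 0) := Finset.sum_le_sum hone
      _ ≤ _ := by
        rw [← Finset.mul_sum]
        gcongr
  have hk1 : (k : ℝ) + 1 ≤ J * (Q + 1) := by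
    rw [hk]
    push_cast
    linarith
  have hx1 : 1 / x = 2 * (k + 1) * ((J : ℝ) ^ 9 * ((Q + 2) ^ 9 / c)) := by
    rw [hx, hε]
    field_simp
  refine absurd hs (not_lt.2 (hcard.trans ?_))
  have hx2 : 1 + 1 / x ≤ (J : ℝ) ^ 10 * (1 + 2 * (Q + 1) * ((Q + 2) ^ 9 / c)) := by
    rw [hx1, mul_add ((J : ℝ) ^ 10), mul_one]
    refine add_le_add (one_le_pow₀ hJ') ?_
    calc 2 * ((k : ℝ) + 1) * ((J : ℝ) ^ 9 * ((Q + 2) ^ 9 / c))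
        ≤ 2 * (J * (Q + 1)) * ((J : ℝ) ^ 9 * ((Q + 2) ^ 9 / c)) := by gcongr
      _ = _ := by ring
  calc 8 * ((k : ℝ) + 1) * (s * (1 + 1 / x))
      ≤ 8 * (J * (Q + 1)) * (s * ((J : ℝ) ^ 10 * (1 + 2 * (Q + 1) * ((Q + 2) ^ 9 / c)))) := by
        gcongr
    _ = _ := by ring

lemma Finset.squarefree_prod_primes {R : Finset ℕ} (hR : ∀ p ∈ R, p.Prime) :
    Squarefree (∏ p ∈ R, p) := by
  refine Finset.squarefree_prod_of_pairwise_isCoprime (fun p hp q hq hpq ↦ ?_)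
    fun p hp ↦ (hR p hp).squarefree
  exact Nat.coprime_iff_isRelPrime.1 ((Nat.coprime_primes (hR p hp) (hR q hq)).2 hpq)

lemma Finset.totient_prod_primes {R : Finset ℕ} (hR : ∀ p ∈ R, p.Prime) :
    Nat.totient (∏ p ∈ R, p) = ∏ p ∈ R, (p - 1) := by
  rw [Nat.totient_eq_div_primeFactors_mul, Nat.primeFactors_prod hR,
    Nat.div_self (Finset.prod_pos fun p hp ↦ (hR p hp).pos), one_mul]

lemma Finset.exists_prod_one_add_mul_eq {ι : Type*} (S : Finset ι) (d : ι → ℕ) (x : ℕ) :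
    ∃ y, ∏ e ∈ S, (1 + x * d e) = 1 + x * (∑ e ∈ S, d e + x * y) := by
  classical
  induction S using Finset.induction_on with
  | empty => exact ⟨0, by simp⟩
  | insert a S ha ih =>
    obtain ⟨y, hy⟩ := ih
    refine ⟨y + d a * ∑ e ∈ S, d e + d a * x * y, ?_⟩
    rw [Finset.prod_insert ha, Finset.sum_insert ha, hy]
    ring

lemma not_pow_succ_dvd_sum_add {ι : Type*} {S : Finset ι} {d : ι → ℕ} {l z : ℕ} (hl : l.Prime)
    (hd : ∀ e ∈ S, d e ≠ 0) {e₀ : ι} (he₀ : e₀ ∈ S)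
    (hmin : ∀ e ∈ S, e ≠ e₀ → (d e₀).factorization l < (d e).factorization l)
    (hz : l ^ ((d e₀).factorization l + 1) ∣ z) :
    ¬ l ^ ((d e₀).factorization l + 1) ∣ ∑ e ∈ S, d e + z := by
  classical
  intro h
  rw [Nat.dvd_add_left hz, ← Finset.add_sum_erase S d he₀, Nat.dvd_add_left] at h
  · exact Nat.pow_succ_factorization_not_dvd (hd e₀ he₀) hl h
  · refine Finset.dvd_sum fun e he ↦ ?_
    exact (hl.pow_dvd_iff_le_factorization (hd e (Finset.mem_of_mem_erase he))).2
      (hmin e (Finset.mem_of_mem_erase he) (Finset.ne_of_mem_erase he))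

theorem lehmer_prod_one_add_mul {ι : Type*} {S : Finset ι} {d : ι → ℕ} {l x : ℕ} (hl : l.Prime)
    (hS : 2 ≤ S.card) (hx : x ≠ 0) (hprime : ∀ e ∈ S, (1 + x * d e).Prime)
    (hinj : Set.InjOn (fun e ↦ (d e).factorization l) S) (hdvd : ∏ e ∈ S, d e ∣ x) :
    Squarefree (∏ e ∈ S, (1 + x * d e)) ∧
    (∏ e ∈ S, (1 + x * d e)).primeFactors.card = S.card ∧
    Nat.totient (∏ e ∈ S, (1 + x * d e)) ∣ (∏ e ∈ S, (1 + x * d e) - 1) ^ (S.card + 1) ∧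
    ¬ Nat.totient (∏ e ∈ S, (1 + x * d e)) ∣ (∏ e ∈ S, (1 + x * d e) - 1) ^ S.card := by
  classical
  have hd (e) (he : e ∈ S) : d e ≠ 0 := fun h ↦ by
    have := hprime e he
    simp [h, Nat.not_prime_one] at this
  have hinj' : Set.InjOn (fun e ↦ 1 + x * d e) S := fun a ha b hb hab ↦ by
    refine hinj ha hb ?_
    have : d a = d b := by simpa [hx] using hab
    simp [this]
  have hR : ∀ p ∈ S.image fun e ↦ 1 + x * d e, p.Prime := by simpa using hprime
  have hprod : ∏ p ∈ S.image (fun e ↦ 1 + x * d e), p = ∏ e ∈ S, (1 + x * d e) :=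
    Finset.prod_image hinj'
  have htot : Nat.totient (∏ e ∈ S, (1 + x * d e)) = x ^ S.card * ∏ e ∈ S, d e := by
    rw [← hprod, Finset.totient_prod_primes hR, Finset.prod_image hinj']
    simp [Finset.prod_mul_distrib]
  obtain ⟨y, hy⟩ := S.exists_prod_one_add_mul_eq d x
  have hn : ∏ e ∈ S, (1 + x * d e) - 1 = x * (∑ e ∈ S, d e + x * y) := by
    rw [hy, Nat.add_sub_cancel_left]
  refine ⟨hprod ▸ Finset.squarefree_prod_primes hR, ?_, ?_, ?_⟩
  · rw [← hprod, Nat.primeFactors_prod hR, Finset.card_image_of_injOn hinj']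
  · rw [htot, hn, mul_pow, pow_succ x]
    exact Dvd.dvd.mul_right (mul_dvd_mul_left _ hdvd) _
  · rw [htot, hn, mul_pow, Nat.mul_dvd_mul_iff_left (pow_pos (Nat.pos_of_ne_zero hx) _)]
    intro h
    obtain ⟨e₀, he₀, hmin⟩ := S.exists_min_image (fun e ↦ (d e).factorization l)
      (Finset.card_pos.1 (by omega))
    have hlt (e) (he : e ∈ S) (hne : e ≠ e₀) :
        (d e₀).factorization l < (d e).factorization l :=
      lt_of_le_of_ne (hmin e he) fun h ↦ hne (hinj he he₀ h.symm)
    obtain ⟨e₁, he₁, hne⟩ := Finset.exists_mem_ne (by omega : 1 < S.card) e₀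
    have hsum : S.card * (d e₀).factorization l < (∏ e ∈ S, d e).factorization l := by
      rw [Nat.factorization_prod_apply hd, ← smul_eq_mul, ← Finset.sum_const]
      exact Finset.sum_lt_sum hmin ⟨e₁, he₁, hlt e₁ he₁ hne⟩
    have hxl : l ^ ((d e₀).factorization l + 1) ∣ x := by
      rw [hl.pow_dvd_iff_le_factorization hx]
      have := (Nat.factorization_le_iff_dvd (Finset.prod_ne_zero_iff.2 hd) hx).2 hdvd l
      nlinarith
    have hu := not_pow_succ_dvd_sum_add hl hd he₀ hlt (hxl.mul_right y)
    set u := ∑ e ∈ S, d e + x * y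
    have hu0 : u ≠ 0 := fun h ↦ hu (h ▸ dvd_zero _)
    rw [hl.pow_dvd_iff_le_factorization hu0, not_le, Nat.lt_succ_iff] at hu
    have := (Nat.factorization_le_iff_dvd (Finset.prod_ne_zero_iff.2 hd)
      (pow_ne_zero _ hu0)).2 h l
    rw [Nat.factorization_pow, Finsupp.smul_apply, smul_eq_mul] at this
    have := Nat.mul_le_mul_left S.card hu
    omega

lemma exists_subset_card_eq_injOn_apply {α ι : Type*} [Fintype ι] [DecidableEq ι] {t : ℕ}
    {P : Finset (ι → α)} (hP : t ^ Fintype.card ι < P.card) :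
    ∃ i, ∃ S ⊆ P, S.card = t + 1 ∧ Set.InjOn (fun e : ι → α ↦ e i) S := by
  classical
  obtain ⟨i, hi⟩ : ∃ i, t < (P.image fun e ↦ e i).card := by
    by_contra! h
    refine absurd hP (not_lt.2 ?_)
    calc P.card ≤ (Fintype.piFinset fun i ↦ P.image fun e ↦ e i).card :=
          Finset.card_le_card fun e he ↦
            Fintype.mem_piFinset.2 fun i ↦ Finset.mem_image_of_mem _ he
      _ = ∏ i, (P.image fun e ↦ e i).card := Fintype.card_piFinset _
      _ ≤ ∏ _i : ι, t := Finset.prod_le_prod' fun i _ ↦ h i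
      _ = t ^ Fintype.card ι := by simp
  obtain ⟨T, hT, hTc⟩ := Finset.exists_subset_card_eq (Nat.succ_le_of_lt hi)
  have hex (v : T) : ∃ e ∈ P, e i = v := by simpa using hT v.2
  choose g hgP hg using hex
  have hginj : Function.Injective g := fun v w h ↦ Subtype.ext (by rw [← hg, ← hg, h])
  refine ⟨i, Finset.univ.image g, ?_, ?_, ?_⟩
  · simpa [Finset.image_subset_iff] using hgP
  · rw [Finset.card_image_of_injective _ hginj]
    simpa using hTc
  · simp only [Finset.coe_image, Finset.coe_univ, Set.image_univ]
    rintro _ ⟨v, rfl⟩ _ ⟨w, rfl⟩ h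
    rw [show v = w from Subtype.ext (by simpa [hg] using h)]

lemma Nat.factorization_prod_prime_pow {ι : Type*} [Fintype ι] [DecidableEq ι] {l : ι → ℕ}
    (hl : ∀ i, (l i).Prime) (hinj : Function.Injective l) (e : ι → ℕ) (i : ι) :
    (∏ j, l j ^ e j).factorization (l i) = e i := by
  rw [Nat.factorization_prod_apply fun j _ ↦ pow_ne_zero _ (hl j).ne_zero]
  simp [(hl _).factorization, Finsupp.single_apply, hinj.eq_iff]

/-- For every `k ≥ 3` there are infinitely many squarefree `n` with exactly `k - 1`
distinct prime factors such that `φ n ∣ (n - 1) ^ k` but `φ n ∤ (n - 1) ^ (k - 1)`. -/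
theorem infinitely_many_kLehmer_not_predLehmer (k : ℕ) (hk : 3 ≤ k) :
    {n : ℕ | Squarefree n ∧ n.primeFactors.card = k - 1 ∧
      Nat.totient n ∣ (n - 1) ^ k ∧ ¬ Nat.totient n ∣ (n - 1) ^ (k - 1)}.Infinite := by
  obtain ⟨t, rfl⟩ : ∃ t, k = t + 2 := ⟨k - 2, by omega⟩
  refine Set.infinite_of_forall_exists_gt fun B ↦ ?_
  set l : Fin 12 → ℕ := fun i ↦ Nat.nth Nat.Prime (i + 1)
  have hl (i) : (l i).Prime := Nat.prime_nth_prime _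
  have hlinj : Function.Injective l := fun i j hij ↦ by
    have := Nat.nth_injective Nat.infinite_setOfPred_prime hij
    exact Fin.ext (by omega)
  have hlodd (i) : Odd (l i) := by
    refine (hl i).odd_of_ne_two fun h ↦ ?_
    rw [← Nat.nth_prime_zero_eq_two] at h
    have := Nat.nth_injective Nat.infinite_setOfPred_prime h
    omega
  set Q : ℕ := ∏ i, l i with hQdef
  have hQ : Odd Q := Finset.prod_induction l Odd (fun _ _ ↦ Odd.mul) odd_one fun i _ ↦ hlodd i
  have hQ1 : 1 < Q := (hl 0).one_lt.trans_le
    (Nat.le_of_dvd hQ.pos (Finset.dvd_prod_of_mem l (Finset.mem_univ 0)))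
  obtain ⟨C, hC⟩ := exists_lt_card_filter_prime_one_add_mul hQ
  obtain ⟨E, hE⟩ := exists_nat_gt (max (B + 1 : ℝ) (C * t ^ 12 * (t + 2) ^ 11))
  have hEB : B + 1 < E := by exact_mod_cast (le_max_left _ _).trans_lt hE
  have hEC := (le_max_right _ _).trans_lt hE
  have hE0 : 0 < E := by omega
  set d : (Fin 12 → Fin E) → ℕ := fun e ↦ ∏ i, l i ^ (e i : ℕ) with hd
  set W : ℕ := Q ^ (E * (t + 1)) with hW
  have hdE (e) : d e ∣ Q ^ E := by
    rw [hQdef, ← Finset.prod_pow]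
    exact Finset.prod_dvd_prod_of_dvd _ _ fun i _ ↦ pow_dvd_pow _ (e i).2.le
  obtain ⟨m, hm, hcard⟩ := hC (E * (t + 2)) (Nat.mul_pos hE0 (by omega))
    (Finset.univ : Finset (Fin 12 → Fin E)) (fun e ↦ W * d e)
    (fun e _ ↦ ⟨(dvd_pow_self Q (by positivity)).mul_right _, by
      rw [show E * (t + 2) = E * (t + 1) + E by ring, pow_add]
      exact mul_dvd_mul_left _ (hdE e)⟩) (t ^ 12) (by
      have : (0 : ℝ) < E := mod_cast hE0
      simp only [Finset.card_univ, Fintype.card_fun, Fintype.card_fin]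
      push_cast
      calc C * (t : ℝ) ^ 12 * ((E : ℝ) * (t + 2)) ^ 11
          = (C * t ^ 12 * (t + 2) ^ 11) * (E : ℝ) ^ 11 := by ring
        _ < (E : ℝ) * (E : ℝ) ^ 11 := by gcongr
        _ = (E : ℝ) ^ 12 := by ring)
  obtain ⟨i, S, hSP, hSc, hSinj⟩ := exists_subset_card_eq_injOn_apply (t := t)
    (P := Finset.univ.filter fun e ↦ (1 + W * d e * m).Prime) (by rwa [Fintype.card_fin])
  have hprime (e) (he : e ∈ S) : (1 + W * m * d e).Prime := by
    have := (Finset.mem_filter.1 (hSP he)).2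
    rwa [mul_right_comm] at this
  have hEB' : B < W := calc
    B < E := by omega
    _ < Q ^ E := Nat.lt_pow_self hQ1
    _ ≤ W := Nat.pow_le_pow_right hQ.pos (Nat.le_mul_of_pos_right _ (by omega))
  have hW0 : 0 < W := pow_pos hQ.pos _
  have hx0 : W * m ≠ 0 := by positivity
  have hlehmer := lehmer_prod_one_add_mul (d := d) (hl i) (by omega) hx0 hprime
    (fun a ha b hb hab ↦ hSinj ha hb <| Fin.ext <| by
      simpa [hd, Nat.factorization_prod_prime_pow hl hlinj (fun j ↦ ((a j : Fin E) : ℕ)),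
        Nat.factorization_prod_prime_pow hl hlinj (fun j ↦ ((b j : Fin E) : ℕ))] using hab)
    (by
      refine Dvd.dvd.mul_right ?_ m
      rw [hW, pow_mul, ← hSc, ← Finset.prod_const]
      exact Finset.prod_dvd_prod_of_dvd _ _ fun e _ ↦ hdE e)
  rw [hSc] at hlehmer
  refine ⟨∏ e ∈ S, (1 + W * m * d e), hlehmer, ?_⟩
  obtain ⟨e, he⟩ := Finset.card_pos.1 (by omega : 0 < S.card)
  have hle : 1 + W * m * d e ≤ ∏ e ∈ S, (1 + W * m * d e) :=
    Finset.single_le_prod' (f := fun e ↦ 1 + W * m * d e) (fun e _ ↦ Nat.le_add_right _ _) he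
  have hd0 : 0 < d e := Nat.pos_of_dvd_of_pos (hdE e) (pow_pos hQ.pos _)
  clear_value W d
  have hmd : W ≤ W * m * d e := by
    rw [mul_assoc]
    exact Nat.le_mul_of_pos_right W (Nat.mul_pos hm hd0)
  exact hEB'.trans_le (hmd.trans ((Nat.le_add_left _ _).trans hle))
end

section
/- For every integer k ≥ 3 and every ε > 0, there exists x₀ such that for all real x ≥ x₀, the number of n ≤ x that have exactly k − 1 distinct prime factors, are squarefree, and satisfy φ(n) | (n − 1)^k but φ(n) ∤ (n − 1)^{k−1}, is at least x^{1/(k−1) − ε}. (In other words, the count of such numbers up to x is at least x^{1/(k−1) + o(1)} as x → ∞.) -/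
open Finset
open ArithmeticFunction (vonMangoldt moebius zeta)

/-- The indicator of `1 mod N` minus the normalized indicator of the residues coprime to `N`. -/
noncomputable def residueDiscrepancy (N : ℕ) (x : ZMod N) : ℝ :=
  Set.indicator {1} 1 x - Set.indicator {y : ZMod N | IsUnit y} (fun _ => (N.totient : ℝ)⁻¹) x

theorem sum_range_natCast_zmod {N : ℕ} [NeZero N] (G : ZMod N → ℝ) :
    ∑ m ∈ range N, G (m : ZMod N) = ∑ x, G x := by
  refine Finset.sum_bij' (fun m _ => (m : ZMod N)) (fun x _ => x.val) ?_ ?_ ?_ ?_ ?_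
  · simp
  · intro x _
    simpa using ZMod.val_lt x
  · intro m hm
    exact ZMod.val_cast_of_lt (by simpa using hm)
  · simp
  · simp

theorem sum_indicator_isUnit {N : ℕ} [NeZero N] :
    ∑ x : ZMod N, Set.indicator {y : ZMod N | IsUnit y} (fun _ => (N.totient : ℝ)⁻¹) x = 1 := by
  classical
  have h : (N.totient : ℝ) ≠ 0 := by
    have := Nat.totient_pos.2 (NeZero.pos N)
    positivity
  simp only [Set.indicator_apply, Set.mem_ofPred_eq]
  rw [← Finset.sum_filter, Finset.sum_const, nsmul_eq_mul]
  have : (univ.filter fun x : ZMod N => IsUnit x).card = N.totient := by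
    rw [← ZMod.card_units_eq_totient N, ← Fintype.card_subtype]
    exact Fintype.card_congr
      ⟨fun x => x.2.unit, fun u => ⟨u, u.isUnit⟩, fun x => Subtype.ext x.2.unit_spec,
        fun u => Units.ext u.isUnit.unit_spec⟩
  rw [this, mul_inv_cancel₀ h]

theorem sum_indicator_one {N : ℕ} [NeZero N] :
    ∑ x : ZMod N, Set.indicator {1} (1 : ZMod N → ℝ) x = 1 := by
  classical
  simp [Set.indicator_apply]

theorem sum_residueDiscrepancy {N : ℕ} [NeZero N] :
    ∑ x : ZMod N, residueDiscrepancy N x = 0 := by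
  simp only [residueDiscrepancy, Finset.sum_sub_distrib, sum_indicator_isUnit, sum_indicator_one,
    sub_self]

theorem sum_abs_residueDiscrepancy {N : ℕ} [NeZero N] :
    ∑ x : ZMod N, |residueDiscrepancy N x| ≤ 2 := by
  calc ∑ x : ZMod N, |residueDiscrepancy N x|
      ≤ ∑ x : ZMod N, (Set.indicator {1} (1 : ZMod N → ℝ) x +
          Set.indicator {y : ZMod N | IsUnit y} (fun _ => (N.totient : ℝ)⁻¹) x) := by
        refine Finset.sum_le_sum fun x _ => ?_
        refine (abs_sub _ _).trans_eq ?_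
        rw [abs_of_nonneg, abs_of_nonneg]
        · exact Set.indicator_nonneg (fun _ _ => by positivity) _
        · exact Set.indicator_nonneg (fun _ _ => zero_le_one) _
    _ = 2 := by
        rw [Finset.sum_add_distrib, sum_indicator_isUnit, sum_indicator_one]; norm_num

theorem residueDiscrepancy_of_not_isUnit {N : ℕ} {x : ZMod N} (hx : ¬ IsUnit x) :
    residueDiscrepancy N x = 0 := by
  have : x ≠ 1 := by rintro rfl; exact hx isUnit_one
  simp [residueDiscrepancy, hx, this]

theorem abs_residueDiscrepancy_le {N : ℕ} [NeZero N] (x : ZMod N) :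
    |residueDiscrepancy N x| ≤ 2 :=
  (Finset.single_le_sum (f := fun x => |residueDiscrepancy N x|) (fun _ _ => abs_nonneg _)
    (mem_univ x)).trans sum_abs_residueDiscrepancy

theorem sum_residueDiscrepancy_mul {N : ℕ} [NeZero N] (d : ZMod N) :
    ∑ x : ZMod N, residueDiscrepancy N (x * d) = 0 := by
  by_cases hd : IsUnit d
  · obtain ⟨u, rfl⟩ := hd
    rw [← sum_residueDiscrepancy (N := N)]
    exact Fintype.sum_equiv (Units.mulRight u) _ _ fun x => rfl
  · refine Finset.sum_eq_zero fun x _ => residueDiscrepancy_of_not_isUnit ?_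
    exact fun h => hd (isUnit_of_mul_isUnit_right h)

theorem sum_abs_residueDiscrepancy_mul {N : ℕ} [NeZero N] (d : ZMod N) :
    ∑ x : ZMod N, |residueDiscrepancy N (x * d)| ≤ 2 := by
  by_cases hd : IsUnit d
  · obtain ⟨u, rfl⟩ := hd
    refine le_of_eq_of_le ?_ (sum_abs_residueDiscrepancy (N := N))
    exact Fintype.sum_equiv (Units.mulRight u) _ _ fun x => rfl
  · rw [Finset.sum_eq_zero fun x _ => ?_]
    · norm_num
    · rw [residueDiscrepancy_of_not_isUnit, abs_zero]
      exact fun h => hd (isUnit_of_mul_isUnit_right h)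

theorem sum_mul_zmod_of_coprime {M N : ℕ} [NeZero M] [NeZero N] (h : M.Coprime N)
    (A : ZMod M → ℝ) (B : ZMod N → ℝ) :
    ∑ m ∈ range (M * N), A m * B m = (∑ x, A x) * ∑ y, B y := by
  let e := ZMod.chineseRemainder h
  have h1 := sum_range_natCast_zmod (N := M * N) (fun z => A (e z).1 * B (e z).2)
  simp only [map_natCast, Prod.fst_natCast, Prod.snd_natCast] at h1
  rw [h1, Finset.sum_mul_sum, ← Finset.sum_product', ← Finset.univ_product_univ.symm]
  exact Fintype.sum_equiv e.toEquiv _ _ fun x => rfl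

/-- Partial sums of a periodic function are, up to full periods, sums over part of a period. -/
theorem abs_sum_range_le_of_periodic {g : ℕ → ℝ} {N : ℕ} {B : ℝ} (hN : 0 < N)
    (hg : Function.Periodic g N) (h0 : ∑ m ∈ range N, g m = 0)
    (hB : ∑ m ∈ range N, |g m| ≤ B) (z : ℕ) : |∑ m ∈ range z, g m| ≤ B := by
  induction z using Nat.strong_induction_on with
  | _ z ih =>
    rcases lt_or_ge z N with hz | hz
    · refine (Finset.abs_sum_le_sum_abs _ _).trans (le_trans ?_ hB)
      exact Finset.sum_le_sum_of_subset_of_nonneg (range_subset_range.2 hz.le)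
        fun _ _ _ => abs_nonneg _
    · obtain ⟨w, rfl⟩ := Nat.exists_eq_add_of_le hz
      rw [Finset.sum_range_add, h0, zero_add]
      have : ∀ m, g (N + m) = g m := fun m => by rw [add_comm]; exact hg m
      simp only [this]
      exact ih w (by omega)

theorem sum_range_le_of_periodic {g : ℕ → ℝ} {N : ℕ} {B : ℝ} (hN : 0 < N)
    (hg : Function.Periodic g N) (h0 : ∀ m, 0 ≤ g m)
    (hB : ∑ m ∈ range N, g m ≤ B) (z : ℕ) :
    ∑ m ∈ range z, g m ≤ B * ((z : ℝ) / N + 1) := by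
  have hB0 : 0 ≤ B := (Finset.sum_nonneg fun _ _ => h0 _).trans hB
  have hN' : (0 : ℝ) < N := by exact_mod_cast hN
  induction z using Nat.strong_induction_on with
  | _ z ih =>
    rcases lt_or_ge z N with hz | hz
    · calc ∑ m ∈ range z, g m ≤ ∑ m ∈ range N, g m :=
            Finset.sum_le_sum_of_subset_of_nonneg (range_subset_range.2 hz.le) fun _ _ _ => h0 _
        _ ≤ B * 1 := by simpa using hB
        _ ≤ _ := by gcongr; simp; positivity
    · obtain ⟨w, rfl⟩ := Nat.exists_eq_add_of_le hz
      rw [Finset.sum_range_add]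
      have : ∀ m, g (N + m) = g m := fun m => by rw [add_comm]; exact hg m
      simp only [this]
      have := ih w (by omega)
      have h2 : ((N + w : ℕ) : ℝ) / N = 1 + w / N := by push_cast; field_simp
      rw [h2]; nlinarith

/-- Summation by parts against a monotone weight. -/
theorem abs_sum_mul_le_of_monotone {w g : ℕ → ℝ} {B : ℝ} (hw : Monotone w) (hw0 : 0 ≤ w 0)
    (hB : ∀ z, |∑ m ∈ range z, g m| ≤ B) (z : ℕ) :
    |∑ m ∈ range (z + 1), w m * g m| ≤ 2 * B * w z := by
  have key : |∑ m ∈ range (z + 1), w m * g m - w z * ∑ m ∈ range (z + 1), g m| ≤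
      B * (w z - w 0) := by
    induction z with
    | zero => simp
    | succ z ih =>
      have h1 : ∑ m ∈ range (z + 1 + 1), w m * g m - w (z + 1) * ∑ m ∈ range (z + 1 + 1), g m =
          (∑ m ∈ range (z + 1), w m * g m - w z * ∑ m ∈ range (z + 1), g m) -
            (w (z + 1) - w z) * ∑ m ∈ range (z + 1), g m := by
        rw [Finset.sum_range_succ _ (z + 1), Finset.sum_range_succ _ (z + 1)]; ring
      have h2 : |(w (z + 1) - w z) * ∑ m ∈ range (z + 1), g m| ≤ (w (z + 1) - w z) * B := by
        have h3 : 0 ≤ w (z + 1) - w z := sub_nonneg.2 (hw (Nat.le_succ z))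
        rw [abs_mul, abs_of_nonneg h3]
        exact mul_le_mul_of_nonneg_left (hB _) h3
      rw [h1]
      refine (abs_sub _ _).trans ?_
      linarith
  have hB0 : 0 ≤ B := (abs_nonneg _).trans (hB 0)
  have hwz : 0 ≤ w z := hw0.trans (hw (Nat.zero_le z))
  have h4 : |w z * ∑ m ∈ range (z + 1), g m| ≤ w z * B := by
    rw [abs_mul, abs_of_nonneg hwz]
    exact mul_le_mul_of_nonneg_left (hB _) hwz
  have h5 := abs_sub_abs_le_abs_sub (∑ m ∈ range (z + 1), w m * g m)
    (w z * ∑ m ∈ range (z + 1), g m)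
  nlinarith [mul_nonneg hB0 hw0]

theorem abs_sum_range_residueDiscrepancy_le {N : ℕ} [NeZero N] (d z : ℕ) :
    |∑ m ∈ range z, residueDiscrepancy N ((m * d : ℕ) : ZMod N)| ≤ 2 := by
  refine abs_sum_range_le_of_periodic (N := N) (NeZero.pos N) (fun m => by simp) ?_ ?_ z
  · simp only [Nat.cast_mul]
    rw [sum_range_natCast_zmod (fun x => residueDiscrepancy N (x * (d : ZMod N)))]
    exact sum_residueDiscrepancy_mul _
  · simp only [Nat.cast_mul]
    rw [sum_range_natCast_zmod (fun x => |residueDiscrepancy N (x * (d : ZMod N))|)]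
    exact sum_abs_residueDiscrepancy_mul _

theorem sum_range_abs_residueDiscrepancy_le {N : ℕ} [NeZero N] (d z : ℕ) :
    ∑ m ∈ range z, |residueDiscrepancy N ((m * d : ℕ) : ZMod N)| ≤ 2 * ((z : ℝ) / N + 1) := by
  refine sum_range_le_of_periodic (N := N) (NeZero.pos N) (fun m => by simp)
    (fun _ => abs_nonneg _) ?_ z
  simp only [Nat.cast_mul]
  rw [sum_range_natCast_zmod (fun x => |residueDiscrepancy N (x * (d : ZMod N))|)]
  exact sum_abs_residueDiscrepancy_mul _

theorem abs_sum_range_residueDiscrepancy_mul_le {M N : ℕ} [NeZero M] [NeZero N]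
    (h : M.Coprime N) (k l z : ℕ) :
    |∑ m ∈ range z, residueDiscrepancy M ((m * k : ℕ) : ZMod M) *
      residueDiscrepancy N ((m * l : ℕ) : ZMod N)| ≤ 4 := by
  refine abs_sum_range_le_of_periodic (N := M * N) (NeZero.pos _) (fun m => by simp) ?_ ?_ z
  · simp only [Nat.cast_mul]
    rw [sum_mul_zmod_of_coprime h (fun x => residueDiscrepancy M (x * (k : ZMod M)))
      (fun x => residueDiscrepancy N (x * (l : ZMod N))), sum_residueDiscrepancy_mul, zero_mul]
  · simp only [Nat.cast_mul, abs_mul]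
    rw [sum_mul_zmod_of_coprime h (fun x => |residueDiscrepancy M (x * (k : ZMod M))|)
      (fun x => |residueDiscrepancy N (x * (l : ZMod N))|)]
    calc _ ≤ (2 : ℝ) * 2 := by
          gcongr
          · exact sum_abs_residueDiscrepancy_mul _
          · exact sum_abs_residueDiscrepancy_mul _
      _ = 4 := by norm_num

/-- The identity weight cut off below `U`. -/
noncomputable def cutoffWeight (U m : ℕ) : ℝ := if U < m then (m : ℝ) else 0

theorem cutoffWeight_monotone (U : ℕ) : Monotone (cutoffWeight U) := by
  intro m n h
  unfold cutoffWeight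
  split_ifs with h1 h2 h2
  · exact_mod_cast h
  · omega
  · positivity
  · rfl

theorem cutoffWeight_nonneg (U m : ℕ) : 0 ≤ cutoffWeight U m := by
  unfold cutoffWeight; split_ifs <;> positivity

theorem cutoffWeight_le (U m : ℕ) : cutoffWeight U m ≤ m := by
  unfold cutoffWeight; split_ifs
  · rfl
  · positivity

theorem abs_sum_cutoffWeight_residueDiscrepancy_mul_le {M N : ℕ} [NeZero M] [NeZero N]
    (h : M.Coprime N) (U k l z : ℕ) :
    |∑ m ∈ Ioc 0 z, cutoffWeight U m * (residueDiscrepancy M ((m * k : ℕ) : ZMod M) *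
      residueDiscrepancy N ((m * l : ℕ) : ZMod N))| ≤ 8 * cutoffWeight U z := by
  have h1 := abs_sum_mul_le_of_monotone (cutoffWeight_monotone U) (cutoffWeight_nonneg U 0)
    (abs_sum_range_residueDiscrepancy_mul_le h k l) z
  rw [Finset.range_eq_Ico, Finset.sum_eq_sum_Ico_succ_bot (by omega)] at h1
  have h2 : cutoffWeight U 0 = 0 := by simp [cutoffWeight]
  rw [h2, zero_mul, zero_add] at h1
  have h3 : Ico (0 + 1) (z + 1) = Ioc 0 z := by ext; simp; omega
  rw [h3] at h1
  linarith

/-- A convolution sum with a fixed first variable. -/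
noncomputable def discrepancySum (b : ℕ → ℝ) (X N m : ℕ) : ℝ :=
  ∑ k ∈ Ioc 0 (X / m), b k * residueDiscrepancy N ((m * k : ℕ) : ZMod N)

theorem discrepancySum_eq_sum_ite {b : ℕ → ℝ} {X N m : ℕ} (hm : 0 < m) :
    discrepancySum b X N m =
      ∑ k ∈ Ioc 0 X, if m * k ≤ X then b k * residueDiscrepancy N ((m * k : ℕ) : ZMod N) else 0 := by
  rw [discrepancySum, ← Finset.sum_filter]
  congr 1
  ext k
  simp only [mem_Ioc, mem_filter, Nat.le_div_iff_mul_le hm, and_assoc]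
  constructor
  · rintro ⟨h1, h2⟩
    exact ⟨h1, by nlinarith, by linarith⟩
  · rintro ⟨h1, _, h2⟩
    exact ⟨h1, by linarith⟩

theorem abs_sum_discrepancySum_mul_le {M N : ℕ} [NeZero M] [NeZero N] (h : M.Coprime N)
    {b : ℕ → ℝ} {U X : ℕ} {B H : ℝ} (hU : 0 < U) (hb : ∀ k ∈ Ioc 0 X, |b k| ≤ B)
    (hH : ∑ k ∈ Ioc 0 X, (k : ℝ)⁻¹ ≤ H) (hB : 0 ≤ B) :
    |∑ m ∈ Ioc 0 X, cutoffWeight U m * (discrepancySum b X M m * discrepancySum b X N m)| ≤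
      8 * B ^ 2 * X ^ 2 * H / U := by
  have h1 : ∑ m ∈ Ioc 0 X, cutoffWeight U m * (discrepancySum b X M m * discrepancySum b X N m) =
      ∑ k ∈ Ioc 0 X, ∑ l ∈ Ioc 0 X, b k * b l * ∑ m ∈ Ioc 0 (min (X / k) (X / l)),
        cutoffWeight U m * (residueDiscrepancy M ((m * k : ℕ) : ZMod M) *
          residueDiscrepancy N ((m * l : ℕ) : ZMod N)) := by
    calc _ = ∑ m ∈ Ioc 0 X, ∑ k ∈ Ioc 0 X, ∑ l ∈ Ioc 0 X, b k * b l *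
          if m * k ≤ X ∧ m * l ≤ X then
            cutoffWeight U m * (residueDiscrepancy M ((m * k : ℕ) : ZMod M) *
              residueDiscrepancy N ((m * l : ℕ) : ZMod N)) else 0 := by
          refine Finset.sum_congr rfl fun m hm => ?_
          rw [discrepancySum_eq_sum_ite (mem_Ioc.1 hm).1, discrepancySum_eq_sum_ite (mem_Ioc.1 hm).1,
            Finset.sum_mul_sum, Finset.mul_sum]
          refine Finset.sum_congr rfl fun k _ => ?_
          rw [Finset.mul_sum]
          refine Finset.sum_congr rfl fun l _ => ?_
          by_cases h1 : m * k ≤ X <;> by_cases h2 : m * l ≤ X <;> simp [h1, h2]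
          ring
      _ = _ := by
          rw [Finset.sum_comm]
          refine Finset.sum_congr rfl fun k hk => ?_
          rw [Finset.sum_comm]
          refine Finset.sum_congr rfl fun l hl => ?_
          rw [← Finset.mul_sum, ← Finset.sum_filter]
          congr 2
          ext m
          have hk := (mem_Ioc.1 hk).1
          have hl := (mem_Ioc.1 hl).1
          simp only [mem_Ioc, mem_filter, le_min_iff, Nat.le_div_iff_mul_le hk,
            Nat.le_div_iff_mul_le hl, and_assoc]
          constructor
          · rintro ⟨h1, _, h2⟩
            exact ⟨h1, h2⟩
          · rintro ⟨h1, h2, h3⟩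
            exact ⟨h1, by nlinarith, h2, h3⟩
  rw [h1]
  have hU' : (0 : ℝ) < U := by exact_mod_cast hU
  calc _ ≤ ∑ k ∈ Ioc 0 X, ∑ l ∈ Ioc 0 X,
        (8 * B ^ 2 * X * (k : ℝ)⁻¹) * if l ≤ X / U then 1 else 0 := by
        refine (Finset.abs_sum_le_sum_abs _ _).trans (Finset.sum_le_sum fun k hk => ?_)
        refine (Finset.abs_sum_le_sum_abs _ _).trans (Finset.sum_le_sum fun l hl => ?_)
        rw [abs_mul, abs_mul]
        have h2 := abs_sum_cutoffWeight_residueDiscrepancy_mul_le h U k l (min (X / k) (X / l))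
        have h3 : cutoffWeight U (min (X / k) (X / l)) ≤
            X * (k : ℝ)⁻¹ * if l ≤ X / U then 1 else 0 := by
          split_ifs with h4
          · calc _ ≤ cutoffWeight U (X / k) := cutoffWeight_monotone U (min_le_left _ _)
              _ ≤ ((X / k : ℕ) : ℝ) := cutoffWeight_le _ _
              _ ≤ (X : ℝ) / k := Nat.cast_div_le
              _ = _ := by rw [div_eq_mul_inv, mul_one]
          · have h5 : X / l ≤ U := by
              have h6 := (mem_Ioc.1 hl).1
              rw [not_le, Nat.div_lt_iff_lt_mul hU] at h4
              refine (Nat.div_le_iff_le_mul_add_pred h6).2 ?_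
              omega
            have h6 : cutoffWeight U (min (X / k) (X / l)) = 0 := by
              unfold cutoffWeight
              rw [if_neg]
              have := min_le_right (X / k) (X / l)
              omega
            rw [h6, mul_zero]
        calc _ ≤ B * B * (8 * (X * (k : ℝ)⁻¹ * if l ≤ X / U then 1 else 0)) := by
              gcongr
              · exact hb k hk
              · exact hb l hl
              · exact h2.trans (by gcongr)
          _ = _ := by ring
    _ = (8 * B ^ 2 * X) * (∑ k ∈ Ioc 0 X, (k : ℝ)⁻¹) *
          ∑ l ∈ Ioc 0 X, if l ≤ X / U then (1 : ℝ) else 0 := by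
        simp_rw [← Finset.mul_sum]
        rw [← Finset.sum_mul, ← Finset.mul_sum]
    _ ≤ (8 * B ^ 2 * X) * H * (X / U) := by
        have h7 : ∑ l ∈ Ioc 0 X, (if l ≤ X / U then (1 : ℝ) else 0) ≤ X / U := by
          rw [← Finset.sum_filter, Finset.sum_const, nsmul_eq_mul, mul_one]
          refine le_trans ?_ (Nat.cast_div_le (m := X) (n := U))
          have : (Ioc 0 X).filter (fun l => l ≤ X / U) ⊆ Ioc 0 (X / U) := by
            intro l; simp only [mem_filter, mem_Ioc]; tauto
          have := Finset.card_le_card this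
          rw [Nat.card_Ioc] at this
          exact_mod_cast this
        have hH0 : 0 ≤ H := le_trans (Finset.sum_nonneg fun _ _ => by positivity) hH
        gcongr
    _ = _ := by ring

theorem sum_discrepancySum_sq_le {N : ℕ} [NeZero N] {b : ℕ → ℝ} {U X : ℕ} {B H s : ℝ}
    (hNU : N ≤ U) (hb : ∀ k ∈ Ioc 0 X, |b k| ≤ B) (hb0 : ∀ k ≤ U, b k = 0)
    (hH : ∑ k ∈ Ioc 0 X, (k : ℝ)⁻¹ ≤ H) (hs : |s| ≤ N) (hB : 0 ≤ B) :
    s ^ 2 * ∑ m ∈ Ioc 0 X, cutoffWeight U m * (discrepancySum b X N m) ^ 2 ≤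
      16 * B ^ 2 * X ^ 2 * H := by
  have hN : (0 : ℝ) < N := by exact_mod_cast NeZero.pos N
  have key : ∀ m ∈ Ioc 0 X, s ^ 2 * (cutoffWeight U m * (discrepancySum b X N m) ^ 2) ≤
      16 * B ^ 2 * X ^ 2 * (m : ℝ)⁻¹ := by
    intro m hm
    have hm0 := (mem_Ioc.1 hm).1
    have hm' : (0 : ℝ) < m := by exact_mod_cast hm0
    rcases le_or_gt (X / m) U with h | h
    · have : discrepancySum b X N m = 0 := by
        refine Finset.sum_eq_zero fun k hk => ?_
        rw [hb0 k ((mem_Ioc.1 hk).2.trans h), zero_mul]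
      rw [this]
      have : (0 : ℝ) ≤ 16 * B ^ 2 * X ^ 2 * (m : ℝ)⁻¹ := by positivity
      simpa using this
    · have h1 : |discrepancySum b X N m| ≤ B * (4 * (X / m) / N) := by
        calc _ ≤ ∑ k ∈ Ioc 0 (X / m), B * |residueDiscrepancy N ((k * m : ℕ) : ZMod N)| := by
              refine (Finset.abs_sum_le_sum_abs _ _).trans (Finset.sum_le_sum fun k hk => ?_)
              rw [abs_mul, mul_comm m k]
              gcongr
              refine hb k ?_
              simp only [mem_Ioc] at hk ⊢
              exact ⟨hk.1, hk.2.trans (Nat.div_le_self _ _)⟩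
          _ ≤ ∑ k ∈ range (X / m + 1), B * |residueDiscrepancy N ((k * m : ℕ) : ZMod N)| := by
              refine Finset.sum_le_sum_of_subset_of_nonneg ?_ fun _ _ _ => by positivity
              intro k; simp
          _ ≤ B * (2 * (((X / m + 1 : ℕ) : ℝ) / N + 1)) := by
              rw [← Finset.mul_sum]
              gcongr
              exact sum_range_abs_residueDiscrepancy_le m _
          _ ≤ B * (4 * (X / m) / N) := by
              have h2 : ((X / m : ℕ) : ℝ) ≤ (X : ℝ) / m := Nat.cast_div_le
              have h3 : (N : ℝ) + 1 ≤ ((X / m : ℕ) : ℝ) := by exact_mod_cast (by omega)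
              gcongr
              rw [div_add_one hN.ne', mul_div_assoc', div_le_div_iff_of_pos_right hN]
              push_cast
              linarith
      have h2 : |s * discrepancySum b X N m| ≤ 4 * B * X / m := by
        rw [abs_mul]
        calc _ ≤ N * (B * (4 * (X / m) / N)) := by gcongr
          _ = _ := by field_simp
      have h3 : (s * discrepancySum b X N m) ^ 2 ≤ (4 * B * X / m) ^ 2 := sq_le_sq' (abs_le.1 h2).1 (abs_le.1 h2).2
      calc s ^ 2 * (cutoffWeight U m * (discrepancySum b X N m) ^ 2)
          = cutoffWeight U m * (s * discrepancySum b X N m) ^ 2 := by ring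
        _ ≤ m * (4 * B * X / m) ^ 2 := by
            gcongr
            exact cutoffWeight_le _ _
        _ = _ := by field_simp; ring
  rw [Finset.mul_sum]
  refine (Finset.sum_le_sum key).trans ?_
  rw [← Finset.mul_sum]
  gcongr

theorem sq_sum_bilinear_le {ι : Type*} [Fintype ι] {N : ι → ℕ} [∀ i, NeZero (N i)]
    (hcop : Pairwise fun i j => (N i).Coprime (N j)) {F U X : ℕ} (hF : ∀ i, N i ≤ F)
    (hFU : F ≤ U) (hKU : Fintype.card ι * F ^ 2 ≤ U) (hU : 0 < U) {b c : ℕ → ℝ} {s : ι → ℝ}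
    {B H : ℝ} (hs : ∀ i, |s i| ≤ N i) (hb : ∀ k ∈ Ioc 0 X, |b k| ≤ B) (hb0 : ∀ k ≤ U, b k = 0)
    (hc0 : ∀ k ≤ U, c k = 0) (hH : ∑ k ∈ Ioc 0 X, (k : ℝ)⁻¹ ≤ H) (hB : 0 ≤ B) :
    (∑ i, s i * ∑ m ∈ Ioc 0 X, c m * discrepancySum b X (N i) m) ^ 2 ≤
      (∑ m ∈ Ioc 0 X, c m ^ 2 / m) * (24 * Fintype.card ι * B ^ 2 * X ^ 2 * H) := by
  classical
  have hH0 : 0 ≤ H := le_trans (Finset.sum_nonneg fun _ _ => by positivity) hH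
  have hU' : (0 : ℝ) < U := by exact_mod_cast hU
  have h1 : ∑ i, s i * ∑ m ∈ Ioc 0 X, c m * discrepancySum b X (N i) m =
      ∑ m ∈ Ioc 0 X, (c m / √m) *
        (√(cutoffWeight U m) * ∑ i, s i * discrepancySum b X (N i) m) := by
    simp_rw [Finset.mul_sum]
    rw [Finset.sum_comm]
    refine Finset.sum_congr rfl fun m hm => Finset.sum_congr rfl fun i _ => ?_
    rcases le_or_gt m U with h | h
    · simp [hc0 m h]
    · have hm' : (0 : ℝ) < m := by exact_mod_cast (mem_Ioc.1 hm).1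
      have : √(m : ℝ) ≠ 0 := (Real.sqrt_pos.2 hm').ne'
      rw [cutoffWeight, if_pos h]
      field_simp
  have h2 : ∑ m ∈ Ioc 0 X, (c m / √m) ^ 2 = ∑ m ∈ Ioc 0 X, c m ^ 2 / m := by
    refine Finset.sum_congr rfl fun m _ => ?_
    rw [div_pow, Real.sq_sqrt (by positivity)]
  have h3 : ∑ m ∈ Ioc 0 X, (√(cutoffWeight U m) * ∑ i, s i * discrepancySum b X (N i) m) ^ 2 =
      ∑ i, ∑ j, s i * s j * ∑ m ∈ Ioc 0 X,
        cutoffWeight U m * (discrepancySum b X (N i) m * discrepancySum b X (N j) m) := by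
    calc _ = ∑ m ∈ Ioc 0 X, ∑ i, ∑ j, s i * s j *
          (cutoffWeight U m * (discrepancySum b X (N i) m * discrepancySum b X (N j) m)) := by
          refine Finset.sum_congr rfl fun m _ => ?_
          rw [mul_pow, Real.sq_sqrt (cutoffWeight_nonneg _ _), sq (∑ i, _), Finset.sum_mul_sum,
            Finset.mul_sum]
          refine Finset.sum_congr rfl fun i _ => ?_
          rw [Finset.mul_sum]
          exact Finset.sum_congr rfl fun j _ => by ring
      _ = _ := by
          rw [Finset.sum_comm]
          refine Finset.sum_congr rfl fun i _ => ?_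
          rw [Finset.sum_comm]
          exact Finset.sum_congr rfl fun j _ => (Finset.mul_sum _ _ _).symm
  rw [h1]
  refine (Finset.sum_mul_sq_le_sq_mul_sq _ _ _).trans ?_
  rw [h2, h3]
  refine mul_le_mul_of_nonneg_left ?_ (Finset.sum_nonneg fun _ _ => by positivity)
  have h4 : ∀ i j, s i * s j * ∑ m ∈ Ioc 0 X,
        cutoffWeight U m * (discrepancySum b X (N i) m * discrepancySum b X (N j) m) ≤
      (if i = j then 16 * B ^ 2 * X ^ 2 * H else 0) + F ^ 2 * (8 * B ^ 2 * X ^ 2 * H / U) := by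
    intro i j
    split_ifs with hij
    · subst hij
      have := sum_discrepancySum_sq_le ((hF i).trans hFU) hb hb0 hH (hs i) hB
      have h5 : 0 ≤ (F : ℝ) ^ 2 * (8 * B ^ 2 * X ^ 2 * H / U) := by positivity
      simp only [← sq]
      linarith
    · rw [zero_add]
      refine (le_abs_self _).trans ?_
      rw [abs_mul, abs_mul, sq (F : ℝ)]
      have hF' : ∀ i, |s i| ≤ F := fun i => (hs i).trans (by exact_mod_cast hF i)
      gcongr
      · exact hF' i
      · exact hF' j
      · exact abs_sum_discrepancySum_mul_le (hcop hij) hU hb hH hB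
  refine (Finset.sum_le_sum fun i _ => Finset.sum_le_sum fun j _ => h4 i j).trans ?_
  simp only [Finset.sum_add_distrib, Finset.sum_ite_eq, mem_univ, if_true, Finset.sum_const,
    card_univ, nsmul_eq_mul]
  have h6 : (Fintype.card ι : ℝ) * F ^ 2 ≤ U := by exact_mod_cast hKU
  have h7 : (Fintype.card ι : ℝ) * F ^ 2 / U ≤ 1 := (div_le_one hU').2 h6
  calc _ = Fintype.card ι * (16 * B ^ 2 * X ^ 2 * H) +
        (Fintype.card ι * F ^ 2 / U) * (Fintype.card ι * (8 * B ^ 2 * X ^ 2 * H)) := by ring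
    _ ≤ Fintype.card ι * (16 * B ^ 2 * X ^ 2 * H) +
        1 * (Fintype.card ι * (8 * B ^ 2 * X ^ 2 * H)) := by gcongr
    _ = _ := by ring

/-- The part of an arithmetic function supported on `n ≤ U`. -/
def truncateLE (U : ℕ) (a : ArithmeticFunction ℝ) : ArithmeticFunction ℝ :=
  ⟨fun n => if n ≤ U then a n else 0, by simp⟩

theorem truncateLE_apply (U n : ℕ) (a : ArithmeticFunction ℝ) :
    truncateLE U a n = if n ≤ U then a n else 0 := rfl

theorem sub_truncateLE_apply (U n : ℕ) (a : ArithmeticFunction ℝ) :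
    (a - truncateLE U a) n = if n ≤ U then 0 else a n := by
  rw [sub_eq_add_neg, ArithmeticFunction.add_apply, ArithmeticFunction.neg_apply, truncateLE_apply]
  split_ifs <;> simp

/-- Vaughan's identity. -/
theorem vonMangoldt_eq_vaughan (U : ℕ) :
    vonMangoldt = truncateLE U vonMangoldt + truncateLE U (moebius : ArithmeticFunction ℝ) *
      ArithmeticFunction.log - truncateLE U vonMangoldt *
      truncateLE U (moebius : ArithmeticFunction ℝ) * (zeta : ArithmeticFunction ℝ) +
      ((zeta : ArithmeticFunction ℝ) * ((moebius : ArithmeticFunction ℝ) -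
        truncateLE U (moebius : ArithmeticFunction ℝ))) *
        (vonMangoldt - truncateLE U vonMangoldt) := by
  have h1 : (zeta : ArithmeticFunction ℝ) * (moebius : ArithmeticFunction ℝ) = 1 :=
    ArithmeticFunction.coe_zeta_mul_coe_moebius
  have h2 := ArithmeticFunction.vonMangoldt_mul_zeta
  rw [← h2]
  linear_combination (truncateLE U vonMangoldt - vonMangoldt) * h1

theorem sum_Ioc_mul_mul_eq_sum_sum (a b : ArithmeticFunction ℝ) (g : ℕ → ℝ) (X : ℕ) :
    ∑ n ∈ Ioc 0 X, (a * b) n * g n =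
      ∑ d ∈ Ioc 0 X, a d * ∑ m ∈ Ioc 0 (X / d), b m * g (d * m) := by
  calc _ = ∑ n ∈ Ioc 0 X, ∑ x ∈ Ioc 0 X ×ˢ Ioc 0 X with x.1 * x.2 = n,
        a x.1 * b x.2 * g (x.1 * x.2) := by
        refine Finset.sum_congr rfl fun n hn => ?_
        rw [mem_Ioc] at hn
        rw [ArithmeticFunction.mul_apply, Finset.sum_mul,
          Nat.divisorsAntidiagonal_eq_prod_filter_of_le hn.1.ne' hn.2]
        refine Finset.sum_congr rfl fun x hx => ?_
        rw [(mem_filter.1 hx).2]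
    _ = ∑ x ∈ Ioc 0 X ×ˢ Ioc 0 X with x.1 * x.2 ≤ X, a x.1 * b x.2 * g (x.1 * x.2) := by
        simp_rw [Finset.sum_filter]
        rw [Finset.sum_comm]
        refine Finset.sum_congr rfl fun x hx => ?_
        simp only [mem_product, mem_Ioc] at hx
        have := Nat.mul_pos hx.1.1 hx.2.1
        simp [this]
    _ = _ := by
        rw [Finset.sum_filter, Finset.sum_product]
        refine Finset.sum_congr rfl fun d hd => ?_
        have hd := (mem_Ioc.1 hd).1
        rw [← Finset.sum_filter, Finset.mul_sum]
        refine Finset.sum_congr ?_ fun m _ => by ring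
        ext m
        simp only [mem_filter, mem_Ioc, Nat.le_div_iff_mul_le hd, and_assoc]
        constructor
        · rintro ⟨h1, _, h2⟩
          exact ⟨h1, by linarith⟩
        · rintro ⟨h1, h2⟩
          exact ⟨h1, by nlinarith, by linarith⟩

theorem abs_sum_mul_residueDiscrepancy_le {N : ℕ} [NeZero N] {a w : ArithmeticFunction ℝ}
    {D X : ℕ} {A : ℝ} (hw : Monotone w) (ha : ∀ d ∈ Ioc 0 X, |a d| ≤ A)
    (ha0 : ∀ d, D < d → a d = 0) (hA : 0 ≤ A) :
    |∑ n ∈ Ioc 0 X, (a * w) n * residueDiscrepancy N (n : ZMod N)| ≤ D * A * (4 * w X) := by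
  have hw0 : w 0 = 0 := by simp
  have hwX : 0 ≤ w X := by rw [← hw0]; exact hw (Nat.zero_le X)
  rw [sum_Ioc_mul_mul_eq_sum_sum a w (fun n => residueDiscrepancy N (n : ZMod N))]
  have h1 : ∀ d z, z ≤ X →
      |∑ m ∈ Ioc 0 z, w m * residueDiscrepancy N ((d * m : ℕ) : ZMod N)| ≤ 4 * w X := by
    intro d z hz
    have h2 := abs_sum_mul_le_of_monotone hw hw0.ge
      (abs_sum_range_residueDiscrepancy_le (N := N) d) z
    rw [Finset.range_eq_Ico, Finset.sum_eq_sum_Ico_succ_bot (by omega)] at h2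
    rw [hw0, zero_mul, zero_add] at h2
    have h3 : Ico (0 + 1) (z + 1) = Ioc 0 z := by ext; simp; omega
    rw [h3] at h2
    simp_rw [mul_comm d]
    have := hw hz
    linarith
  calc _ ≤ ∑ d ∈ Ioc 0 X, if d ≤ D then A * (4 * w X) else 0 := by
        refine (Finset.abs_sum_le_sum_abs _ _).trans (Finset.sum_le_sum fun d hd => ?_)
        rw [abs_mul]
        split_ifs with h
        · gcongr
          · exact ha d hd
          · exact h1 d _ (Nat.div_le_self _ _)
        · rw [ha0 d (by omega), abs_zero, zero_mul]
    _ ≤ _ := by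
        rw [← Finset.sum_filter, Finset.sum_const, nsmul_eq_mul, mul_assoc]
        gcongr
        have : (Ioc 0 X).filter (fun l => l ≤ D) ⊆ Ioc 0 D := by
          intro l; simp only [mem_filter, mem_Ioc]; tauto
        simpa using Finset.card_le_card this

theorem abs_truncateLE_vonMangoldt_mul_moebius_le (U n : ℕ) :
    |(truncateLE U vonMangoldt * truncateLE U (moebius : ArithmeticFunction ℝ)) n| ≤
      Real.log n := by
  rw [ArithmeticFunction.mul_apply, ← ArithmeticFunction.vonMangoldt_sum,
    ← Nat.sum_divisorsAntidiagonal (fun i _ => (vonMangoldt i : ℝ))]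
  refine (Finset.abs_sum_le_sum_abs _ _).trans (Finset.sum_le_sum fun x _ => ?_)
  rw [abs_mul, truncateLE_apply, truncateLE_apply]
  have h1 : |((moebius : ArithmeticFunction ℝ) x.2)| ≤ 1 := by
    rw [ArithmeticFunction.intCoe_apply]
    exact_mod_cast ArithmeticFunction.abs_moebius_le_one
  have h2 : (0 : ℝ) ≤ vonMangoldt x.1 := ArithmeticFunction.vonMangoldt_nonneg
  split_ifs <;> simp [abs_of_nonneg h2, h2]
  simpa using mul_le_mul_of_nonneg_left h1 h2

theorem truncateLE_mul_truncateLE_eq_zero {U n : ℕ} (a b : ArithmeticFunction ℝ)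
    (h : U * U < n) : (truncateLE U a * truncateLE U b) n = 0 := by
  rw [ArithmeticFunction.mul_apply]
  refine Finset.sum_eq_zero fun x hx => ?_
  rw [Nat.mem_divisorsAntidiagonal] at hx
  rw [truncateLE_apply, truncateLE_apply]
  split_ifs with h1 h2
  · have := Nat.mul_le_mul h1 h2
    omega
  all_goals simp

theorem abs_zeta_mul_sub_truncateLE_moebius_le (U n : ℕ) :
    |((zeta : ArithmeticFunction ℝ) * ((moebius : ArithmeticFunction ℝ) -
      truncateLE U (moebius : ArithmeticFunction ℝ))) n| ≤ n.divisors.card := by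
  rw [ArithmeticFunction.coe_zeta_mul_apply, ← nsmul_one, ← Finset.sum_const]
  refine (Finset.abs_sum_le_sum_abs _ _).trans (Finset.sum_le_sum fun x _ => ?_)
  rw [sub_truncateLE_apply]
  split_ifs
  · simp
  · rw [ArithmeticFunction.intCoe_apply]
    exact_mod_cast ArithmeticFunction.abs_moebius_le_one

theorem zeta_mul_sub_truncateLE_eq_zero {U n : ℕ} (a : ArithmeticFunction ℝ) (h : n ≤ U) :
    ((zeta : ArithmeticFunction ℝ) * (a - truncateLE U a)) n = 0 := by
  rw [ArithmeticFunction.coe_zeta_mul_apply]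
  refine Finset.sum_eq_zero fun x hx => ?_
  rw [sub_truncateLE_apply, if_pos ((Nat.divisor_le hx).trans h)]

theorem card_divisors_mul_le (m n : ℕ) :
    (m * n).divisors.card ≤ m.divisors.card * n.divisors.card := by
  open Pointwise in
  rw [Nat.divisors_mul]
  exact Finset.card_mul_le

theorem sum_zeta_mul_zeta_mul_le (X : ℕ) {g : ℕ → ℝ} (hg : ∀ n, 0 ≤ g n)
    (hmul : ∀ m n, g (m * n) ≤ g m * g n) :
    ∑ n ∈ Ioc 0 X, (n.divisors.card : ℝ) * g n ≤ (∑ n ∈ Ioc 0 X, g n) ^ 2 := by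
  have h1 : ∀ n, ((zeta : ArithmeticFunction ℝ) * (zeta : ArithmeticFunction ℝ)) n =
      n.divisors.card := by
    intro n
    rw [ArithmeticFunction.coe_zeta_mul_apply, ← nsmul_one, ← Finset.sum_const]
    refine Finset.sum_congr rfl fun d hd => ?_
    have := (Nat.pos_of_mem_divisors hd).ne'
    simp [this]
  have h2 := sum_Ioc_mul_mul_eq_sum_sum (zeta : ArithmeticFunction ℝ)
    (zeta : ArithmeticFunction ℝ) g X
  simp only [h1] at h2
  rw [h2, sq, Finset.sum_mul]
  refine Finset.sum_le_sum fun d hd => ?_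
  have hd0 := (mem_Ioc.1 hd).1.ne'
  simp only [ArithmeticFunction.natCoe_apply, ArithmeticFunction.zeta_apply, hd0, if_false,
    Nat.cast_one, one_mul]
  rw [Finset.mul_sum]
  calc _ ≤ ∑ m ∈ Ioc 0 (X / d), g d * g m := by
        refine Finset.sum_le_sum fun m hm => ?_
        have := (mem_Ioc.1 hm).1.ne'
        simpa [this] using hmul d m
    _ ≤ _ := by
        refine Finset.sum_le_sum_of_subset_of_nonneg ?_ fun _ _ _ => mul_nonneg (hg _) (hg _)
        exact Finset.Ioc_subset_Ioc_right (Nat.div_le_self _ _)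

theorem sum_card_divisors_sq_div_le (X : ℕ) :
    ∑ n ∈ Ioc 0 X, (n.divisors.card : ℝ) ^ 2 / n ≤ (∑ n ∈ Ioc 0 X, (n : ℝ)⁻¹) ^ 4 := by
  have h1 := sum_zeta_mul_zeta_mul_le X (g := fun n => (n : ℝ)⁻¹) (fun n => by positivity)
    (fun m n => by push_cast; rw [mul_inv])
  have h2 := sum_zeta_mul_zeta_mul_le X (g := fun n => (n.divisors.card : ℝ) * (n : ℝ)⁻¹)
    (fun n => by positivity) (fun m n => by
      have : ((m * n).divisors.card : ℝ) ≤ m.divisors.card * n.divisors.card := by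
        exact_mod_cast card_divisors_mul_le m n
      push_cast
      rw [mul_inv]
      calc _ ≤ (m.divisors.card * n.divisors.card : ℝ) * ((m : ℝ)⁻¹ * (n : ℝ)⁻¹) := by gcongr
        _ = _ := by ring)
  calc _ = ∑ n ∈ Ioc 0 X, (n.divisors.card : ℝ) * (n.divisors.card * (n : ℝ)⁻¹) := by
        exact Finset.sum_congr rfl fun n _ => by ring
    _ ≤ _ := h2
    _ ≤ ((∑ n ∈ Ioc 0 X, (n : ℝ)⁻¹) ^ 2) ^ 2 := by gcongr
    _ = _ := by ring

theorem sum_Ioc_inv_le (X : ℕ) : ∑ n ∈ Ioc 0 X, (n : ℝ)⁻¹ ≤ 1 + Real.log X := by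
  have := harmonic_le_one_add_log X
  rw [harmonic_eq_sum_Icc] at this
  push_cast at this
  exact this

/-- The error term for primes congruent to `1` modulo `N`. -/
noncomputable def primeDiscrepancy (X N : ℕ) : ℝ :=
  ∑ n ∈ Ioc 0 X, vonMangoldt n * residueDiscrepancy N (n : ZMod N)

theorem abs_primeDiscrepancy_sub_le {N : ℕ} [NeZero N] {U X : ℕ} (hU : 0 < U) :
    |primeDiscrepancy X N - ∑ m ∈ Ioc 0 X, ((zeta : ArithmeticFunction ℝ) *
      ((moebius : ArithmeticFunction ℝ) - truncateLE U (moebius : ArithmeticFunction ℝ))) m *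
      discrepancySum (fun k => (vonMangoldt - truncateLE U vonMangoldt) k) X N m| ≤
      10 * U ^ 2 * Real.log X := by
  have hlog : Monotone (ArithmeticFunction.log) := by
    intro m n h
    rw [ArithmeticFunction.log_apply, ArithmeticFunction.log_apply]
    rcases Nat.eq_zero_or_pos m with rfl | hm
    · simp [Real.log_natCast_nonneg]
    · exact Real.log_le_log (by exact_mod_cast hm) (by exact_mod_cast h)
  have hzeta : Monotone (zeta : ArithmeticFunction ℝ) := by
    intro m n h
    simp only [ArithmeticFunction.natCoe_apply, ArithmeticFunction.zeta_apply]
    split_ifs <;> first | omega | simp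
  have hX := Real.log_natCast_nonneg X
  have hlogX : ∀ n ∈ Ioc 0 X, Real.log n ≤ Real.log X := fun n hn =>
    hlog (mem_Ioc.1 hn).2
  have h1 : |∑ n ∈ Ioc 0 X, truncateLE U vonMangoldt n * residueDiscrepancy N (n : ZMod N)| ≤
      U * (2 * Real.log X) := by
    calc _ ≤ ∑ n ∈ Ioc 0 X, if n ≤ U then 2 * Real.log X else 0 := by
          refine (Finset.abs_sum_le_sum_abs _ _).trans (Finset.sum_le_sum fun n hn => ?_)
          rw [abs_mul, truncateLE_apply]
          split_ifs
          · rw [abs_of_nonneg ArithmeticFunction.vonMangoldt_nonneg, mul_comm]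
            gcongr
            · exact abs_residueDiscrepancy_le _
            · exact ArithmeticFunction.vonMangoldt_le_log.trans (hlogX n hn)
          · simp
      _ ≤ _ := by
          rw [← Finset.sum_filter, Finset.sum_const, nsmul_eq_mul]
          gcongr
          have : (Ioc 0 X).filter (fun l => l ≤ U) ⊆ Ioc 0 U := by
            intro l; simp only [mem_filter, mem_Ioc]; tauto
          simpa using Finset.card_le_card this
  have h2 := abs_sum_mul_residueDiscrepancy_le (N := N) (X := X) (D := U) (A := 1)
    (a := truncateLE U (moebius : ArithmeticFunction ℝ)) hlog (fun d _ => by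
      rw [truncateLE_apply]
      split_ifs
      · rw [ArithmeticFunction.intCoe_apply]
        exact_mod_cast ArithmeticFunction.abs_moebius_le_one
      · simp) (fun d hd => by rw [truncateLE_apply, if_neg (by omega)]) zero_le_one
  have h3 := abs_sum_mul_residueDiscrepancy_le (N := N) (X := X) (D := U * U) (A := Real.log X)
    (a := truncateLE U vonMangoldt * truncateLE U (moebius : ArithmeticFunction ℝ)) hzeta
    (fun d hd => (abs_truncateLE_vonMangoldt_mul_moebius_le U d).trans (hlogX d hd))
    (fun d hd => truncateLE_mul_truncateLE_eq_zero _ _ hd) hX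
  have h4 : (zeta : ArithmeticFunction ℝ) X ≤ 1 := by
    simp only [ArithmeticFunction.natCoe_apply, ArithmeticFunction.zeta_apply]
    split_ifs <;> simp
  have h5 : primeDiscrepancy X N - ∑ m ∈ Ioc 0 X, ((zeta : ArithmeticFunction ℝ) *
      ((moebius : ArithmeticFunction ℝ) - truncateLE U (moebius : ArithmeticFunction ℝ))) m *
      discrepancySum (fun k => (vonMangoldt - truncateLE U vonMangoldt) k) X N m =
      ∑ n ∈ Ioc 0 X, truncateLE U vonMangoldt n * residueDiscrepancy N (n : ZMod N) +
      ∑ n ∈ Ioc 0 X, (truncateLE U (moebius : ArithmeticFunction ℝ) *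
        ArithmeticFunction.log) n * residueDiscrepancy N (n : ZMod N) -
      ∑ n ∈ Ioc 0 X, (truncateLE U vonMangoldt * truncateLE U (moebius : ArithmeticFunction ℝ) *
        (zeta : ArithmeticFunction ℝ)) n * residueDiscrepancy N (n : ZMod N) := by
    have h6 := sum_Ioc_mul_mul_eq_sum_sum ((zeta : ArithmeticFunction ℝ) *
      ((moebius : ArithmeticFunction ℝ) - truncateLE U (moebius : ArithmeticFunction ℝ)))
      (vonMangoldt - truncateLE U vonMangoldt) (fun n => residueDiscrepancy N (n : ZMod N)) X
    simp only [discrepancySum]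
    rw [← h6, primeDiscrepancy, ← Finset.sum_sub_distrib, ← Finset.sum_add_distrib,
      ← Finset.sum_sub_distrib]
    refine Finset.sum_congr rfl fun n _ => ?_
    have h7 := congrArg (fun a : ArithmeticFunction ℝ => a n) (vonMangoldt_eq_vaughan U)
    simp only [sub_eq_add_neg, ArithmeticFunction.add_apply, ArithmeticFunction.neg_apply] at h7 ⊢
    rw [h7]
    ring
  rw [h5]
  have hU1 : (1 : ℝ) ≤ U := by exact_mod_cast hU
  have hU2 : (U : ℝ) ≤ (U : ℝ) ^ 2 := by nlinarith
  rw [ArithmeticFunction.log_apply] at h2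
  have h8 : ((U * U : ℕ) : ℝ) * Real.log X * (4 * (zeta : ArithmeticFunction ℝ) X) ≤
      U ^ 2 * Real.log X * (4 * 1) := by
    push_cast
    rw [sq]
    gcongr
  have h9 := mul_le_mul_of_nonneg_right hU2 hX
  refine (abs_sub _ _).trans ((add_le_add_left (abs_add_le _ _) _).trans ?_)
  linarith

theorem sum_totient_mul_abs_primeDiscrepancy_le {ι : Type*} [Fintype ι] {N : ι → ℕ}
    [∀ i, NeZero (N i)] (hcop : Pairwise fun i j => (N i).Coprime (N j)) {F U X : ℕ}
    (hF : ∀ i, N i ≤ F) (hFU : F ≤ U) (hKU : Fintype.card ι * F ^ 2 ≤ U) (hU : 0 < U)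
    {R l : ℝ} (hR : 0 ≤ R) (hKR : (Fintype.card ι : ℝ) ≤ R ^ 2) (hl : 1 + Real.log X ≤ l) :
    ∑ i, ((N i).totient : ℝ) * |primeDiscrepancy X (N i)| ≤
      5 * R * X * l ^ 4 + Fintype.card ι * F * (10 * U ^ 2 * l) := by
  set c : ℕ → ℝ := fun m => ((zeta : ArithmeticFunction ℝ) *
    ((moebius : ArithmeticFunction ℝ) - truncateLE U (moebius : ArithmeticFunction ℝ))) m with hc
  set b : ℕ → ℝ := fun m => (vonMangoldt - truncateLE U vonMangoldt) m with hb
  set T : ι → ℝ := fun i => ∑ m ∈ Ioc 0 X, c m * discrepancySum b X (N i) m with hT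
  have hX := Real.log_natCast_nonneg X
  have hl1 : 1 ≤ l := by linarith
  have h1 : ∀ i, |primeDiscrepancy X (N i)| ≤ |T i| + 10 * U ^ 2 * l := by
    intro i
    have h2 := abs_primeDiscrepancy_sub_le (N := N i) (X := X) hU
    have h3 := abs_sub_abs_le_abs_sub (primeDiscrepancy X (N i)) (T i)
    have h4 : 10 * (U : ℝ) ^ 2 * Real.log X ≤ 10 * U ^ 2 * l := by gcongr; linarith
    have h5 := h3.trans (h2.trans h4)
    linarith
  have h2 : (∑ i, ((N i).totient : ℝ) * |T i|) ^ 2 ≤ (5 * R * X * l ^ 4) ^ 2 := by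
    have h3 := sq_sum_bilinear_le hcop hF hFU hKU hU (X := X) (b := b) (c := c)
      (s := fun i => if 0 ≤ T i then ((N i).totient : ℝ) else -(N i).totient)
      (B := Real.log X) (H := l) (fun i => by
        have : ((N i).totient : ℝ) ≤ N i := by exact_mod_cast Nat.totient_le _
        split_ifs <;> simpa using this) (fun k hk => by
        rw [hb]
        simp only [sub_truncateLE_apply]
        split_ifs
        · simpa using hX
        · rw [abs_of_nonneg ArithmeticFunction.vonMangoldt_nonneg]
          refine ArithmeticFunction.vonMangoldt_le_log.trans (Real.log_le_log ?_ ?_)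
          · exact_mod_cast (mem_Ioc.1 hk).1
          · exact_mod_cast (mem_Ioc.1 hk).2) (fun k hk => by
        rw [hb]
        simp only [sub_truncateLE_apply, if_pos hk])
      (fun k hk => zeta_mul_sub_truncateLE_eq_zero _ hk)
      ((sum_Ioc_inv_le X).trans hl) hX
    have h4 : ∀ i, (if 0 ≤ T i then ((N i).totient : ℝ) else -(N i).totient) * T i =
        (N i).totient * |T i| := by
      intro i
      split_ifs with h
      · rw [abs_of_nonneg h]
      · rw [abs_of_neg (not_le.1 h)]; ring
    have h5 : ∑ m ∈ Ioc 0 X, c m ^ 2 / m ≤ l ^ 4 := by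
      calc _ ≤ ∑ n ∈ Ioc 0 X, (n.divisors.card : ℝ) ^ 2 / n := by
            refine Finset.sum_le_sum fun n _ => ?_
            gcongr ?_ / _
            rw [← sq_abs]
            gcongr
            exact abs_zeta_mul_sub_truncateLE_moebius_le U n
        _ ≤ _ := sum_card_divisors_sq_div_le X
        _ ≤ l ^ 4 := by
            gcongr
            exact (sum_Ioc_inv_le X).trans hl
    calc _ = (∑ i, (if 0 ≤ T i then ((N i).totient : ℝ) else -(N i).totient) * T i) ^ 2 := by
          simp_rw [h4]
      _ ≤ _ := h3
      _ ≤ l ^ 4 * (24 * R ^ 2 * l ^ 2 * X ^ 2 * l) := by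
          gcongr
          linarith
      _ = 24 * (R ^ 2 * X ^ 2) * l ^ 7 := by ring
      _ ≤ 25 * (R ^ 2 * X ^ 2) * l ^ 8 := by
          gcongr <;> norm_num
      _ = _ := by ring
  have h3 := abs_le_of_sq_le_sq h2 (by positivity)
  calc _ ≤ ∑ i, (((N i).totient : ℝ) * |T i| + F * (10 * U ^ 2 * l)) := by
        refine Finset.sum_le_sum fun i _ => ?_
        have h6 : ((N i).totient : ℝ) ≤ F := by
          exact_mod_cast (Nat.totient_le _).trans (hF i)
        calc _ ≤ ((N i).totient : ℝ) * (|T i| + 10 * U ^ 2 * l) := by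
              gcongr
              exact h1 i
          _ = ((N i).totient : ℝ) * |T i| + (N i).totient * (10 * U ^ 2 * l) := by ring
          _ ≤ _ := by gcongr
    _ = _ := by
        rw [Finset.sum_add_distrib, Finset.sum_const, nsmul_eq_mul, card_univ]
    _ ≤ _ := by linarith [(abs_le.1 h3).2]

theorem sum_log_primeFactors_le {N : ℕ} (hN : N ≠ 0) :
    ∑ p ∈ N.primeFactors, Real.log p ≤ Real.log N := by
  rw [← Real.log_prod (fun p hp => by exact_mod_cast (Nat.prime_of_mem_primeFactors hp).ne_zero)]
  refine Real.log_le_log ?_ ?_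
  · exact Finset.prod_pos fun p hp => by exact_mod_cast (Nat.prime_of_mem_primeFactors hp).pos
  · rw [← Nat.cast_prod]
    exact_mod_cast Nat.le_of_dvd (Nat.pos_of_ne_zero hN) (Nat.prod_primeFactors_dvd N)

theorem theta_sub_log_le_sum_coprime {N : ℕ} (hN : N ≠ 0) (X : ℕ) :
    Chebyshev.theta X - Real.log N ≤
      ∑ n ∈ Ioc 0 X with n.Coprime N, (vonMangoldt n : ℝ) := by
  have h1 : Chebyshev.theta X = ∑ p ∈ Ioc 0 X with p.Prime, Real.log p := by
    rw [Chebyshev.theta, Nat.floor_natCast]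
  have h2 : ∑ p ∈ (Ioc 0 X).filter Nat.Prime with ¬ p.Coprime N, Real.log p ≤ Real.log N := by
    refine le_trans ?_ (sum_log_primeFactors_le hN)
    refine Finset.sum_le_sum_of_subset_of_nonneg ?_ fun p _ _ => Real.log_natCast_nonneg p
    intro p hp
    simp only [mem_filter] at hp
    rw [Nat.mem_primeFactors]
    have h := hp.2
    rw [hp.1.2.coprime_iff_not_dvd, not_not] at h
    exact ⟨hp.1.2, h, hN⟩
  have h3 : ∑ p ∈ (Ioc 0 X).filter Nat.Prime with p.Coprime N, Real.log p ≤
      ∑ n ∈ Ioc 0 X with n.Coprime N, (vonMangoldt n : ℝ) := by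
    calc _ = ∑ p ∈ (Ioc 0 X).filter Nat.Prime with p.Coprime N, (vonMangoldt p : ℝ) := by
          refine Finset.sum_congr rfl fun p hp => ?_
          rw [ArithmeticFunction.vonMangoldt_apply_prime (mem_filter.1 (mem_filter.1 hp).1).2]
      _ ≤ _ := by
          refine Finset.sum_le_sum_of_subset_of_nonneg ?_
            fun p _ _ => ArithmeticFunction.vonMangoldt_nonneg
          exact Finset.filter_subset_filter _ (Finset.filter_subset _ _)
  rw [h1, ← Finset.sum_filter_add_sum_filter_not _ (fun p => p.Coprime N)]
  linarith

theorem primeDiscrepancy_eq (X N : ℕ) :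
    primeDiscrepancy X N = ∑ n ∈ Ioc 0 X with n ≡ 1 [MOD N], (vonMangoldt n : ℝ) -
      (N.totient : ℝ)⁻¹ * ∑ n ∈ Ioc 0 X with n.Coprime N, (vonMangoldt n : ℝ) := by
  classical
  rw [primeDiscrepancy, Finset.mul_sum, Finset.sum_filter, Finset.sum_filter,
    ← Finset.sum_sub_distrib]
  refine Finset.sum_congr rfl fun n _ => ?_
  have h1 : ((n : ZMod N) = 1) ↔ n ≡ 1 [MOD N] := by
    rw [← ZMod.natCast_eq_natCast_iff, Nat.cast_one]
  rw [residueDiscrepancy]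
  simp only [Set.indicator_apply, Set.mem_singleton_iff, Set.mem_ofPred_eq,
    ZMod.isUnit_iff_coprime, h1, Pi.one_apply]
  split_ifs <;> ring

theorem sum_modEq_one_le (X N : ℕ) (hX : 1 ≤ X) :
    ∑ n ∈ Ioc 0 X with n ≡ 1 [MOD N], (vonMangoldt n : ℝ) ≤
      ((Ioc 0 X).filter fun p => p.Prime ∧ p ≡ 1 [MOD N]).card * Real.log X +
        2 * √X * Real.log X := by
  have h1 : ∑ n ∈ Ioc 0 X with ¬ n.Prime, (vonMangoldt n : ℝ) ≤ 2 * √X * Real.log X := by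
    have h2 := Chebyshev.psi_sub_theta_eq_sum_not_prime X
    rw [Nat.floor_natCast] at h2
    rw [← h2]
    exact (le_abs_self _).trans
      (Chebyshev.abs_psi_sub_theta_le_sqrt_mul_log (by exact_mod_cast hX))
  rw [← Finset.sum_filter_add_sum_filter_not _ (fun p => p.Prime)]
  refine add_le_add ?_ (le_trans ?_ h1)
  · rw [← nsmul_eq_mul, ← Finset.sum_const, Finset.filter_filter]
    simp_rw [and_comm]
    refine Finset.sum_le_sum fun p hp => ?_
    simp only [mem_filter, mem_Ioc] at hp
    refine ArithmeticFunction.vonMangoldt_le_log.trans (Real.log_le_log ?_ ?_)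
    · exact_mod_cast hp.1.1
    · exact_mod_cast hp.1.2
  · refine Finset.sum_le_sum_of_subset_of_nonneg ?_
      fun p _ _ => ArithmeticFunction.vonMangoldt_nonneg
    exact Finset.filter_subset_filter _ (Finset.filter_subset _ _)

theorem le_mul_card_primes_modEq_one {X N : ℕ} (hX : 2 ≤ X) (hN : N ≠ 0)
    (hE : N.totient * |primeDiscrepancy X N| ≤ X / 8)
    (hsmall : 64 * N * √X * Real.log X ≤ X) :
    (X : ℝ) ≤ 4 * N * Real.log X *
      ((Ioc 0 X).filter fun p => p.Prime ∧ p ≡ 1 [MOD N]).card := by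
  set c : ℝ := (((Ioc 0 X).filter fun p => p.Prime ∧ p ≡ 1 [MOD N]).card : ℝ) with hc
  have hX' : (2 : ℝ) ≤ X := by exact_mod_cast hX
  have hs : 1 ≤ √(X : ℝ) := Real.one_le_sqrt.2 (by linarith)
  have hl2 := Real.log_two_gt_d9
  have hlX : Real.log 2 ≤ Real.log X := Real.log_le_log (by norm_num) hX'
  have hN1 : (1 : ℝ) ≤ N := by exact_mod_cast Nat.one_le_iff_ne_zero.2 hN
  have hlN : Real.log N ≤ N := (Real.log_le_sub_one_of_pos (by linarith)).trans (by linarith)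
  have hlX1 : Real.log (X + 1) ≤ 2 * Real.log X := by
    have : (2 : ℝ) * Real.log X = Real.log ((X : ℝ) ^ 2) := by rw [Real.log_pow]; norm_num
    rw [this]
    exact Real.log_le_log (by linarith) (by nlinarith)
  have hφ : (0 : ℝ) < N.totient := by exact_mod_cast Nat.totient_pos.2 (Nat.pos_of_ne_zero hN)
  have hφN : (N.totient : ℝ) ≤ N := by exact_mod_cast Nat.totient_le N
  have h1 := theta_sub_log_le_sum_coprime hN X
  have h2 := sum_modEq_one_le X N (by omega)
  rw [← hc] at h2
  have h3 := primeDiscrepancy_eq X N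
  have h4 := Chebyshev.theta_ge X
  set S := ∑ n ∈ Ioc 0 X with n.Coprime N, (vonMangoldt n : ℝ)
  set s := √(X : ℝ)
  set l := Real.log (X : ℝ)
  have hw : (0.69 : ℝ) ≤ s * l := by nlinarith
  have h5 : N.totient * primeDiscrepancy X N ≤ N.totient * (c * l + 2 * s * l) - S := by
    rw [h3, mul_sub, mul_inv_cancel_left₀ hφ.ne']
    gcongr
  have h6 : N.totient * (c * l + 2 * s * l) ≤ N * (c * l + 2 * s * l) := by
    have : 0 ≤ c * l + 2 * s * l := by
      have : 0 ≤ c := by positivity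
      have : 0 ≤ l := by linarith
      positivity
    gcongr
  have h7 : -(X / 8 : ℝ) ≤ N.totient * primeDiscrepancy X N := by
    have := neg_abs_le (primeDiscrepancy X N)
    have := mul_le_mul_of_nonneg_left this hφ.le
    linarith
  have h8 : (N : ℝ) ≤ N * (2 * (s * l)) := by nlinarith
  have h9 : s * l ≤ N * (s * l) := by nlinarith
  have h10 : l ≤ s * l := by nlinarith
  nlinarith

theorem exists_subset_prime_not_dvd_sum {r : ℕ} (hr : 2 ≤ r) {H : Finset ℕ}
    (hcard : 2 * r ≤ H.card) (hsq : ∀ a ∈ H, Squarefree a)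
    (hbig : ∀ a ∈ H, ∀ q, q.Prime → q ∣ a → r ≤ q) :
    ∃ R ⊆ H, R.card = r ∧ ∃ q, q.Prime ∧ (∃ a ∈ R, q ∣ a) ∧ ¬ q ∣ ∑ a ∈ R, a := by
  obtain ⟨q, hq, u, hu, v, hv, hqu, hqv⟩ : ∃ q, q.Prime ∧ ∃ u ∈ H, ∃ v ∈ H, q ∣ u ∧ ¬ q ∣ v := by
    obtain ⟨a, ha, b, hb, hab⟩ := Finset.one_lt_card.1 (show 1 < H.card by omega)
    by_contra! h
    exact hab ((Nat.Squarefree.ext_iff (hsq a ha) (hsq b hb)).2 fun p hp =>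
      ⟨h p hp a ha b hb, h p hp b hb a ha⟩)
  have hsum := Finset.card_filter_add_card_filter_not (s := H) (fun a => q ∣ a)
  rcases le_or_gt (r - 1) (H.filter fun a => q ∣ a).card with h | h
  · obtain ⟨R, hR, hRc⟩ := Finset.exists_subset_card_eq h
    have hR' : ∀ a ∈ R, a ∈ H ∧ q ∣ a := fun a ha => mem_filter.1 (hR ha)
    have hvR : v ∉ R := fun h => hqv (hR' v h).2
    obtain ⟨a, ha⟩ := Finset.card_pos.1 (show 0 < R.card by omega)
    refine ⟨insert v R, ?_, ?_, q, hq, ⟨a, by simp [ha], (hR' a ha).2⟩, ?_⟩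
    · intro x hx
      rcases mem_insert.1 hx with rfl | hx
      · exact hv
      · exact (hR' x hx).1
    · rw [card_insert_of_notMem hvR]; omega
    · rw [sum_insert hvR, ← Nat.dvd_add_iff_left (dvd_sum fun a ha => (hR' a ha).2)]
      exact hqv
  · obtain ⟨D, hD, hDc⟩ := Finset.exists_subset_card_eq
      (show r ≤ (H.filter fun a => ¬ q ∣ a).card by omega)
    have hD' : ∀ a ∈ D, a ∈ H ∧ ¬ q ∣ a := fun a ha => mem_filter.1 (hD ha)
    have huD : u ∉ D := fun h => (hD' u h).2 hqu
    obtain ⟨x, hx, hxq⟩ : ∃ x ∈ D, ¬ q ∣ ∑ a ∈ D.erase x, a := by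
      by_contra! h
      have h1 : q ∣ (r - 1) * ∑ a ∈ D, a := by
        have h2 : ∑ x ∈ D, ∑ a ∈ D.erase x, a + ∑ x ∈ D, x = r * ∑ a ∈ D, a := by
          rw [← Finset.sum_add_distrib, ← hDc, ← smul_eq_mul, ← Finset.sum_const]
          exact Finset.sum_congr rfl fun x hx => Finset.sum_erase_add _ _ hx
        have h3 : ∑ x ∈ D, ∑ a ∈ D.erase x, a = (r - 1) * ∑ a ∈ D, a := by
          rw [Nat.sub_mul]; omega
        rw [← h3]
        exact dvd_sum h
      obtain ⟨x, hx⟩ := Finset.card_pos.1 (show 0 < D.card by omega)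
      have h4 := hbig u hu q hq hqu
      rcases hq.dvd_mul.1 h1 with h5 | h5
      · have := Nat.le_of_dvd (by omega) h5
        omega
      · rw [← Finset.sum_erase_add _ _ hx] at h5
        exact (hD' x hx).2 ((Nat.dvd_add_iff_right (h x hx)).2 h5)
    have huD' : u ∉ D.erase x := fun h => huD (mem_of_mem_erase h)
    refine ⟨insert u (D.erase x), ?_, ?_, q, hq, ⟨u, by simp, hqu⟩, ?_⟩
    · intro y hy
      rcases mem_insert.1 hy with rfl | hy
      · exact hu
      · exact (hD' y (mem_of_mem_erase hy)).1
    · rw [card_insert_of_notMem huD', card_erase_of_mem hx]; omega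
    · rw [sum_insert huD', ← Nat.dvd_add_iff_right hqu]
      exact hxq

theorem exists_prod_mul_add_one_eq (R : Finset ℕ) (M : ℕ) :
    ∃ t, ∏ a ∈ R, (a * M + 1) = 1 + M * (∑ a ∈ R, a + M * t) := by
  classical
  induction R using Finset.induction_on with
  | empty => exact ⟨0, by simp⟩
  | insert a R ha ih =>
    obtain ⟨t, ht⟩ := ih
    refine ⟨t + a * (∑ a ∈ R, a + M * t), ?_⟩
    rw [prod_insert ha, ht, sum_insert ha]
    ring

theorem primeFactors_prod_mul_add_one {R : Finset ℕ} {M : ℕ} (hM : 0 < M)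
    (hp : ∀ a ∈ R, (a * M + 1).Prime) :
    (∏ a ∈ R, (a * M + 1)).primeFactors = R.image fun a => a * M + 1 := by
  have hinj : Set.InjOn (fun a => a * M + 1) R := fun a _ b _ h => by
    simpa [hM.ne'] using h
  rw [← Finset.prod_image (f := fun p => p) hinj, Nat.primeFactors_prod]
  simpa using hp

theorem isLehmer_prod {L m r : ℕ} (hL : 0 < L) (hm : 0 < m) {R : Finset ℕ} (hR : R.card = r)
    (hr : 0 < r) (hRL : ∀ a ∈ R, a ∣ L) (hp : ∀ a ∈ R, (a * (L ^ r * m) + 1).Prime)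
    {q : ℕ} (hq : q.Prime) (hqR : ∃ a ∈ R, q ∣ a) (hqS : ¬ q ∣ ∑ a ∈ R, a) {n : ℕ}
    (hn : n = ∏ a ∈ R, (a * (L ^ r * m) + 1)) :
    Squarefree n ∧ n.primeFactors.card = r ∧ n.totient ∣ (n - 1) ^ (r + 1) ∧
      ¬ n.totient ∣ (n - 1) ^ r := by
  set M := L ^ r * m with hM
  have hM0 : 0 < M := by positivity
  clear_value M
  have hinj : Set.InjOn (fun a => a * M + 1) R := fun a _ b _ h => by
    simpa [hM0.ne'] using h
  have hpf := primeFactors_prod_mul_add_one hM0 hp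
  rw [← hn] at hpf
  have hn0 : 0 < n := by rw [hn]; exact Finset.prod_pos fun _ _ => Nat.succ_pos _
  have hrad : ∏ p ∈ n.primeFactors, p = n := by
    rw [hpf, Finset.prod_image hinj, hn]
  have hφ : n.totient = M ^ r * ∏ a ∈ R, a := by
    have h := Nat.totient_mul_prod_primeFactors n
    rw [hrad, mul_comm] at h
    rw [Nat.eq_of_mul_eq_mul_left hn0 h, hpf, Finset.prod_image hinj]
    simp only [Nat.add_sub_cancel]
    rw [Finset.prod_mul_distrib, Finset.prod_const, hR, mul_comm]
  obtain ⟨t, ht⟩ := exists_prod_mul_add_one_eq R M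
  rw [← hn] at ht
  have hn1 : n - 1 = M * (∑ a ∈ R, a + M * t) := by omega
  refine ⟨?_, ?_, ?_, ?_⟩
  · rw [← hrad]
    refine Finset.squarefree_prod_of_pairwise_isCoprime ?_ ?_
    · intro x hx y hy hxy
      exact Nat.coprime_iff_isRelPrime.1 ((Nat.coprime_primes (Nat.prime_of_mem_primeFactors hx)
        (Nat.prime_of_mem_primeFactors hy)).2 hxy)
    · intro p hp
      exact (Nat.prime_of_mem_primeFactors hp).prime.squarefree
  · rw [hpf, Finset.card_image_of_injOn hinj, hR]
  · rw [hφ, hn1, mul_pow, pow_succ M]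
    refine Dvd.dvd.mul_right (Nat.mul_dvd_mul_left _ ?_) _
    calc ∏ a ∈ R, a ∣ ∏ _a ∈ R, L := Finset.prod_dvd_prod_of_dvd _ _ hRL
      _ = L ^ r := by rw [Finset.prod_const, hR]
      _ ∣ M := Dvd.intro _ hM.symm
  · rw [hφ, hn1, mul_pow]
    intro h
    have h1 := Nat.dvd_of_mul_dvd_mul_left (by positivity) h
    obtain ⟨a, ha, hqa⟩ := hqR
    have h2 := hq.dvd_of_dvd_pow ((hqa.trans (Finset.dvd_prod_of_mem _ ha)).trans h1)
    have h3 : q ∣ M := (hqa.trans (hRL a ha)).trans ((dvd_pow_self L hr.ne').trans (Dvd.intro _ hM.symm))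
    exact hqS ((Nat.dvd_add_iff_left (h3.mul_right t)).2 h2)

theorem card_primes_modEq_one_le {X N b K : ℕ} (hb : 0 < b * K) (hN : b * K ≤ N) :
    ((Ioc 0 X).filter fun p => p.Prime ∧ p ≡ 1 [MOD N]).card ≤
      ((Ioc 0 (X / (b * K))).filter fun m => (N * m + 1).Prime ∧ N * m + 1 ≤ X).card := by
  refine le_trans (Finset.card_le_card ?_) (Finset.card_image_le (f := fun m => N * m + 1))
  intro p hp
  simp only [mem_filter, mem_Ioc] at hp
  obtain ⟨⟨-, hpX⟩, hp, hmod⟩ := hp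
  obtain ⟨m, hm⟩ := (Nat.modEq_iff_dvd' hp.one_lt.le).1 hmod.symm
  have hpm : N * m + 1 = p := by have := hp.one_lt; omega
  simp only [mem_image, mem_filter, mem_Ioc]
  refine ⟨m, ⟨⟨?_, ?_⟩, ?_⟩, hpm⟩
  · rcases Nat.eq_zero_or_pos m with rfl | h
    · have := hp.one_lt
      simp at hpm
      omega
    · exact h
  · rw [Nat.le_div_iff_mul_le hb]
    calc m * (b * K) ≤ m * N := Nat.mul_le_mul_left _ hN
      _ ≤ X := by rw [mul_comm]; omega
  · rw [hpm]; exact ⟨hp, hpX⟩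

theorem exists_finset_lehmer {r L D b X : ℕ} {W : ℝ} (hr : 2 ≤ r) (hL : 0 < L) (hb : 0 < b)
    (hD : 0 < D) (hW : 0 < W) {S : Finset ℕ} (hSL : ∀ a ∈ S, a ∣ L)
    (hsq : ∀ a ∈ S, Squarefree a) (hbig : ∀ a ∈ S, ∀ q, q.Prime → q ∣ a → r ≤ q)
    (hba : ∀ a ∈ S, b ≤ a) (haD : ∀ a ∈ S, a ≤ D * b)
    (hprimes : ∀ a ∈ S, (X : ℝ) ≤ 4 * ((a * L ^ r : ℕ) : ℝ) * W *
      ((Ioc 0 X).filter fun p => p.Prime ∧ p ≡ 1 [MOD a * L ^ r]).card)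
    (hcard : 16 * r * D * W ≤ S.card) :
    ∃ Q : Finset ℕ, (∀ n ∈ Q, n ≤ X ^ r ∧ Squarefree n ∧ n.primeFactors.card = r ∧
      n.totient ∣ (n - 1) ^ (r + 1) ∧ ¬ n.totient ∣ (n - 1) ^ r) ∧
      X ≤ L ^ (r + 1) * S.card ^ 2 * Q.card := by
  classical
  set Y := X / (b * L ^ r) with hY
  have hbL : 0 < b * L ^ r := by positivity
  set H : ℕ → Finset ℕ := fun m => S.filter fun a =>
    (a * L ^ r * m + 1).Prime ∧ a * L ^ r * m + 1 ≤ X with hH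
  set G := (Ioc 0 Y).filter fun m => 2 * r ≤ (H m).card with hG
  have hHS : ∀ m a, a ∈ H m → a ∈ S ∧ (a * (L ^ r * m) + 1).Prime ∧ a * (L ^ r * m) + 1 ≤ X := by
    intro m a ha
    rw [← mul_assoc]
    exact mem_filter.1 ha
  have hex : ∀ m : ℕ, ∃ R : Finset ℕ, m ∈ G → R ⊆ H m ∧ R.card = r ∧ ∃ q, q.Prime ∧
      (∃ a ∈ R, q ∣ a) ∧ ¬ q ∣ ∑ a ∈ R, a := by
    intro m
    by_cases hm : m ∈ G
    · obtain ⟨R, hR⟩ := exists_subset_prime_not_dvd_sum hr (mem_filter.1 hm).2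
        (fun a ha => hsq a (hHS m a ha).1) (fun a ha => hbig a (hHS m a ha).1)
      exact ⟨R, fun _ => hR⟩
    · exact ⟨∅, fun h => absurd h hm⟩
  choose R hR using hex
  set f : ℕ → ℕ := fun m => ∏ a ∈ R m, (a * (L ^ r * m) + 1) with hf
  have hGpos : ∀ m ∈ G, 0 < m := fun m hm => (mem_Ioc.1 (mem_filter.1 hm).1).1
  have hbS : ∀ a ∈ S, b * L ^ r ≤ a * L ^ r := fun a ha => Nat.mul_le_mul_right _ (hba a ha)
  have hfiber : ∀ n ∈ G.image f, (G.filter fun m => f m = n).card ≤ S.card := by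
    intro n _
    refine le_trans (Finset.card_le_card ?_)
      (Finset.card_image_le (f := fun a => (n.minFac - 1) / (a * L ^ r)))
    intro m hm
    obtain ⟨hm, hn⟩ := mem_filter.1 hm
    obtain ⟨hRH, hRc, -⟩ := hR m hm
    have hp : ∀ a ∈ R m, (a * (L ^ r * m) + 1).Prime := fun a ha => (hHS m a (hRH ha)).2.1
    have hpf := primeFactors_prod_mul_add_one (Nat.mul_pos (by positivity) (hGpos m hm)) hp
    have hne : n ≠ 1 := by
      rintro rfl
      rw [show (∏ a ∈ R m, (a * (L ^ r * m) + 1)) = 1 from hn, Nat.primeFactors_one] at hpf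
      have := Finset.image_eq_empty.1 hpf.symm
      rw [this] at hRc
      simp at hRc
      omega
    have hmem : n.minFac ∈ n.primeFactors := by
      rw [Nat.mem_primeFactors]
      refine ⟨Nat.minFac_prime hne, Nat.minFac_dvd n, ?_⟩
      rw [← hn]
      exact Finset.prod_ne_zero_iff.2 fun a ha => (hp a ha).ne_zero
    rw [← hn, show (f m).primeFactors = _ from hpf, mem_image] at hmem
    obtain ⟨a, ha, ham⟩ := hmem
    have haS := (hHS m a (hRH ha)).1
    refine mem_image.2 ⟨a, haS, ?_⟩
    have : n.minFac - 1 = a * L ^ r * m := by rw [← hn, ← ham, mul_assoc]; rfl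
    rw [this, Nat.mul_div_cancel_left _ (hbL.trans_le (hbS a haS))]
  refine ⟨G.image f, ?_, ?_⟩
  · intro n hn
    obtain ⟨m, hm, hn⟩ := mem_image.1 hn
    obtain ⟨hRH, hRc, q, hq, hqR, hqS⟩ := hR m hm
    refine ⟨?_, isLehmer_prod hL (hGpos m hm) hRc (by omega)
      (fun a ha => hSL a (hHS m a (hRH ha)).1) (fun a ha => (hHS m a (hRH ha)).2.1)
      hq hqR hqS hn.symm⟩
    rw [← hn, ← hRc, ← Finset.prod_const]
    exact Finset.prod_le_prod' fun a ha => (hHS m a (hRH ha)).2.2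
  have hGQ := Finset.card_le_mul_card_image G S.card hfiber
  have hS0 : 0 < S.card := by
    have : (0 : ℝ) < 16 * r * D * W := by positivity
    exact_mod_cast this.trans_le hcard
  obtain ⟨a₀, ha₀⟩ := Finset.card_pos.1 hS0
  have hlow : (S.card : ℝ) * X ≤ 4 * D * (b * L ^ r) * W * ∑ m ∈ Ioc 0 Y, ((H m).card : ℝ) := by
    have h1 : ∑ m ∈ Ioc 0 Y, (H m).card = ∑ a ∈ S, ((Ioc 0 Y).filter fun m =>
        (a * L ^ r * m + 1).Prime ∧ a * L ^ r * m + 1 ≤ X).card := by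
      simp_rw [hH, Finset.card_filter]
      exact Finset.sum_comm
    rw [← Nat.cast_sum, h1, Nat.cast_sum, Finset.mul_sum, ← nsmul_eq_mul, ← Finset.sum_const]
    refine Finset.sum_le_sum fun a ha => (hprimes a ha).trans ?_
    have h2 : ((a * L ^ r : ℕ) : ℝ) ≤ D * (b * L ^ r) := by
      have : a * L ^ r ≤ D * (b * L ^ r) := by
        rw [← mul_assoc]
        exact Nat.mul_le_mul_right _ (haD a ha)
      exact_mod_cast this
    have h3 := card_primes_modEq_one_le (X := X) hbL (hbS a ha)
    rw [mul_assoc 4 (D : ℝ)]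
    gcongr
  have hup : ∑ m ∈ Ioc 0 Y, (H m).card ≤ G.card * S.card + 2 * r * Y := by
    rw [← Finset.sum_filter_add_sum_filter_not _ (fun m => 2 * r ≤ (H m).card)]
    refine add_le_add ?_ ?_
    · exact Finset.sum_le_card_nsmul _ _ _ fun m _ => Finset.card_filter_le _ _
    · calc _ ≤ ∑ m ∈ (Ioc 0 Y).filter fun m => ¬ 2 * r ≤ (H m).card, 2 * r :=
            Finset.sum_le_sum fun m hm => (not_le.1 (mem_filter.1 hm).2).le
        _ ≤ ∑ m ∈ Ioc 0 Y, 2 * r := Finset.sum_le_sum_of_subset (Finset.filter_subset _ _)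
        _ = _ := by simp [mul_comm]
  have hYX : (Y : ℝ) * (b * L ^ r) ≤ X := by exact_mod_cast Nat.div_mul_le_self X (b * L ^ r)
  have hup' : ∑ m ∈ Ioc 0 Y, ((H m).card : ℝ) ≤ G.card * S.card + 2 * r * Y := by
    exact_mod_cast hup
  have hbL' : (b : ℝ) * L ^ r ≤ L ^ (r + 1) := by
    have : b * L ^ r ≤ L ^ (r + 1) := by
      rw [pow_succ, mul_comm]
      exact Nat.mul_le_mul_left _ ((hba a₀ ha₀).trans (Nat.le_of_dvd hL (hSL a₀ ha₀)))
    exact_mod_cast this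
  have key : (X : ℝ) ≤ b * L ^ r * (G.card * S.card) := by
    have h1 : 16 * r * D * W * X ≤ 4 * D * (b * L ^ r) * W * (G.card * S.card + 2 * r * Y) := by
      calc _ ≤ (S.card : ℝ) * X := by gcongr
        _ ≤ _ := hlow
        _ ≤ _ := by gcongr
    have h2 : (4 * D * W) * (4 * r * X) ≤
        (4 * D * W) * (b * L ^ r * (G.card * S.card + 2 * r * Y)) := by linarith
    have h3 := le_of_mul_le_mul_left h2 (by positivity)
    have h4 : (r : ℝ) * (Y * (b * L ^ r)) ≤ r * X := by gcongr
    have h5 : (1 : ℝ) ≤ r := by exact_mod_cast (by omega : 1 ≤ r)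
    have h6 : (X : ℝ) ≤ r * X := le_mul_of_one_le_left (by positivity) h5
    linarith
  have key' : (X : ℝ) ≤ L ^ (r + 1) * S.card ^ 2 * (G.image f).card := by
    calc (X : ℝ) ≤ b * L ^ r * (G.card * S.card) := key
      _ ≤ L ^ (r + 1) * ((S.card * (G.image f).card) * S.card) := by
          gcongr
          exact_mod_cast hGQ
      _ = _ := by ring
  exact_mod_cast key'

theorem eventually_mul_pow_le_two_pow (C : ℝ) (k : ℕ) :
    ∀ᶠ g : ℕ in Filter.atTop, C * (g : ℝ) ^ k ≤ 2 ^ g := by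
  have h := (isLittleO_pow_const_const_pow_of_one_lt (R := ℝ) k (one_lt_two (α := ℝ))).const_mul_left C
  filter_upwards [h.bound one_pos] with g hg
  rw [one_mul, Real.norm_eq_abs, Real.norm_eq_abs, abs_of_nonneg (by positivity : (0:ℝ) ≤ 2 ^ g)] at hg
  exact (le_abs_self _).trans hg

theorem exists_dyadic_card_primes_ge {g : ℕ} (hg : 1 ≤ g) (h2 : 1000 * g ^ 2 ≤ 2 ^ g) :
    ∃ T ≤ 21 * g, 2 ^ (19 * g) ≤ ((Ico (2 ^ T) (2 ^ (T + 1))).filter Nat.Prime).card := by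
  set n := 2 ^ (21 * g) with hn
  have hcount : n ≤ 42 * g * n.primesLE.card := by
    have h1 := Chebyshev.psi_le_primeCounting_mul_log n
    have h3 := Chebyshev.psi_ge n
    rw [← Nat.primesLE_card_eq_primeCounting] at h1
    have h4 : Real.log n = 21 * g * Real.log 2 := by
      rw [hn]; push_cast; rw [Real.log_pow]; push_cast; ring
    have h5 : Real.log (n + 1) ≤ n * Real.log 2 / 2 := by
      have h6 : Real.log (n + 1) ≤ Real.log 2 + Real.log n := by
        rw [← Real.log_mul (by norm_num) (by positivity)]
        refine Real.log_le_log (by positivity) ?_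
        have : (1 : ℝ) ≤ n := by exact_mod_cast Nat.one_le_two_pow
        linarith
      have h7 : 2 * (21 * g + 1) ≤ n := by
        calc 2 * (21 * g + 1) ≤ 1000 * g ^ 2 := by nlinarith
          _ ≤ 2 ^ g := h2
          _ ≤ n := Nat.pow_le_pow_right (by norm_num) (by omega)
      have h8 : (2 * (21 * g + 1) : ℝ) * Real.log 2 ≤ n * Real.log 2 := by
        gcongr
        exact_mod_cast h7
      linarith
    have h6 : (n : ℝ) * Real.log 2 ≤ 42 * g * n.primesLE.card * Real.log 2 := by
      rw [h4] at h1
      linarith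
    exact_mod_cast le_of_mul_le_mul_right h6 (Real.log_pos one_lt_two)
  by_contra! h
  have h6 : n.primesLE ⊆ (range (21 * g + 1)).biUnion fun T =>
      (Ico (2 ^ T) (2 ^ (T + 1))).filter Nat.Prime := by
    intro p hp
    rw [Nat.mem_primesLE] at hp
    simp only [mem_biUnion, mem_range, mem_filter, mem_Ico]
    refine ⟨Nat.log 2 p, ?_, ⟨Nat.pow_log_le_self 2 hp.2.ne_zero,
      Nat.lt_pow_succ_log_self one_lt_two p⟩, hp.2⟩
    have := Nat.log_mono_right (b := 2) hp.1
    rw [hn, Nat.log_pow one_lt_two] at this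
    omega
  have h7 := (Finset.card_le_card h6).trans Finset.card_biUnion_le
  have h8 := h7.trans (Finset.sum_le_card_nsmul _ _ (2 ^ (19 * g)) fun T hT =>
    (h T (by rw [mem_range] at hT; omega)).le)
  rw [card_range, smul_eq_mul] at h8
  have h9 : n = 2 ^ (19 * g) * (2 ^ g * 2 ^ g) := by
    rw [hn, ← pow_add, ← pow_add]; congr 1; ring
  have h10 : 2 ^ (19 * g) * (2 ^ g * 2 ^ g) ≤ 2 ^ (19 * g) * (42 * g * (21 * g + 1)) := by
    rw [← h9]
    calc n ≤ _ := hcount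
      _ ≤ 42 * g * ((21 * g + 1) * 2 ^ (19 * g)) := by gcongr
      _ = _ := by ring
  have h11 := Nat.le_of_mul_le_mul_left h10 (by positivity)
  have h12 := (Nat.mul_le_mul h2 h2).trans h11
  have h13 : g ≤ g ^ 2 := Nat.le_self_pow two_ne_zero g
  have h14 : 1 ≤ g ^ 2 := Nat.one_le_pow _ _ hg
  nlinarith

theorem exists_forall_totient_mul_abs_primeDiscrepancy_le {κ α : Type*} [Fintype κ]
    {𝒜 : Finset α} {N : κ → α → ℕ} {g P X : ℕ} (hN : ∀ i, ∀ A ∈ 𝒜, N i A ≠ 0)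
    (hcop : ∀ A ∈ 𝒜, Pairwise fun i j => (N i A).Coprime (N j A))
    (hP : ∀ i, ∀ A ∈ 𝒜, N i A ≤ 2 ^ P) (hκ : Fintype.card κ = 2 ^ (18 * g))
    (h𝒜 : 𝒜.card ≤ 2 ^ (4 * g)) (hg : 80 ≤ 2 ^ g) (hl : 1 + Real.log X ≤ 2 ^ g)
    (hX : 2 ^ (41 * g + 5 * P + 8) ≤ X) :
    ∃ i, ∀ A ∈ 𝒜, (N i A).totient * |primeDiscrepancy X (N i A)| ≤ (X : ℝ) / 8 := by
  classical
  set y : ℝ := 2 ^ g with hy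
  set F : ℝ := 2 ^ P with hF
  have hy80 : 80 ≤ y := by rw [hy]; exact_mod_cast hg
  have hκ' : (Fintype.card κ : ℝ) = y ^ 18 := by
    rw [hκ, hy]; push_cast; rw [← pow_mul, mul_comm]
  have h𝒜' : (𝒜.card : ℝ) ≤ y ^ 4 := by
    rw [hy, ← pow_mul, mul_comm]; exact_mod_cast h𝒜
  have hX' : 256 * y ^ 41 * F ^ 5 ≤ X := by
    have : ((2 ^ (41 * g + 5 * P + 8) : ℕ) : ℝ) ≤ X := by exact_mod_cast hX
    refine le_trans (le_of_eq ?_) this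
    rw [hy, hF]; push_cast; rw [pow_add, pow_add, ← pow_mul, ← pow_mul]; norm_num; ring
  have hF1 : 1 ≤ F := one_le_pow₀ (by norm_num)
  have hA : ∀ A ∈ 𝒜, ∑ i, ((N i A).totient : ℝ) * |primeDiscrepancy X (N i A)| ≤
      5 * y ^ 13 * X + 10 * y ^ 55 * F ^ 5 := by
    intro A hA
    have : ∀ i, NeZero (N i A) := fun i => ⟨hN i A hA⟩
    have h := sum_totient_mul_abs_primeDiscrepancy_le (hcop A hA) (fun i => hP i A hA)
      (U := 2 ^ (18 * g) * (2 ^ P) ^ 2) (X := X) (R := y ^ 9) (l := y) ?_ ?_ (by positivity)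
      (by positivity) (by rw [hκ']; exact le_of_eq (by ring)) hl
    · refine h.trans (le_of_eq ?_)
      rw [hκ']
      push_cast
      rw [show (2 : ℝ) ^ (18 * g) = y ^ 18 by rw [hy, ← pow_mul, mul_comm], ← hF]
      ring
    · calc 2 ^ P ≤ (2 ^ P) ^ 2 := Nat.le_self_pow two_ne_zero _
        _ ≤ _ := Nat.le_mul_of_pos_left _ (by positivity)
    · rw [hκ]
  by_contra! h
  have h1 : ∀ i, (X : ℝ) / 8 ≤ ∑ A ∈ 𝒜, ((N i A).totient : ℝ) * |primeDiscrepancy X (N i A)| := by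
    intro i
    obtain ⟨A, hA, hlt⟩ := h i
    refine hlt.le.trans (Finset.single_le_sum
      (f := fun A => ((N i A).totient : ℝ) * |primeDiscrepancy X (N i A)|) (fun A _ => ?_) hA)
    positivity
  have h2 : y ^ 18 * (X / 8 : ℝ) ≤ y ^ 4 * (5 * y ^ 13 * X + 10 * y ^ 55 * F ^ 5) := by
    calc y ^ 18 * (X / 8 : ℝ) = ∑ _i : κ, (X / 8 : ℝ) := by
          rw [Finset.sum_const, nsmul_eq_mul, card_univ, hκ']
      _ ≤ ∑ i, ∑ A ∈ 𝒜, ((N i A).totient : ℝ) * |primeDiscrepancy X (N i A)| :=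
          Finset.sum_le_sum fun i _ => h1 i
      _ = ∑ A ∈ 𝒜, ∑ i, ((N i A).totient : ℝ) * |primeDiscrepancy X (N i A)| := Finset.sum_comm
      _ ≤ ∑ A ∈ 𝒜, (5 * y ^ 13 * X + 10 * y ^ 55 * F ^ 5) := Finset.sum_le_sum hA
      _ ≤ _ := by
          rw [Finset.sum_const, nsmul_eq_mul]
          gcongr
  have hXpos : 0 < (X : ℝ) := lt_of_lt_of_le (by positivity) hX'
  have h3 : y ^ 18 * (10 * (256 * y ^ 41 * F ^ 5)) ≤ y ^ 18 * (10 * X) := by gcongr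
  have h4 : y ^ 17 * X * 80 ≤ y ^ 17 * X * y := by gcongr
  have h5 : 0 < y ^ 18 * X := by positivity
  nlinarith

theorem primeFactors_prod_of_injective {ι : Type*} {s : ι → ℕ} (hs : ∀ t, (s t).Prime)
    (hinj : Function.Injective s) (A : Finset ι) :
    (∏ t ∈ A, s t).primeFactors = A.image s := by
  rw [← Finset.prod_image (f := fun p => p) (g := s) hinj.injOn, Nat.primeFactors_prod]
  simpa using fun t _ => hs t

theorem squarefree_prod_of_injective {ι : Type*} {s : ι → ℕ} (hs : ∀ t, (s t).Prime)
    (hinj : Function.Injective s) (A : Finset ι) : Squarefree (∏ t ∈ A, s t) :=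
  Finset.squarefree_prod_of_pairwise_isCoprime
    (fun x _ y _ hxy => Nat.coprime_iff_isRelPrime.1
      ((Nat.coprime_primes (hs x) (hs y)).2 (hinj.ne hxy)))
    fun t _ => (hs t).prime.squarefree

theorem prod_injective_of_injective {ι : Type*} {s : ι → ℕ} (hs : ∀ t, (s t).Prime)
    (hinj : Function.Injective s) : Function.Injective fun A : Finset ι => ∏ t ∈ A, s t := by
  intro A B h
  have h1 := congrArg Nat.primeFactors h
  simp only [primeFactors_prod_of_injective hs hinj] at h1
  exact Finset.image_injective hinj h1

theorem exists_lehmer_of_scale {r g X : ℕ} (hr : 2 ≤ r) (hg : 1 ≤ g)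
    (hg2 : 1000 * g ^ 2 ≤ 2 ^ g) (hgr : 64 * r * g ≤ 2 ^ g) (hX2 : 2 ≤ X)
    (hl : 1 + Real.log X ≤ 2 ^ g) (hX : 2 ^ (1000 * (r + 1) * g ^ 2) ≤ X) :
    ∃ Q : Finset ℕ, (∀ n ∈ Q, n ≤ X ^ r ∧ Squarefree n ∧ n.primeFactors.card = r ∧
      n.totient ∣ (n - 1) ^ (r + 1) ∧ ¬ n.totient ∣ (n - 1) ^ r) ∧
      X ≤ 2 ^ (1000 * (r + 1) * g ^ 2) * Q.card := by
  classical
  have hgg : g ≤ g ^ 2 := Nat.le_self_pow two_ne_zero g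
  obtain ⟨T, hT, hTc⟩ := exists_dyadic_card_primes_ge hg hg2
  set Pr := (Ico (2 ^ T) (2 ^ (T + 1))).filter Nat.Prime with hPr
  have hT19 : 2 ^ (19 * g) ≤ 2 ^ T := by
    refine hTc.trans ((Finset.card_filter_le _ _).trans ?_)
    rw [Nat.card_Ico, pow_succ]; omega
  have hrT : r ≤ 2 ^ T := by
    calc r ≤ 64 * r * g := by nlinarith
      _ ≤ 2 ^ g := hgr
      _ ≤ 2 ^ (19 * g) := Nat.pow_le_pow_right (by norm_num) (by omega)
      _ ≤ _ := hT19
  obtain ⟨e⟩ : Nonempty (Fin (2 ^ (18 * g)) × Fin (4 * g) ↪ Pr) := by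
    refine Function.Embedding.nonempty_of_card_le ?_
    rw [Fintype.card_prod, Fintype.card_fin, Fintype.card_fin, Fintype.card_coe]
    calc 2 ^ (18 * g) * (4 * g) ≤ 2 ^ (18 * g) * 2 ^ g := by
          gcongr
          nlinarith
      _ = 2 ^ (19 * g) := by rw [← pow_add]; congr 1; ring
      _ ≤ _ := hTc
  set s : Fin (2 ^ (18 * g)) → Fin (4 * g) → ℕ := fun i t => (e (i, t) : ℕ) with hs
  have hsPr : ∀ i t, s i t ∈ Pr := fun i t => (e (i, t)).2
  have hsp : ∀ i t, (s i t).Prime := fun i t => (mem_filter.1 (hsPr i t)).2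
  have hslo : ∀ i t, 2 ^ T ≤ s i t := fun i t => (mem_Ico.1 (mem_filter.1 (hsPr i t)).1).1
  have hshi : ∀ i t, s i t ≤ 2 ^ (T + 1) :=
    fun i t => (mem_Ico.1 (mem_filter.1 (hsPr i t)).1).2.le
  have hsinj : ∀ i, Function.Injective (s i) := fun i t u h => by
    have := e.injective (Subtype.ext h)
    simpa using this
  have hsne : ∀ i j t u, i ≠ j → s i t ≠ s j u := fun i j t u hij h => by
    have := e.injective (Subtype.ext h)
    simp only [Prod.mk.injEq] at this
    exact hij this.1
  set L : Fin (2 ^ (18 * g)) → ℕ := fun i => ∏ t, s i t with hL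
  set a : Fin (2 ^ (18 * g)) → Finset (Fin (4 * g)) → ℕ := fun i A => ∏ t ∈ A, s i t with ha
  set 𝒜 := Finset.powersetCard (2 * g) (univ : Finset (Fin (4 * g))) with h𝒜
  have h𝒜card : 𝒜.card = (2 * g).centralBinom := by
    rw [h𝒜, card_powersetCard, card_univ, Fintype.card_fin, Nat.centralBinom]
    congr 1; ring
  have h𝒜le : 𝒜.card ≤ 2 ^ (4 * g) := by
    rw [h𝒜, card_powersetCard, card_univ, Fintype.card_fin]
    exact Nat.choose_le_two_pow _ _
  have hLpos : ∀ i, 0 < L i := fun i => Finset.prod_pos fun t _ => (hsp i t).pos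
  have haL : ∀ i A, a i A ∣ L i := fun i A =>
    Finset.prod_dvd_prod_of_subset _ _ _ (Finset.subset_univ _)
  have hLle : ∀ i, L i ≤ 2 ^ (88 * g ^ 2) := by
    intro i
    calc L i ≤ ∏ _t : Fin (4 * g), 2 ^ (T + 1) := Finset.prod_le_prod' fun t _ => hshi i t
      _ = 2 ^ ((T + 1) * (4 * g)) := by
          rw [Finset.prod_const, card_univ, Fintype.card_fin, ← pow_mul]
      _ ≤ _ := Nat.pow_le_pow_right (by norm_num) (by nlinarith)
  have hLr : ∀ i, L i ^ (r + 1) ≤ 2 ^ (88 * (r + 1) * g ^ 2) := by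
    intro i
    calc L i ^ (r + 1) ≤ (2 ^ (88 * g ^ 2)) ^ (r + 1) := Nat.pow_le_pow_left (hLle i) _
      _ = _ := by rw [← pow_mul]; congr 1; ring
  have hNdvd : ∀ i A, a i A * L i ^ r ∣ L i ^ (r + 1) := fun i A => by
    rw [pow_succ, mul_comm]
    exact Nat.mul_dvd_mul_left _ (haL i A)
  have hNle : ∀ i A, a i A * L i ^ r ≤ 2 ^ (88 * (r + 1) * g ^ 2) := fun i A =>
    (Nat.le_of_dvd (pow_pos (hLpos i) _) (hNdvd i A)).trans (hLr i)
  have hapos : ∀ i A, 0 < a i A := fun i A => Nat.pos_of_dvd_of_pos (haL i A) (hLpos i)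
  have hNne : ∀ i A, a i A * L i ^ r ≠ 0 := fun i A =>
    (Nat.mul_pos (hapos i A) (pow_pos (hLpos i) _)).ne'
  have hLcop : Pairwise fun i j => (L i).Coprime (L j) := fun i j hij =>
    Nat.Coprime.prod_left fun t _ => Nat.Coprime.prod_right fun u _ =>
      (Nat.coprime_primes (hsp i t) (hsp j u)).2 (hsne i j t u hij)
  obtain ⟨i, hi⟩ := exists_forall_totient_mul_abs_primeDiscrepancy_le
    (N := fun i A => a i A * L i ^ r) (𝒜 := 𝒜) (X := X) (g := g) (P := 88 * (r + 1) * g ^ 2)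
    (fun i A _ => hNne i A)
    (fun A _ i j hij => Nat.Coprime.coprime_dvd_left (hNdvd i A)
      (Nat.Coprime.coprime_dvd_right (hNdvd j A) ((hLcop hij).pow _ _)))
    (fun i A _ => hNle i A) (Fintype.card_fin _) h𝒜le (by nlinarith) hl
    ((Nat.pow_le_pow_right (by norm_num) (by nlinarith)).trans hX)
  have haT : ∀ A ∈ 𝒜, 2 ^ (T * (2 * g)) ≤ a i A ∧ a i A ≤ 2 ^ (2 * g) * 2 ^ (T * (2 * g)) := by
    intro A hA
    rw [mem_powersetCard] at hA
    constructor
    · rw [pow_mul, ← hA.2, ← Finset.prod_const]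
      exact Finset.prod_le_prod' fun t _ => hslo i t
    · rw [← pow_add, show 2 * g + T * (2 * g) = (T + 1) * (2 * g) by ring, pow_mul]
      rw [← hA.2, ← Finset.prod_const]
      exact Finset.prod_le_prod' fun t _ => hshi i t
  set S := 𝒜.image (a i) with hS
  have hScard : S.card = 𝒜.card :=
    Finset.card_image_of_injective _ (prod_injective_of_injective (hsp i) (hsinj i))
  have hlpos : 0 < Real.log X := Real.log_pos (by exact_mod_cast hX2)
  have hy : (64 * r * g : ℝ) ≤ 2 ^ g := by exact_mod_cast hgr
  obtain ⟨Q, hQ, hXQ⟩ := exists_finset_lehmer (S := S) (X := X) (L := L i) (W := Real.log X)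
    (D := 2 ^ (2 * g)) (b := 2 ^ (T * (2 * g))) hr (hLpos i) (by positivity) (by positivity) hlpos
    (fun b hb => by
      obtain ⟨A, -, rfl⟩ := mem_image.1 hb
      exact haL i A)
    (fun b hb => by
      obtain ⟨A, -, rfl⟩ := mem_image.1 hb
      exact squarefree_prod_of_injective (hsp i) (hsinj i) A)
    (fun b hb q hq hqb => by
      obtain ⟨A, -, rfl⟩ := mem_image.1 hb
      have h1 : q ∈ (a i A).primeFactors :=
        Nat.mem_primeFactors.2 ⟨hq, hqb, (hapos i A).ne'⟩
      rw [ha, primeFactors_prod_of_injective (hsp i) (hsinj i), mem_image] at h1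
      obtain ⟨t, -, rfl⟩ := h1
      exact hrT.trans (hslo i t))
    (fun b hb => by
      obtain ⟨A, hA, rfl⟩ := mem_image.1 hb
      exact (haT A hA).1)
    (fun b hb => by
      obtain ⟨A, hA, rfl⟩ := mem_image.1 hb
      exact (haT A hA).2)
    (fun b hb => by
      obtain ⟨A, hA, rfl⟩ := mem_image.1 hb
      refine le_mul_card_primes_modEq_one hX2 (hNne i A) (hi A hA) ?_
      have hN : ((a i A * L i ^ r : ℕ) : ℝ) ≤ 2 ^ (88 * (r + 1) * g ^ 2) := by
        exact_mod_cast hNle i A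
      have hroot : (64 * 2 ^ (88 * (r + 1) * g ^ 2) * 2 ^ g : ℝ) ≤ √X := by
        refine Real.le_sqrt_of_sq_le ?_
        refine le_trans ?_ (show ((2 ^ (1000 * (r + 1) * g ^ 2) : ℕ) : ℝ) ≤ X by exact_mod_cast hX)
        push_cast
        rw [show (64 : ℝ) = 2 ^ 6 by norm_num, ← pow_add, ← pow_add, ← pow_mul]
        exact pow_le_pow_right₀ (by norm_num) (by nlinarith)
      calc 64 * ((a i A * L i ^ r : ℕ) : ℝ) * √X * Real.log X
          ≤ 64 * 2 ^ (88 * (r + 1) * g ^ 2) * √X * 2 ^ g := by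
            gcongr
            linarith
        _ = (64 * 2 ^ (88 * (r + 1) * g ^ 2) * 2 ^ g) * √X := by ring
        _ ≤ √X * √X := by gcongr
        _ = X := Real.mul_self_sqrt (by positivity))
    (by
      rw [hScard, h𝒜card]
      have h1 := Nat.four_pow_le_two_mul_self_mul_centralBinom (2 * g) (by omega)
      have h2 : ((2 : ℝ) ^ g) ^ 4 ≤ 4 * g * (2 * g).centralBinom := by
        have h3 : ((4 ^ (2 * g) : ℕ) : ℝ) ≤ ((2 * (2 * g) * (2 * g).centralBinom : ℕ) : ℝ) := by
          exact_mod_cast h1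
        push_cast at h3
        refine le_trans (le_of_eq ?_) (h3.trans (le_of_eq (by ring)))
        rw [show (4 : ℝ) = 2 ^ 2 by norm_num, ← pow_mul, ← pow_mul]
        congr 1; ring
      have hg0 : (0 : ℝ) < 4 * g := by positivity
      refine le_of_mul_le_mul_left (le_trans ?_ h2) hg0
      push_cast
      calc (4 * g : ℝ) * (16 * r * 2 ^ (2 * g) * Real.log X)
          ≤ 4 * g * (16 * r * 2 ^ (2 * g) * 2 ^ g) := by
            gcongr
            linarith
        _ = 64 * r * g * (2 ^ g) ^ 3 := by rw [mul_comm 2 g, pow_mul]; ring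
        _ ≤ 2 ^ g * (2 ^ g) ^ 3 := by gcongr
        _ = _ := by ring)
  refine ⟨Q, hQ, hXQ.trans ?_⟩
  gcongr
  rw [hScard]
  calc L i ^ (r + 1) * 𝒜.card ^ 2 ≤ 2 ^ (88 * (r + 1) * g ^ 2) * (2 ^ (4 * g)) ^ 2 :=
        Nat.mul_le_mul (hLr i) (Nat.pow_le_pow_left h𝒜le _)
    _ = 2 ^ (88 * (r + 1) * g ^ 2 + 8 * g) := by rw [← pow_mul, ← pow_add]; congr 1; ring
    _ ≤ _ := Nat.pow_le_pow_right (by norm_num) (by nlinarith)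

theorem eventually_exists_lehmer {r : ℕ} (hr : 2 ≤ r) {δ : ℝ} (hδ : 0 < δ) (hδ1 : δ ≤ 1) :
    ∀ᶠ X : ℕ in Filter.atTop, ∃ Q : Finset ℕ, (∀ n ∈ Q, n ≤ X ^ r ∧ Squarefree n ∧
      n.primeFactors.card = r ∧ n.totient ∣ (n - 1) ^ (r + 1) ∧ ¬ n.totient ∣ (n - 1) ^ r) ∧
      (X : ℝ) ^ (1 - δ) ≤ Q.card := by
  set g : ℕ → ℕ := fun X => Nat.clog 2 ⌈1 + Real.log X⌉₊ with hg
  have hup : ∀ X : ℕ, 1 + Real.log X ≤ 2 ^ g X := fun X => by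
    refine (Nat.le_ceil _).trans ?_
    exact_mod_cast Nat.le_pow_clog one_lt_two _
  have hlog : Filter.Tendsto (fun X : ℕ => Real.log X) Filter.atTop Filter.atTop :=
    Real.tendsto_log_atTop.comp tendsto_natCast_atTop_atTop
  have hgtop : Filter.Tendsto g Filter.atTop Filter.atTop := by
    refine Filter.tendsto_atTop.2 fun G => ?_
    filter_upwards [hlog.eventually_ge_atTop (2 ^ G)] with X hX
    by_contra! h
    have h1 : (2 : ℝ) ^ g X ≤ 2 ^ G := pow_le_pow_right₀ one_le_two h.le
    linarith [hup X]
  filter_upwards [Filter.eventually_ge_atTop 2, hlog.eventually_gt_atTop 0,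
    hgtop.eventually (eventually_mul_pow_le_two_pow 1000 2),
    hgtop.eventually (eventually_mul_pow_le_two_pow (64 * r) 1),
    hgtop.eventually (eventually_mul_pow_le_two_pow (4 * (1000 * (r + 1)) / δ) 2),
    hgtop.eventually_ge_atTop 3] with X hX2 hX0 h1 h2 h3 h4
  have hlow : (2 : ℝ) ^ g X ≤ 4 + 2 * Real.log X := by
    have h5 : 1 < ⌈1 + Real.log X⌉₊ := Nat.lt_ceil.2 (by push_cast; linarith)
    have h6 := Nat.pow_pred_clog_lt_self one_lt_two h5
    have h7 := Nat.ceil_lt_add_one (show 0 ≤ 1 + Real.log X by linarith)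
    have h8 : ((2 ^ (g X).pred : ℕ) : ℝ) < ⌈1 + Real.log X⌉₊ := by exact_mod_cast h6
    have h9 : (2 : ℝ) ^ g X = 2 * 2 ^ (g X).pred := by
      rw [← pow_succ', ← Nat.succ_eq_add_one, Nat.succ_pred_eq_of_pos (by omega)]
    push_cast at h8
    rw [h9]
    linarith
  have hXpos : (0 : ℝ) < X := by positivity
  have hsmall : ((2 ^ (1000 * (r + 1) * g X ^ 2) : ℕ) : ℝ) ≤ (X : ℝ) ^ δ := by
    push_cast
    rw [← Real.log_le_log_iff (by positivity) (by positivity), Real.log_pow,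
      Real.log_rpow hXpos]
    push_cast
    have h8 : (8 : ℝ) ≤ 2 ^ g X := by
      calc (8 : ℝ) = 2 ^ 3 := by norm_num
        _ ≤ _ := pow_le_pow_right₀ one_le_two h4
    have h9 : Real.log 2 ≤ 1 := by linarith [Real.log_two_lt_d9]
    have h10 : (1000 * (r + 1) * g X ^ 2 : ℝ) ≤ δ * (2 ^ g X / 4) := by
      rw [div_mul_eq_mul_div, div_le_iff₀ hδ] at h3
      linarith
    calc (1000 * (r + 1) * g X ^ 2 : ℝ) * Real.log 2 ≤ 1000 * (r + 1) * g X ^ 2 * 1 := by gcongr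
      _ ≤ δ * (2 ^ g X / 4) := by rw [mul_one]; exact h10
      _ ≤ _ := by
        gcongr
        linarith
  obtain ⟨Q, hQ, hXQ⟩ := exists_lehmer_of_scale (g := g X) hr (by omega) (by exact_mod_cast h1)
    (by rw [pow_one] at h2; exact_mod_cast h2) hX2 (hup X) (by
      have h5 : (X : ℝ) ^ δ ≤ X := by
        calc (X : ℝ) ^ δ ≤ (X : ℝ) ^ (1 : ℝ) :=
              Real.rpow_le_rpow_of_exponent_le (by exact_mod_cast (by omega : 1 ≤ X)) hδ1
          _ = X := Real.rpow_one _
      exact_mod_cast hsmall.trans h5)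
  refine ⟨Q, hQ, ?_⟩
  rw [Real.rpow_sub hXpos, Real.rpow_one, div_le_iff₀ (by positivity)]
  have h6 : (X : ℝ) ≤ ((2 ^ (1000 * (r + 1) * g X ^ 2) : ℕ) : ℝ) * Q.card := by exact_mod_cast hXQ
  rw [mul_comm]
  exact h6.trans (by gcongr)

/-- For every `k ≥ 3`, the count up to `x` of squarefree `n` with exactly `k - 1`
distinct prime factors satisfying `φ n ∣ (n - 1) ^ k` but `φ n ∤ (n - 1) ^ (k - 1)`
is at least `x ^ (1 / (k - 1) + o(1))` as `x → ∞`. -/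
theorem kLehmer_count_lower_bound (k : ℕ) (hk : 3 ≤ k) :
    ∀ ε : ℝ, 0 < ε → ∃ x₀ : ℝ, ∀ x : ℝ, x₀ ≤ x →
      x ^ ((1 : ℝ) / (k - 1 : ℝ) - ε) ≤
        (Nat.card {n : ℕ | (n : ℝ) ≤ x ∧ Squarefree n ∧ n.primeFactors.card = k - 1 ∧
          Nat.totient n ∣ (n - 1) ^ k ∧ ¬ Nat.totient n ∣ (n - 1) ^ (k - 1)} : ℝ) := by
  intro ε hε
  obtain ⟨r, rfl⟩ : ∃ r, k = r + 1 := ⟨k - 1, by omega⟩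
  have hr : 2 ≤ r := by omega
  have hr0 : (0 : ℝ) < r := by positivity
  set δ : ℝ := min 1 (ε / 2) with hδ
  have hδ0 : 0 < δ := lt_min one_pos (by positivity)
  have hδε : δ ≤ ε / 2 := min_le_right _ _
  have hfloor : Filter.Tendsto (fun x : ℝ => ⌊x ^ ((1 : ℝ) / r)⌋₊) Filter.atTop Filter.atTop :=
    tendsto_nat_floor_atTop.comp (tendsto_rpow_atTop (by positivity))
  rw [← Filter.eventually_atTop]
  filter_upwards [hfloor.eventually (eventually_exists_lehmer hr hδ0 (min_le_left _ _)),
    Filter.eventually_ge_atTop 1,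
    (tendsto_rpow_atTop (show 0 < ε / 2 by positivity)).eventually_ge_atTop 2] with x hx hx1 hx2
  obtain ⟨Q, hQ, hQc⟩ := hx
  set y : ℝ := x ^ ((1 : ℝ) / r) with hy
  have hx0 : 0 < x := by linarith
  have hy1 : 1 ≤ y := Real.one_le_rpow hx1 (by positivity)
  have hyx : y ^ r = x := by
    rw [hy, ← Real.rpow_natCast, ← Real.rpow_mul hx0.le, one_div_mul_cancel hr0.ne', Real.rpow_one]
  have hsub : (Q : Set ℕ) ⊆ {n : ℕ | (n : ℝ) ≤ x ∧ Squarefree n ∧ n.primeFactors.card = r + 1 - 1 ∧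
      Nat.totient n ∣ (n - 1) ^ (r + 1) ∧ ¬ Nat.totient n ∣ (n - 1) ^ (r + 1 - 1)} := by
    intro n hn
    obtain ⟨hnX, h⟩ := hQ n hn
    refine ⟨?_, h⟩
    calc (n : ℝ) ≤ (⌊y⌋₊ : ℝ) ^ r := by exact_mod_cast hnX
      _ ≤ y ^ r := by gcongr; exact Nat.floor_le (by linarith)
      _ = x := hyx
  have hfin : {n : ℕ | (n : ℝ) ≤ x ∧ Squarefree n ∧ n.primeFactors.card = r + 1 - 1 ∧
      Nat.totient n ∣ (n - 1) ^ (r + 1) ∧ ¬ Nat.totient n ∣ (n - 1) ^ (r + 1 - 1)}.Finite :=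
    (Set.finite_Iic ⌊x⌋₊).subset fun n hn => Nat.le_floor hn.1
  have hcard := Set.ncard_le_ncard hsub hfin
  rw [Set.ncard_coe_finset] at hcard
  have hfl : y / 2 ≤ (⌊y⌋₊ : ℝ) := by
    have h1 := Nat.lt_floor_add_one y
    have h2 : (1 : ℝ) ≤ ⌊y⌋₊ := by exact_mod_cast Nat.one_le_floor_iff y |>.2 hy1
    linarith
  calc x ^ ((1 : ℝ) / ((r + 1 : ℕ) - 1 : ℝ) - ε) = x ^ ((1 : ℝ) / r - ε) := by
        push_cast; rw [add_sub_cancel_right]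
    _ ≤ x ^ ((1 : ℝ) / r * (1 - δ) - ε / 2) := by
        refine Real.rpow_le_rpow_of_exponent_le hx1 ?_
        have h1 : (1 : ℝ) / r * δ ≤ 1 * (ε / 2) := by
          gcongr
          rw [div_le_one hr0]
          exact_mod_cast (by omega : 1 ≤ r)
        linarith
    _ = y ^ (1 - δ) / x ^ (ε / 2) := by
        rw [Real.rpow_sub hx0, Real.rpow_mul hx0.le]
    _ ≤ y ^ (1 - δ) / 2 ^ (1 - δ) := by
        have h1 : (2 : ℝ) ^ (1 - δ) ≤ 2 := by
          calc (2 : ℝ) ^ (1 - δ) ≤ 2 ^ (1 : ℝ) :=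
                Real.rpow_le_rpow_of_exponent_le one_le_two (by linarith)
            _ = 2 := Real.rpow_one _
        gcongr
        exact h1.trans hx2
    _ = (y / 2) ^ (1 - δ) := (Real.div_rpow (by linarith) two_pos.le _).symm
    _ ≤ (⌊y⌋₊ : ℝ) ^ (1 - δ) := by
        have : 0 ≤ 1 - δ := sub_nonneg.2 (min_le_left _ _)
        gcongr
    _ ≤ Q.card := hQc
    _ ≤ _ := by exact_mod_cast hcard
end
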